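/- Let l divide n and let χ be associated to the even nilpotent element of Q(n) all of whose Jordan blocks have size l. Then, under the Harish-Chandra embedding ϑ and the identification U(g_0) ≅ U(Q(n/l))^{⊗l}, the finite W-algebra W_χ maps isomorphically onto the image of Y(Q(n/l)) under ev^{⊗l}∘Δ_l; that is, ϑ(W_χ) = ev^{⊗l}∘Δ_l(Y(Q(n/l))). -/

import Mathlib

noncomputable section
open scoped Classical

/-! # The universal enveloping superalgebra `U(Q(n))` of the queer Lie superalgebra

`U(Q(n))` is presented by even generators `e i j` and odd generators `f i j`
(`1 ≤ i,j ≤ n`) subject to the relations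
`[e i j, e k l] = δ_{jk} e i l - δ_{li} e k j`,
`[e i j, f k l] = δ_{jk} f i l - δ_{li} f k j`,
`f i j * f k l + f k l * f i j = δ_{jk} e i l + δ_{li} e k j`. -/

/-- Generators of `U(Q(n))`: `E i j` (even) and `F i j` (odd). -/
inductive QGen (n : ℕ) : Type
  | E : Fin n → Fin n → QGen n
  | F : Fin n → Fin n → QGen n

/-- Kronecker delta. -/
def kd {n : ℕ} (i j : Fin n) : ℂ := if i = j then 1 else 0

/-- The defining relations of `U(Q(n))`. -/
inductive QRel (n : ℕ) : FreeAlgebra ℂ (QGen n) → FreeAlgebra ℂ (QGen n) → Prop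
  | ee (i j k l : Fin n) : QRel n
      (FreeAlgebra.ι ℂ (QGen.E i j) * FreeAlgebra.ι ℂ (QGen.E k l) -
        FreeAlgebra.ι ℂ (QGen.E k l) * FreeAlgebra.ι ℂ (QGen.E i j))
      (kd j k • FreeAlgebra.ι ℂ (QGen.E i l) - kd l i • FreeAlgebra.ι ℂ (QGen.E k j))
  | ef (i j k l : Fin n) : QRel n
      (FreeAlgebra.ι ℂ (QGen.E i j) * FreeAlgebra.ι ℂ (QGen.F k l) -
        FreeAlgebra.ι ℂ (QGen.F k l) * FreeAlgebra.ι ℂ (QGen.E i j))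
      (kd j k • FreeAlgebra.ι ℂ (QGen.F i l) - kd l i • FreeAlgebra.ι ℂ (QGen.F k j))
  | ff (i j k l : Fin n) : QRel n
      (FreeAlgebra.ι ℂ (QGen.F i j) * FreeAlgebra.ι ℂ (QGen.F k l) +
        FreeAlgebra.ι ℂ (QGen.F k l) * FreeAlgebra.ι ℂ (QGen.F i j))
      (kd j k • FreeAlgebra.ι ℂ (QGen.E i l) + kd l i • FreeAlgebra.ι ℂ (QGen.E k j))

/-- The universal enveloping superalgebra `U(Q(n))`. -/
abbrev UQ (n : ℕ) := RingQuot (QRel n)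

/-- The generator `e i j` of `U(Q(n))`. -/
def Ue {n : ℕ} (i j : Fin n) : UQ n :=
  RingQuot.mkAlgHom ℂ (QRel n) (FreeAlgebra.ι ℂ (QGen.E i j))

/-- The generator `f i j` of `U(Q(n))`. -/
def Uf {n : ℕ} (i j : Fin n) : UQ n :=
  RingQuot.mkAlgHom ℂ (QRel n) (FreeAlgebra.ι ℂ (QGen.F i j))

/-- Sergeev's elements `e_{ij}^{(m)}` and `f_{ij}^{(m)}` of `U(Q(n))`, defined recursively by
`e^{(0)} = δ`, `f^{(0)} = 0`,
`e_{ij}^{(m)} = Σ_k e_{ik} e_{kj}^{(m-1)} + (-1)^{m+1} Σ_k f_{ik} f_{kj}^{(m-1)}`,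
`f_{ij}^{(m)} = Σ_k e_{ik} f_{kj}^{(m-1)} + (-1)^{m+1} Σ_k f_{ik} e_{kj}^{(m-1)}`. -/
def efU (n : ℕ) : ℕ → (Fin n → Fin n → UQ n) × (Fin n → Fin n → UQ n)
  | 0 => (fun i j => algebraMap ℂ (UQ n) (kd i j), fun _ _ => 0)
  | m + 1 =>
      (fun i j => (∑ k, Ue i k * (efU n m).1 k j) +
        (-1 : ℂ) ^ m • ∑ k, Uf i k * (efU n m).2 k j,
       fun i j => (∑ k, Ue i k * (efU n m).2 k j) +
        (-1 : ℂ) ^ m • ∑ k, Uf i k * (efU n m).1 k j)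

/-- `e_{ij}^{(m)}`. -/
def eU {n : ℕ} (m : ℕ) (i j : Fin n) : UQ n := (efU n m).1 i j
/-- `f_{ij}^{(m)}`. -/
def fU {n : ℕ} (m : ℕ) (i j : Fin n) : UQ n := (efU n m).2 i j

/-- For `l ∣ n`, the index `l(p-1)+i` of `{1,…,n}` (0-based: block `p`, position `i`). -/
def bidx {n l : ℕ} (h : l ∣ n) (p : Fin (n / l)) (i : Fin l) : Fin n :=
  ⟨l * p.val + i.val, by
    have h1 : i.val < l := i.isLt
    have h2 : p.val + 1 ≤ n / l := p.isLt
    have h3 : l * (p.val + 1) ≤ l * (n / l) := Nat.mul_le_mul_left l h2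
    have h4 : n / l * l ≤ n := Nat.div_mul_le_self n l
    have h5 : l * (p.val + 1) = l * p.val + l := Nat.mul_succ l p.val
    have h6 : l * (n / l) = n / l * l := Nat.mul_comm l (n / l)
    omega⟩
set_option linter.unusedVariables false

/-! # The character `χ`, the left ideal `I_χ` and the finite W-algebra data

Here `l ∣ n` and `χ` corresponds to the even nilpotent element of `Q(n)` all of whose
Jordan blocks have size `l`.  The subalgebra `m = ⊕_{j<0} g_j` is spanned by the
elements `e_{l(p-1)+i+k, l(q-1)+i}` and `f_{l(p-1)+i+k, l(q-1)+i}` (`k ≥ 1`), and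
`χ(e_{l(p-1)+i+1, l(q-1)+i}) = δ_{pq}` and `χ = 0` on the other basis elements. -/

/-- The set of elements `a - χ(a)` for `a` ranging over the standard basis of `m`;
(rows/columns written 0-based: `a` is the position of the row inside its block `p`,
`b` the position of the column inside its block `q`, with `b < a`). -/
def mSet (n l : ℕ) (h : l ∣ n) : Set (UQ n) :=
  { x : UQ n | ∃ (p q : Fin (n / l)) (a b : Fin l), b.val < a.val ∧
      (x = Ue (bidx h p a) (bidx h q b) -
            algebraMap ℂ (UQ n) (if a.val = b.val + 1 ∧ p = q then 1 else 0) ∨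
       x = Uf (bidx h p a) (bidx h q b)) }

/-- The left ideal `I_χ` of `U(Q(n))` generated by the `a - χ(a)`, `a ∈ m`. -/
def Ichi (n l : ℕ) (h : l ∣ n) : Submodule (UQ n) (UQ n) :=
  Submodule.span (UQ n) (mSet n l h)

/-- The quotient `U(Q(n))/I_χ` (as a `ℂ`-vector space). -/
abbrev Wq (n l : ℕ) (h : l ∣ n) := UQ n ⧸ (Ichi n l h).restrictScalars ℂ

/-- The quotient map `π : U(Q(n)) → U(Q(n))/I_χ`. -/
def piq (n l : ℕ) (h : l ∣ n) : UQ n →ₗ[ℂ] Wq n l h :=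
  ((Ichi n l h).restrictScalars ℂ).mkQ

/-- `y` super-commutes with `m` into `I_χ`:  `[a, y] ∈ I_χ` for every `a` in the standard
basis of `m`.  Here the super-commutator of the odd element `f` with (the possibly
non-homogeneous) `y` is `f * y - σ(y) * f`, where `σ` is the parity involution of
`U(Q(n))` (the algebra automorphism fixing the `e`'s and negating the `f`'s). -/
def Wcond {n l : ℕ} (h : l ∣ n) (σ : UQ n →ₐ[ℂ] UQ n) (y : UQ n) : Prop :=
  ∀ (p q : Fin (n / l)) (a b : Fin l), b.val < a.val →
    (Ue (bidx h p a) (bidx h q b) * y - y * Ue (bidx h p a) (bidx h q b) ∈ Ichi n l h) ∧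
    (Uf (bidx h p a) (bidx h q b) * y - σ y * Uf (bidx h p a) (bidx h q b) ∈ Ichi n l h)

/-- The finite W-algebra `W_χ = {π(y) | [a, y] ∈ I_χ for all a ∈ m}`, as a subset of
`U(Q(n))/I_χ`.  (Its product is `π(y₁)·π(y₂) = π(y₁y₂)`.) -/
def WchiSet (n l : ℕ) (h : l ∣ n) (σ : UQ n →ₐ[ℂ] UQ n) : Set (Wq n l h) :=
  { w : Wq n l h | ∃ y : UQ n, Wcond h σ y ∧ piq n l h y = w }

/-- The standard basis elements of the parabolic subalgebra `p = ⊕_{j≥0} g_j`. -/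
def pSet (n l : ℕ) (h : l ∣ n) : Set (UQ n) :=
  { x : UQ n | ∃ (p q : Fin (n / l)) (a b : Fin l), a.val ≤ b.val ∧
      (x = Ue (bidx h p a) (bidx h q b) ∨ x = Uf (bidx h p a) (bidx h q b)) }

/-- The standard basis elements of the nilradical `n = ⊕_{j>0} g_j` of `p`. -/
def nSet (n l : ℕ) (h : l ∣ n) : Set (UQ n) :=
  { x : UQ n | ∃ (p q : Fin (n / l)) (a b : Fin l), a.val < b.val ∧
      (x = Ue (bidx h p a) (bidx h q b) ∨ x = Uf (bidx h p a) (bidx h q b)) }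

/-- The kernel of the Harish-Chandra projection `ϑ : U(p) → U(g₀)`, realized inside
`U(Q(n))`: the `ℂ`-span of `U(p)·n`.  (By the PBW theorem, `U(g) = U(p) ⊕ I_χ` and
`U(p) = U(g₀) ⊕ U(p)n`, so for `y ∈ U(g)`, `ϑ(pr(y)) = t` iff
`y - t ∈ I_χ + U(p)n`.) -/
def Lspan (n l : ℕ) (h : l ∣ n) : Submodule ℂ (UQ n) :=
  Submodule.span ℂ
    { x : UQ n | ∃ u ∈ Algebra.adjoin ℂ (pSet n l h), ∃ g ∈ nSet n l h, x = u * g }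

/-- A descriptor of a generator of `U(p)`:  `(b, p, q, a, c)` is
`e_{l(p-1)+(a+1), l(q-1)+(c+1)}` if `b = false` and `f_{…}` if `b = true`
(required: `a ≤ c`). -/
def pgElem {n l : ℕ} (h : l ∣ n) :
    Bool × Fin (n / l) × Fin (n / l) × Fin l × Fin l → UQ n
  | (b, p, q, a, c) => (if b then Uf else Ue) (bidx h p a) (bidx h q c)

/-- Kazhdan degree `2k+2` of a `p`-generator of block offset `k = c - a`. -/
def pgDeg {l m : ℕ} (d : Bool × Fin m × Fin m × Fin l × Fin l) : ℕ :=
  2 * (d.2.2.2.2.val - d.2.2.2.1.val) + 2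

/-- Weight `2k` of a `p`-generator of block offset `k = c - a`. -/
def pgWt {l m : ℕ} (d : Bool × Fin m × Fin m × Fin l × Fin l) : ℕ :=
  2 * (d.2.2.2.2.val - d.2.2.2.1.val)

/-- Monomials in the generators of `U(p)` which are "lower" than bidegree
(Kazhdan degree `D`, weight `W`): either of Kazhdan degree `< D`, or of Kazhdan
degree `≤ D` and weight `< W`. -/
def LowSet (n l : ℕ) (h : l ∣ n) (D W : ℕ) : Set (UQ n) :=
  { x : UQ n | ∃ L : List (Bool × Fin (n / l) × Fin (n / l) × Fin l × Fin l),
      (∀ d ∈ L, d.2.2.2.1.val ≤ d.2.2.2.2.val) ∧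
      x = (L.map (pgElem h)).prod ∧
      ((L.map pgDeg).sum < D ∨ ((L.map pgDeg).sum ≤ D ∧ (L.map pgWt).sum < W)) }

/-- The span of the "lower" monomials. -/
def LowSpan (n l : ℕ) (h : l ∣ n) (D W : ℕ) : Submodule ℂ (UQ n) :=
  Submodule.span ℂ (LowSet n l h D W)

/-! # The super tensor power `U(Q(m))^{⊗l}`

Modeled as the superalgebra with generators `x^i_{pq} = 1^{⊗(l-i)} ⊗ e_{pq} ⊗ 1^{⊗(i-1)}`
(even) and `ξ^i_{pq} = 1^{⊗(l-i)} ⊗ f_{pq} ⊗ 1^{⊗(i-1)}` (odd), subject to the `U(Q(m))`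
relations in each tensor slot and to (super-)commutation between different slots. -/

/-- Generators of `U(Q(m))^{⊗l}`: `X i p q` is `x^i_{pq}` and `Xi i p q` is `ξ^i_{pq}`
(`i : Fin l` is the 0-based tensor slot, counted from the right). -/
inductive TGen (m l : ℕ) : Type
  | X : Fin l → Fin m → Fin m → TGen m l
  | Xi : Fin l → Fin m → Fin m → TGen m l

/-- Kronecker delta on slots. -/
def kdl {l : ℕ} (i j : Fin l) : ℂ := if i = j then 1 else 0

/-- The defining relations of `U(Q(m))^{⊗l}`. -/
inductive TRel (m l : ℕ) : FreeAlgebra ℂ (TGen m l) → FreeAlgebra ℂ (TGen m l) → Prop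
  | xx (i i' : Fin l) (p q r s : Fin m) : TRel m l
      (FreeAlgebra.ι ℂ (TGen.X i p q) * FreeAlgebra.ι ℂ (TGen.X i' r s) -
        FreeAlgebra.ι ℂ (TGen.X i' r s) * FreeAlgebra.ι ℂ (TGen.X i p q))
      ((kdl i i' * kd q r) • FreeAlgebra.ι ℂ (TGen.X i p s) -
        (kdl i i' * kd s p) • FreeAlgebra.ι ℂ (TGen.X i' r q))
  | xxi (i i' : Fin l) (p q r s : Fin m) : TRel m l
      (FreeAlgebra.ι ℂ (TGen.X i p q) * FreeAlgebra.ι ℂ (TGen.Xi i' r s) -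
        FreeAlgebra.ι ℂ (TGen.Xi i' r s) * FreeAlgebra.ι ℂ (TGen.X i p q))
      ((kdl i i' * kd q r) • FreeAlgebra.ι ℂ (TGen.Xi i p s) -
        (kdl i i' * kd s p) • FreeAlgebra.ι ℂ (TGen.Xi i' r q))
  | xixi (i i' : Fin l) (p q r s : Fin m) : TRel m l
      (FreeAlgebra.ι ℂ (TGen.Xi i p q) * FreeAlgebra.ι ℂ (TGen.Xi i' r s) +
        FreeAlgebra.ι ℂ (TGen.Xi i' r s) * FreeAlgebra.ι ℂ (TGen.Xi i p q))
      ((kdl i i' * kd q r) • FreeAlgebra.ι ℂ (TGen.X i p s) +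
        (kdl i i' * kd s p) • FreeAlgebra.ι ℂ (TGen.X i' r q))

/-- The superalgebra `U(Q(m))^{⊗l}`. -/
abbrev TQ (m l : ℕ) := RingQuot (TRel m l)

/-- `x^i_{pq} := 1^{⊗(l-i)} ⊗ e_{pq} ⊗ 1^{⊗(i-1)} ∈ U(Q(m))^{⊗l}`. -/
def xT {m l : ℕ} (i : Fin l) (p q : Fin m) : TQ m l :=
  RingQuot.mkAlgHom ℂ (TRel m l) (FreeAlgebra.ι ℂ (TGen.X i p q))

/-- `ξ^i_{pq} := 1^{⊗(l-i)} ⊗ f_{pq} ⊗ 1^{⊗(i-1)} ∈ U(Q(m))^{⊗l}`. -/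
def xiT {m l : ℕ} (i : Fin l) (p q : Fin m) : TQ m l :=
  RingQuot.mkAlgHom ℂ (TRel m l) (FreeAlgebra.ι ℂ (TGen.Xi i p q))

/-! # The super-Yangian `Y(Q(n))` -/

/-- The index set `{±1, …, ±n}`:  `(false, a)` is the positive index `a` (even),
`(true, a)` is the negative index `-a` (odd). -/
abbrev QIdx (n : ℕ) := Bool × Fin n

/-- Negation `i ↦ -i` on indices. -/
def qneg {n : ℕ} (i : QIdx n) : QIdx n := (!i.1, i.2)

/-- The parity `p(i)`: `0` for positive `i`, `1` for negative `i`. -/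
def qpar {n : ℕ} (i : QIdx n) : ℕ := if i.1 then 1 else 0

/-- Kronecker delta on `{±1, …, ±n}`. -/
def kdq {n : ℕ} (i j : QIdx n) : ℂ := if i = j then 1 else 0

/-- Generators of `Y(Q(n))`: `T m i j` encodes `T^{(m+1)}_{i,j}`. -/
inductive YGen (n : ℕ) : Type
  | T : ℕ → QIdx n → QIdx n → YGen n

/-- `T^{(m)}_{i,j}` in the free algebra, with `T^{(0)}_{i,j} = δ_{ij}`. -/
def Tf {n : ℕ} : ℕ → QIdx n → QIdx n → FreeAlgebra ℂ (YGen n)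
  | 0, i, j => algebraMap ℂ _ (kdq i j)
  | m + 1, i, j => FreeAlgebra.ι ℂ (YGen.T m i j)

/-- The super-commutator `[T^{(a)}_{i,j}, T^{(b)}_{k,l}]` in the free algebra. -/
def ybr {n : ℕ} (a : ℕ) (i j : QIdx n) (b : ℕ) (k l : QIdx n) :
    FreeAlgebra ℂ (YGen n) :=
  Tf a i j * Tf b k l -
    ((-1 : ℂ) ^ ((qpar i + qpar j) * (qpar k + qpar l))) • (Tf b k l * Tf a i j)

/-- The defining relations of the super-Yangian `Y(Q(n))`: for `M, R ≥ 1`,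
`(-1)^{p(i)p(k)+p(i)p(l)+p(k)p(l)} ([T^{(M+1)}_{ij}, T^{(R-1)}_{kl}] - [T^{(M-1)}_{ij}, T^{(R+1)}_{kl}])
 = T^{(M)}_{kj}T^{(R-1)}_{il} + T^{(M-1)}_{kj}T^{(R)}_{il} - T^{(R-1)}_{kj}T^{(M)}_{il}
   - T^{(R)}_{kj}T^{(M-1)}_{il}
   + (-1)^{p(k)+p(l)} (-T^{(M)}_{-k,j}T^{(R-1)}_{-i,l} + T^{(M-1)}_{-k,j}T^{(R)}_{-i,l}
       + T^{(R-1)}_{k,-j}T^{(M)}_{i,-l} - T^{(R)}_{k,-j}T^{(M-1)}_{i,-l})`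
(here `M = m+1`, `R = r+1`), together with `T^{(m)}_{-i,-j} = (-1)^m T^{(m)}_{i,j}`. -/
inductive YRel (n : ℕ) : FreeAlgebra ℂ (YGen n) → FreeAlgebra ℂ (YGen n) → Prop
  | quad (m r : ℕ) (i j k l : QIdx n) : YRel n
      (((-1 : ℂ) ^ (qpar i * qpar k + qpar i * qpar l + qpar k * qpar l)) •
        (ybr (m + 2) i j r k l - ybr m i j (r + 2) k l))
      (Tf (m + 1) k j * Tf r i l + Tf m k j * Tf (r + 1) i l -
        Tf r k j * Tf (m + 1) i l - Tf (r + 1) k j * Tf m i l +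
        ((-1 : ℂ) ^ (qpar k + qpar l)) •
          (-(Tf (m + 1) (qneg k) j * Tf r (qneg i) l) +
            Tf m (qneg k) j * Tf (r + 1) (qneg i) l +
            Tf r k (qneg j) * Tf (m + 1) i (qneg l) -
            Tf (r + 1) k (qneg j) * Tf m i (qneg l)))
  | par (m : ℕ) (i j : QIdx n) : YRel n
      (Tf (m + 1) (qneg i) (qneg j)) (((-1 : ℂ) ^ (m + 1)) • Tf (m + 1) i j)

/-- The super-Yangian `Y(Q(n))`. -/
abbrev YQ (n : ℕ) := RingQuot (YRel n)

/-- The generator `T^{(m)}_{i,j}` of `Y(Q(n))` (with `T^{(0)}_{i,j} = δ_{ij}`). -/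
def TY {n : ℕ} (m : ℕ) (i j : QIdx n) : YQ n :=
  RingQuot.mkAlgHom ℂ (YRel n) (Tf m i j)

/-! # Values of the homomorphisms `U`, `ev`, `ēv` on the generators of `Y(Q(n))`,
and the explicit sums appearing in the main theorems. -/

/-- The value of the homomorphism `U : Y(Q(n)) → U(Q(n))` on the generator
`T^{(r)}_{i,j}`:  `U(T^{(r)}_{i,j}) = (-1)^r e^{(r)}_{j,i}`,
`U(T^{(r)}_{-i,j}) = (-1)^r f^{(r)}_{j,i}` for `i, j > 0`, and the values on the other
generators are forced by `T^{(r)}_{-i,-j} = (-1)^r T^{(r)}_{i,j}`. -/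
def Uval {n : ℕ} (r : ℕ) (i j : QIdx n) : UQ n :=
  (if j.1 then (-1 : ℂ) ^ r else 1) •
    ((-1 : ℂ) ^ r • (if xor i.1 j.1 then fU r j.2 i.2 else eU r j.2 i.2))

/-- The value of the evaluation homomorphism `ev : Y(Q(n)) → U(Q(n))` on `T^{(r)}_{i,j}`:
`ev(T^{(1)}_{i,j}) = -e_{j,i}`, `ev(T^{(1)}_{-i,j}) = -f_{j,i}` for `i, j > 0`,
`ev(T^{(0)}_{i,j}) = δ_{ij}` and `ev(T^{(r)}_{i,j}) = 0` for `r > 1` (with the values on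
the remaining generators forced by `T^{(r)}_{-i,-j} = (-1)^r T^{(r)}_{i,j}`). -/
def evval {n : ℕ} (r : ℕ) (i j : QIdx n) : UQ n :=
  (if j.1 then (-1 : ℂ) ^ r else 1) •
    (match r with
      | 0 => if xor i.1 j.1 then 0 else algebraMap ℂ (UQ n) (kd i.2 j.2)
      | 1 => -(if xor i.1 j.1 then Uf j.2 i.2 else Ue j.2 i.2)
      | _ + 2 => 0)

/-- The value of `ēv = α ∘ ev : Y(Q(n)) → U(Q(n))` on `T^{(r)}_{i,j}`, where `α` is the
principal anti-automorphism of `U(Q(n))`:  `ēv(T^{(1)}_{i,j}) = e_{j,i}`,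
`ēv(T^{(1)}_{-i,j}) = f_{j,i}` for `i, j > 0`, `ēv(T^{(0)}_{i,j}) = δ_{ij}`,
`ēv(T^{(r)}_{i,j}) = 0` for `r > 1`. -/
def bevval {n : ℕ} (r : ℕ) (i j : QIdx n) : UQ n :=
  (if j.1 then (-1 : ℂ) ^ r else 1) •
    (match r with
      | 0 => if xor i.1 j.1 then 0 else algebraMap ℂ (UQ n) (kd i.2 j.2)
      | 1 => (if xor i.1 j.1 then Uf j.2 i.2 else Ue j.2 i.2)
      | _ + 2 => 0)

/-- The sum `Σ_{p_1,…,p_{r-1}} Σ_{l ≥ i_1 ≥ i_2 ≥ … ≥ i_r ≥ 1}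
Π_{a=1}^r (x^{i_a}_{p_{a-1},p_a} + (-1)^{r-a} ξ^{i_a}_{p_{a-1},p_a})`
(with `p_0 = p`, `p_r = q`), an element of `U(Q(m))^{⊗l}`. -/
def chainProdDec (m l : ℕ) (r : ℕ) (p q : Fin m) : TQ m l :=
  ∑ c : Fin (r + 1) → Fin m, ∑ iv : Fin r → Fin l,
    (if c 0 = p ∧ c (Fin.last r) = q ∧ (∀ a b : Fin r, a ≤ b → iv b ≤ iv a)
      then (1 : ℂ) else 0) •
      (List.ofFn fun a : Fin r =>
        xT (iv a) (c a.castSucc) (c a.succ) +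
          ((-1 : ℂ) ^ (r - 1 - a.val)) • xiT (iv a) (c a.castSucc) (c a.succ)).prod

/-- The sum `Σ_{p_1,…,p_{r-1}} Σ_{1 ≤ i_1 < i_2 < … < i_r ≤ l}
Π_{a=1}^r (x^{i_a}_{p_{a-1},p_a} + (-1)^{r-a} ξ^{i_a}_{p_{a-1},p_a})`
(with `p_0 = p`, `p_r = q`), an element of `U(Q(m))^{⊗l}`. -/
def chainProdInc (m l : ℕ) (r : ℕ) (p q : Fin m) : TQ m l :=
  ∑ c : Fin (r + 1) → Fin m, ∑ iv : Fin r → Fin l,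
    (if c 0 = p ∧ c (Fin.last r) = q ∧ (∀ a b : Fin r, a < b → iv a < iv b)
      then (1 : ℂ) else 0) •
      (List.ofFn fun a : Fin r =>
        xT (iv a) (c a.castSucc) (c a.succ) +
          ((-1 : ℂ) ^ (r - 1 - a.val)) • xiT (iv a) (c a.castSucc) (c a.succ)).prod

/-- The elements `z^{(r)}_{±q,p}` of `U(Q(m))^{⊗l}`:  the even (`sgn = false`,
giving `z^{(r)}_{q,p}`) resp. odd (`sgn = true`, giving `z^{(r)}_{-q,p}`) component of
`chainProdDec`, computed using the parity involution `σT` of `U(Q(m))^{⊗l}`;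
`z^{(0)}_{q,p} = δ_{qp}`, `z^{(0)}_{-q,p} = 0`. -/
def zDec {m l : ℕ} (σT : TQ m l →ₐ[ℂ] TQ m l) :
    ℕ → Bool → Fin m → Fin m → TQ m l
  | 0, sgn, q, p => if sgn then 0 else algebraMap ℂ (TQ m l) (kd q p)
  | r + 1, sgn, q, p =>
      (2⁻¹ : ℂ) • (chainProdDec m l (r + 1) p q +
        (if sgn then (-1 : ℂ) else 1) • σT (chainProdDec m l (r + 1) p q))

/-- The elements `z̃^{(r)}_{±q,p}` of `U(Q(m))^{⊗l}` (as `zDec`, with increasing chains). -/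
def zInc {m l : ℕ} (σT : TQ m l →ₐ[ℂ] TQ m l) :
    ℕ → Bool → Fin m → Fin m → TQ m l
  | 0, sgn, q, p => if sgn then 0 else algebraMap ℂ (TQ m l) (kd q p)
  | r + 1, sgn, q, p =>
      (2⁻¹ : ℂ) • (chainProdInc m l (r + 1) p q +
        (if sgn then (-1 : ℂ) else 1) • σT (chainProdInc m l (r + 1) p q))

/-- The explicit formula for the antipode value `S(T^{(r)}_{i,j})` (`r ≥ 1`):
`S(T^{(r)}_{i,j}) = Σ_{m=1}^{r} (-1)^m Σ_{i_1,…,i_{m-1}} Σ_{r_1+⋯+r_m=r, r_a>0}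
(-1)^{ν(i,i_1,…,i_{m-1},j)} T^{(r_1)}_{i,i_1} ⋯ T^{(r_m)}_{i_{m-1},j}` where
`ν(i_0,…,i_m) = Σ_{0≤k<s≤m-1} (p(i_k)+p(i_{k+1}))(p(i_s)+p(i_{s+1}))`. -/
def STval {n : ℕ} (r : ℕ) (i j : QIdx n) : YQ n :=
  ∑ m : Fin r,
    ((-1 : ℂ) ^ (m.val + 1)) •
      ∑ ch : Fin (m.val + 2) → QIdx n, ∑ c : Fin (m.val + 1) → Fin (r + 1),
        (if ch 0 = i ∧ ch (Fin.last (m.val + 1)) = j ∧ (∀ a, 1 ≤ (c a).val) ∧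
              (∑ a, (c a).val) = r
          then ((-1 : ℂ) ^ (∑ a : Fin (m.val + 1), ∑ b : Fin (m.val + 1),
              if a < b then
                (qpar (ch a.castSucc) + qpar (ch a.succ)) *
                  (qpar (ch b.castSucc) + qpar (ch b.succ))
              else 0))
          else 0) •
        (List.ofFn fun a : Fin (m.val + 1) =>
          TY (c a).val (ch a.castSucc) (ch a.succ)).prod

/-! ## Abstract setting: a `ℂ`-algebra with elements satisfying the `Q`-relations -/

/-- The sign `(-1)^{st}` for parities. -/
def sg (s t : Bool) : ℂ := if s && t then -1 else 1

/-- Kronecker delta on an arbitrary type. -/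
def dl {J : Type*} (i j : J) : ℂ := if i = j then 1 else 0

theorem dl_comm {J : Type*} (i j : J) : dl i j = dl j i := by simp [dl, eq_comm]
theorem dl_self {J : Type*} (i : J) : dl i i = 1 := by simp [dl]
theorem dl_ne {J : Type*} {i j : J} (h : i ≠ j) : dl i j = 0 := by simp [dl, h]

/-- The family `z` satisfies the relations of `Q`. -/
structure IsQ {J R : Type*} [Ring R] [Algebra ℂ R] (z : Bool → J → J → R) : Prop where
  comm : ∀ s t i j k m, z s i j * z t k m - sg s t • (z t k m * z s i j) =
      dl j k • z (xor s t) i m - (sg s t * dl m i) • z (xor s t) k j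
  ind : ∀ C : Submodule ℂ R, 1 ∈ C → (∀ s i j, ∀ x ∈ C, z s i j * x ∈ C) → ∀ x, x ∈ C

section Sergeev
variable {J R : Type*} [Ring R] [Algebra ℂ R] {z : Bool → J → J → R}

theorem IsQ.mul_eq (hz : IsQ z) (s t i j k m) : z s i j * z t k m = sg s t • (z t k m * z s i j) +
      (dl j k • z (xor s t) i m - (sg s t * dl m i) • z (xor s t) k j) := by
  rw [← hz.comm]; abel

/-- `u ε i j = e + ε f`. -/
def uu (z : Bool → J → J → R) (ε : ℂ) (i j : J) : R := z false i j + ε • z true i j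

variable [Fintype J]

/-- Sergeev's elements, `S ε m = e^{(m)} + ε f^{(m)}`. -/
def SS (z : Bool → J → J → R) (ε : ℂ) : ℕ → J → J → R
  | 0, i, j => dl i j • 1
  | m + 1, i, j => ∑ k, uu z (ε * (-1) ^ m) i k * SS z ε m k j

theorem sum_dl_smul {M : Type*} [AddCommGroup M] [Module ℂ M] (j : J) (f : J → M) :
    ∑ k, dl j k • f k = f j := by
  simp [dl]
theorem sum_dl_smul' {M : Type*} [AddCommGroup M] [Module ℂ M] (j : J) (f : J → M) :
    ∑ k, dl k j • f k = f j := by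
  simp [dl]

theorem e_uu (hz : IsQ z) (ε : ℂ) (i j k h : J) :
    z false i j * uu z ε k h = uu z ε k h * z false i j + dl j k • uu z ε i h
      - dl h i • uu z ε k j := by
  have h1 := hz.mul_eq false false i j k h
  have h2 := hz.mul_eq false true i j k h
  simp only [sg, Bool.false_and, Bool.false_xor, one_smul, one_mul, Bool.false_eq_true, if_false] at h1 h2
  simp only [uu, mul_add, add_mul, mul_smul_comm, smul_mul_assoc, h1, h2]
  module

theorem f_uu (hz : IsQ z) (ε : ℂ) (hε : ε * ε = 1) (i j k h : J) :
    z true i j * uu z ε k h = uu z (-ε) k h * z true i j + (ε * dl j k) • uu z ε i h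
      + (ε * dl h i) • uu z (-ε) k j := by
  have h1 := hz.mul_eq true false i j k h
  have h2 := hz.mul_eq true true i j k h
  simp only [sg, Bool.true_and, Bool.and_true, Bool.and_false, Bool.xor_false, Bool.xor_true,
    Bool.not_true, one_smul, one_mul, Bool.false_eq_true, if_false, if_true] at h1 h2
  simp only [uu, mul_add, add_mul, mul_smul_comm, smul_mul_assoc, h1, h2, smul_add, smul_sub,
    smul_smul]
  have e1 : ∀ x : ℂ, ε * x * ε = x := by intro x; linear_combination x * hε
  have e2 : ∀ x : ℂ, ε * x * -ε = -x := by intro x; linear_combination -x * hε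
  simp only [e1, e2]
  module

theorem e_SS (hz : IsQ z) (ε : ℂ) (m : ℕ) : ∀ (i j k p : J), i ≠ p →
    z false i j * SS z ε m k p = SS z ε m k p * z false i j + dl j k • SS z ε m i p := by
  induction m with
  | zero =>
    intro i j k p hip
    simp [SS, dl_ne hip]
  | succ m ih =>
    intro i j k p hip
    have key : ∀ h, z false i j * (uu z (ε * (-1) ^ m) k h * SS z ε m h p) =
        uu z (ε * (-1) ^ m) k h * SS z ε m h p * z false i j
        + dl j k • (uu z (ε * (-1) ^ m) i h * SS z ε m h p)
        - dl h i • (uu z (ε * (-1) ^ m) k j * SS z ε m h p)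
        + dl j h • (uu z (ε * (-1) ^ m) k h * SS z ε m i p) := by
      intro h
      rw [← mul_assoc, e_uu hz, sub_mul, add_mul, mul_assoc, ih i j h p hip]
      simp only [mul_add, smul_mul_assoc, mul_smul_comm, mul_assoc]
      abel
    simp only [SS, Finset.mul_sum, Finset.sum_mul, key, Finset.sum_add_distrib,
      Finset.sum_sub_distrib, sum_dl_smul, sum_dl_smul', Finset.smul_sum]
    abel

theorem f_SS (hz : IsQ z) (ε : ℂ) (hε : ε * ε = 1) (m : ℕ) : ∀ (i j k p : J), i ≠ p →
    z true i j * SS z ε m k p = SS z (-ε) m k p * z true i j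
      + (-(ε * (-1) ^ m) * dl j k) • SS z ε m i p := by
  induction m with
  | zero =>
    intro i j k p hip
    simp [SS, dl_ne hip]
  | succ m ih =>
    intro i j k p hip
    have hε' : (ε * (-1) ^ m) * (ε * (-1) ^ m) = 1 := by
      rw [mul_mul_mul_comm, hε, ← mul_pow]; simp
    have key : ∀ h, z true i j * (uu z (ε * (-1) ^ m) k h * SS z ε m h p) =
        uu z (-ε * (-1) ^ m) k h * SS z (-ε) m h p * z true i j
        + (ε * (-1) ^ m) • dl j k • (uu z (ε * (-1) ^ m) i h * SS z ε m h p)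
        + (ε * (-1) ^ m) • dl h i • (uu z (-ε * (-1) ^ m) k j * SS z ε m h p)
        - (ε * (-1) ^ m) • dl j h • (uu z (-ε * (-1) ^ m) k h * SS z ε m i p) := by
      intro h
      rw [← mul_assoc, f_uu hz _ hε', add_mul, add_mul, mul_assoc, ih i j h p hip]
      simp only [mul_add, smul_mul_assoc, mul_smul_comm, mul_assoc, smul_smul, neg_mul]
      module
    simp only [SS, Finset.mul_sum, Finset.sum_mul, key, Finset.sum_add_distrib,
      Finset.sum_sub_distrib, sum_dl_smul, sum_dl_smul', Finset.smul_sum, ← Finset.smul_sum, pow_succ]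
    module

end Sergeev

/-! ## The left ideal, Whittaker vectors, and the Harish-Chandra projection, abstractly -/

section Whit
variable {N l : ℕ} {R : Type*} [Ring R] [Algebra ℂ R] {z : Bool → Fin N × Fin l → Fin N × Fin l → R}

/-- The character `χ`. -/
def chi (s : Bool) (i j : Fin N × Fin l) : ℂ :=
  if s = false ∧ i.1 = j.1 ∧ i.2.val = j.2.val + 1 then 1 else 0

theorem chi_true (i j : Fin N × Fin l) : chi true i j = 0 := by simp [chi]

/-- The shifted generators. -/
def zc (z : Bool → Fin N × Fin l → Fin N × Fin l → R) (s : Bool) (i j : Fin N × Fin l) : R :=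
  z s i j - chi s i j • 1

/-- The left ideal. -/
def II (z : Bool → Fin N × Fin l → Fin N × Fin l → R) : Submodule R R :=
  Submodule.span R {x | ∃ s i j, j.2 < i.2 ∧ x = zc z s i j}

theorem zc_mem {s : Bool} {i j : Fin N × Fin l} (h : j.2 < i.2) : zc z s i j ∈ II z :=
  Submodule.subset_span ⟨s, i, j, h, rfl⟩

theorem II_mul_left (a : R) {x : R} (hx : x ∈ II z) : a * x ∈ II z := (II z).smul_mem a hx

theorem II_smul (c : ℂ) {x : R} (hx : x ∈ II z) : c • x ∈ II z := by
  rw [← one_mul x, ← smul_mul_assoc]; exact II_mul_left _ hx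

/-- Whittaker vectors. -/
def Wh (z : Bool → Fin N × Fin l → Fin N × Fin l → R) (y : R) : Prop :=
  ∀ s i j, j.2 < i.2 → zc z s i j * y ∈ II z

theorem II_mul {x y : R} (hx : x ∈ II z) (hy : Wh z y) : x * y ∈ II z := by
  induction hx using Submodule.span_induction with
  | mem x h => obtain ⟨s, i, j, h, rfl⟩ := h; exact hy s i j h
  | zero => simp
  | add a b _ _ ha hb => rw [add_mul]; exact (II z).add_mem ha hb
  | smul a b _ hb => rw [smul_eq_mul, mul_assoc]; exact II_mul_left _ hb

theorem Wh.mul {x y : R} (hx : Wh z x) (hy : Wh z y) : Wh z (x * y) := by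
  intro s i j h
  rw [← mul_assoc]; exact II_mul (hx s i j h) hy
theorem Wh.add {x y : R} (hx : Wh z x) (hy : Wh z y) : Wh z (x + y) := by
  intro s i j h
  rw [mul_add]; exact (II z).add_mem (hx s i j h) (hy s i j h)
theorem Wh.smul (c : ℂ) {x : R} (hx : Wh z x) : Wh z (c • x) := by
  intro s i j h
  rw [mul_smul_comm]; exact II_smul c (hx s i j h)
theorem Wh.one : Wh z 1 := by
  intro s i j h
  rw [mul_one]; exact zc_mem h
theorem Wh.of_mem {x : R} (hx : x ∈ II z) : Wh z x := fun s i j h => II_mul_left _ hx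
theorem Wh.sub {x y : R} (hx : Wh z x) (hy : Wh z y) : Wh z (x - y) := by
  rw [sub_eq_add_neg, ← neg_one_smul ℂ]; exact hx.add (hy.smul _)

theorem zc_false_add (i j : Fin N × Fin l) : z false i j = zc z false i j + chi false i j • 1 := by
  simp [zc]
theorem zc_true (i j : Fin N × Fin l) : zc z true i j = z true i j := by
  simp [zc, chi_true]

theorem Wh_SS (hz : IsQ z) (ε : ℂ) (hε : ε * ε = 1) (m : ℕ) (i j : Fin N × Fin l)
    (hi : i.2.val + 1 = l) (hj : j.2.val = 0) : Wh z (SS z ε m i j) := by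
  intro s i' j' h
  have h1 : i' ≠ j := by rintro rfl; have := Fin.lt_def.1 h; omega
  have h2 : j' ≠ i := by rintro rfl; have := Fin.lt_def.1 h; have := i'.2.isLt; omega
  cases s
  · have : zc z false i' j' * SS z ε m i j = SS z ε m i j * zc z false i' j' := by
      simp only [zc, sub_mul, mul_sub, e_SS hz ε m i' j' i j h1, dl_ne h2, smul_mul_assoc,
        mul_smul_comm, one_mul, mul_one, zero_smul, add_zero]
    rw [this]
    exact II_mul_left _ (zc_mem h)
  · rw [zc_true, f_SS hz ε hε m i' j' i j h1, dl_ne h2, mul_zero, zero_smul, add_zero, ← zc_true (z := z)]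
    exact II_mul_left _ (zc_mem h)

/-- The fundamental recursion modulo the left ideal. -/
theorem SS_rec (hz : IsQ z) (ε : ℂ) (hε : ε * ε = 1) (m : ℕ) (i j : Fin N × Fin l)
    (hj : j.2.val = 0) :
    SS z ε (m + 1) i j - ∑ k, (if i.2 ≤ k.2 then uu z (ε * (-1) ^ m) i k * SS z ε m k j
      else chi false i k • SS z ε m k j) ∈ II z := by
  simp only [SS]
  rw [← Finset.sum_sub_distrib]
  refine Submodule.sum_mem _ fun k _ => ?_
  split_ifs with hk
  · simp
  · push Not at hk
    have h1 : i ≠ j := by rintro rfl; have := Fin.lt_def.1 hk; omega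
    have hε' : (ε * (-1) ^ m) * (ε * (-1) ^ m) = 1 := by
      rw [mul_mul_mul_comm, hε, ← mul_pow]; simp
    have : uu z (ε * (-1) ^ m) i k * SS z ε m k j - chi false i k • SS z ε m k j =
        SS z ε m k j * zc z false i k + (ε * (-1) ^ m) • (SS z (-ε) m k j * zc z true i k) := by
      rw [uu, add_mul, smul_mul_assoc, e_SS hz ε m i k k j h1, f_SS hz ε hε m i k k j h1, dl_self,
        smul_add, smul_smul, zc_true, zc, mul_sub, mul_smul_comm, mul_one, mul_one, mul_neg, hε']
      module
    rw [this]
    exact (II z).add_mem (II_mul_left _ (zc_mem hk)) (II_smul _ (II_mul_left _ (zc_mem hk)))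

/-- `U(p)`. -/
def PP (z : Bool → Fin N × Fin l → Fin N × Fin l → R) : Subalgebra ℂ R :=
  Algebra.adjoin ℂ {x | ∃ s i j, i.2 ≤ j.2 ∧ x = z s i j}

/-- `U(p) n`. -/
def LL (z : Bool → Fin N × Fin l → Fin N × Fin l → R) : Submodule ℂ R :=
  Submodule.span ℂ {x | ∃ u ∈ PP z, ∃ s i j, i.2 < j.2 ∧ x = u * z s i j}

theorem PP_gen {s : Bool} {i j : Fin N × Fin l} (h : i.2 ≤ j.2) : z s i j ∈ PP z :=
  Algebra.subset_adjoin ⟨s, i, j, h, rfl⟩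

theorem LL_le_PP {x : R} (hx : x ∈ LL z) : x ∈ PP z := by
  induction hx using Submodule.span_induction with
  | mem x h => obtain ⟨u, hu, s, i, j, h, rfl⟩ := h; exact (PP z).mul_mem hu (PP_gen h.le)
  | zero => exact (PP z).zero_mem
  | add a b _ _ ha hb => exact (PP z).add_mem ha hb
  | smul a b _ hb => exact (PP z).smul_mem hb a

theorem LL_gen {u : R} (hu : u ∈ PP z) {s : Bool} {i j : Fin N × Fin l} (h : i.2 < j.2) :
    u * z s i j ∈ LL z := Submodule.subset_span ⟨u, hu, s, i, j, h, rfl⟩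

theorem PP_mul_LL {u x : R} (hu : u ∈ PP z) (hx : x ∈ LL z) : u * x ∈ LL z := by
  induction hx using Submodule.span_induction with
  | mem x h =>
    obtain ⟨v, hv, s, i, j, h, rfl⟩ := h
    rw [← mul_assoc]; exact LL_gen ((PP z).mul_mem hu hv) h
  | zero => simp
  | add a b _ _ ha hb => rw [mul_add]; exact (LL z).add_mem ha hb
  | smul a b _ hb => rw [mul_smul_comm]; exact (LL z).smul_mem _ hb

theorem dl_smul_mem {K : Type*} {M : Type*} [AddCommGroup M] [Module ℂ M] (C : Submodule ℂ M)
    (i j : K) (c : ℂ) (x : M) (h : i = j → x ∈ C) : (c * dl i j) • x ∈ C := by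
  by_cases hij : i = j
  · exact C.smul_mem _ (h hij)
  · simp [dl_ne hij]
theorem dl_smul_mem' {K : Type*} {M : Type*} [AddCommGroup M] [Module ℂ M] (C : Submodule ℂ M)
    (i j : K) (x : M) (h : i = j → x ∈ C) : (dl i j) • x ∈ C := by
  simpa using dl_smul_mem C i j 1 x h

theorem LL_mul_PP (hz : IsQ z) {u x : R} (hx : x ∈ LL z) (hu : u ∈ PP z) : x * u ∈ LL z := by
  induction hu using Algebra.adjoin_induction generalizing x with
  | algebraMap r => rw [← Algebra.commutes, ← Algebra.smul_def]; exact (LL z).smul_mem _ hx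
  | add a b _ _ ha hb => rw [mul_add]; exact (LL z).add_mem (ha hx) (hb hx)
  | mul a b _ _ ha hb => rw [← mul_assoc]; exact hb (ha hx)
  | mem w hw =>
    obtain ⟨t, k, m, hkm, rfl⟩ := hw
    induction hx using Submodule.span_induction with
    | mem x h =>
      obtain ⟨v, hv, s, i, j, h, rfl⟩ := h
      rw [mul_assoc, hz.mul_eq, mul_add, mul_smul_comm, mul_sub, mul_smul_comm, mul_smul_comm,
        ← mul_assoc]
      refine (LL z).add_mem ((LL z).smul_mem _ (LL_gen ((PP z).mul_mem hv (PP_gen hkm)) h))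
        ((LL z).sub_mem (dl_smul_mem' _ _ _ _ ?_) (dl_smul_mem _ _ _ _ _ ?_))
      · rintro rfl; exact LL_gen hv (lt_of_lt_of_le h hkm)
      · rintro rfl; exact LL_gen hv (lt_of_le_of_lt hkm h)
    | zero => simp
    | add a b _ _ ha hb => rw [add_mul]; exact (LL z).add_mem ha hb
    | smul a b _ hb => rw [smul_mul_assoc]; exact (LL z).smul_mem _ hb

/-- `I + U(p) n`. -/
def IL (z : Bool → Fin N × Fin l → Fin N × Fin l → R) : Submodule ℂ R :=
  (II z).restrictScalars ℂ ⊔ LL z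

theorem IL_I {x : R} (hx : x ∈ II z) : x ∈ IL z := Submodule.mem_sup_left hx
theorem IL_L {x : R} (hx : x ∈ LL z) : x ∈ IL z := Submodule.mem_sup_right hx

theorem PP_mul_IL {u x : R} (hu : u ∈ PP z) (hx : x ∈ IL z) : u * x ∈ IL z := by
  obtain ⟨a, ha, b, hb, rfl⟩ := Submodule.mem_sup.1 hx
  rw [mul_add]
  exact (IL z).add_mem (IL_I (II_mul_left _ ha)) (IL_L (PP_mul_LL hu hb))

variable {T : Type*} [Ring T] [Algebra ℂ T]

/-- `ϑ(y) = t`. -/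
def Rl (z : Bool → Fin N × Fin l → Fin N × Fin l → R) (ι : T →ₐ[ℂ] R) (y : R) (t : T) : Prop :=
  Wh z y ∧ y - ι t ∈ IL z

theorem Rl.add {ι : T →ₐ[ℂ] R} {y y' : R} {t t' : T} (h : Rl z ι y t) (h' : Rl z ι y' t') :
    Rl z ι (y + y') (t + t') := by
  refine ⟨h.1.add h'.1, ?_⟩
  rw [map_add, add_sub_add_comm]; exact (IL z).add_mem h.2 h'.2

theorem Rl.smul {ι : T →ₐ[ℂ] R} {y : R} {t : T} (c : ℂ) (h : Rl z ι y t) :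
    Rl z ι (c • y) (c • t) := by
  refine ⟨h.1.smul c, ?_⟩
  rw [map_smul, ← smul_sub]; exact (IL z).smul_mem _ h.2

theorem Rl.one {ι : T →ₐ[ℂ] R} : Rl z ι 1 1 := by
  refine ⟨Wh.one, ?_⟩
  rw [map_one, sub_self]; exact (IL z).zero_mem

theorem Rl.mul (hz : IsQ z) {ι : T →ₐ[ℂ] R} (hι : ∀ t, ι t ∈ PP z) {y y' : R} {t t' : T}
    (h : Rl z ι y t) (h' : Rl z ι y' t') : Rl z ι (y * y') (t * t') := by
  refine ⟨h.1.mul h'.1, ?_⟩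
  obtain ⟨a, ha, b, hb, hab⟩ := Submodule.mem_sup.1 h.2
  obtain ⟨a', ha', b', hb', hab'⟩ := Submodule.mem_sup.1 h'.2
  change a ∈ II z at ha
  change a' ∈ II z at ha'
  have e1 : y = ι t + a + b := by rw [add_assoc, hab]; abel
  have e2 : y' = ι t' + a' + b' := by rw [add_assoc, hab']; abel
  have e3 : y * y' - ι (t * t') = (y * a' - a * a' + a * y') + (ι t * b' + b * ι t' + b * b') := by
    rw [map_mul, e1, e2]; noncomm_ring
  rw [e3]
  refine (IL z).add_mem (IL_I ?_) (IL_L ?_)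
  · exact (II z).add_mem ((II z).sub_mem (II_mul_left _ ha') (II_mul_left _ ha')) (II_mul ha h'.1)
  · exact (LL z).add_mem ((LL z).add_mem (PP_mul_LL (hι t) hb') (LL_mul_PP hz hb (hι t')))
      (PP_mul_LL (LL_le_PP hb) hb')

def uX (X : Bool → ℕ → Fin N → Fin N → T) (η : ℂ) (a : ℕ) (p c : Fin N) : T :=
  X false a p c + η • X true a p c

/-- The Harish-Chandra images. -/
def tau (X : Bool → ℕ → Fin N → Fin N → T) (ε : ℂ) (q : Fin N) : ℕ → ℕ → Fin N → T
  | 0, a, p => if a = 0 ∧ p = q then 1 else 0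
  | m + 1, a, p => (∑ c, uX X (ε * (-1) ^ (m + a)) a p c * tau X ε q m a c) +
      (if a = 0 then 0 else tau X ε q m (a - 1) p)

theorem tau_spec (hz : IsQ z) {ι : T →ₐ[ℂ] R} (hι : ∀ t, ι t ∈ PP z)
    (X : Bool → ℕ → Fin N → Fin N → T)
    (hX : ∀ s (a : Fin l) p q, ι (X s a.val p q) =
      (if s then (-1 : ℂ) ^ a.val else 1) • z s (p, a) (q, a))
    (ε : ℂ) (hε : ε * ε = 1) (q : Fin N) (o : Fin l) (ho : o.val = 0) (m : ℕ) :
    ∀ (p : Fin N) (a : Fin l), SS z ε m (p, a) (q, o) - ι (tau X ε q m a.val p) ∈ IL z := by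
  induction m with
  | zero =>
    intro p a
    have : SS z ε 0 (p, a) (q, o) = ι (tau X ε q 0 a.val p) := by
      simp only [SS, tau, dl, Prod.mk.injEq]
      have : a = o ↔ a.val = 0 := by rw [Fin.ext_iff, ho]
      simp only [this, and_comm]
      split_ifs <;> simp_all
    rw [this, sub_self]; exact (IL z).zero_mem
  | succ m ih =>
    intro p a
    have hrec := IL_I (SS_rec hz ε hε m (p, a) (q, o) ho)
    have hsum : ι (tau X ε q (m + 1) a.val p) = ∑ k : Fin N × Fin l,
        ((if k.2 = a then ι (uX X (ε * (-1) ^ (m + a.val)) a.val p k.1) * ι (tau X ε q m a.val k.1)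
          else 0) + (if k.1 = p ∧ k.2.val + 1 = a.val then ι (tau X ε q m k.2.val p) else 0)) := by
      simp only [tau, map_add, map_sum, map_mul, Finset.sum_add_distrib]
      congr 1
      · rw [Fintype.sum_prod_type]; simp
      · split_ifs with h0
        · rw [map_zero, Finset.sum_eq_zero]
          intro k _
          rw [if_neg]; omega
        · rw [Finset.sum_eq_single (p, (⟨a.val - 1, by omega⟩ : Fin l))]
          · rw [if_pos]; exact ⟨rfl, by simp; omega⟩
          · rintro ⟨b1, b2⟩ _ hb
            rw [if_neg]; rintro ⟨rfl, h2⟩; apply hb; simp [Fin.ext_iff] at h2 ⊢; omega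
          · simp
    have hfin : (∑ k, (if (p, a).2 ≤ k.2 then uu z (ε * (-1) ^ m) (p, a) k * SS z ε m k (q, o)
        else chi false (p, a) k • SS z ε m k (q, o))) - ι (tau X ε q (m + 1) a.val p) ∈ IL z := by
      rw [hsum, ← Finset.sum_sub_distrib]
      refine Submodule.sum_mem _ fun k _ => ?_
      obtain ⟨c, b⟩ := k
      have hu : ∀ η : ℂ, a ≤ b → uu z η (p, a) (c, b) ∈ PP z := fun η h =>
        (PP z).add_mem (PP_gen h) ((PP z).smul_mem (PP_gen h) _)
      simp only
      rcases lt_trichotomy a b with hab | rfl | hab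
      · rw [if_pos hab.le, if_neg hab.ne', if_neg (by have := Fin.lt_def.1 hab; omega), add_zero,
          sub_zero]
        have h1 := PP_mul_IL (hu (ε * (-1) ^ m) hab.le) (ih c b)
        rw [mul_sub] at h1
        have h2 : uu z (ε * (-1) ^ m) (p, a) (c, b) * ι (tau X ε q m b.val c) ∈ LL z := by
          refine LL_mul_PP hz ?_ (hι _)
          rw [← one_mul (uu _ _ _ _), uu, mul_add, mul_smul_comm]
          exact (LL z).add_mem (LL_gen (PP z).one_mem hab)
            ((LL z).smul_mem _ (LL_gen (PP z).one_mem hab))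
        simpa using (IL z).add_mem h1 (IL_L h2)
      · rw [if_pos le_rfl, if_pos rfl, if_neg (by omega), add_zero]
        have h1 := PP_mul_IL (hu (ε * (-1) ^ m) le_rfl) (ih c a)
        rw [mul_sub] at h1
        convert h1 using 3
        simp only [uX, uu, map_add, map_smul, hX, if_true, Bool.false_eq_true, if_false, one_smul,
          smul_smul]
        rw [pow_add, mul_assoc, mul_assoc, ← pow_add, Even.neg_one_pow ⟨a.val, rfl⟩, mul_one]
      · rw [if_neg (not_le.2 hab), if_neg hab.ne, zero_add]
        by_cases hc : c = p ∧ b.val + 1 = a.val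
        · obtain ⟨rfl, h2⟩ := hc
          rw [if_pos ⟨rfl, h2⟩]
          have : chi false (c, a) (c, b) = 1 := by simp [chi, h2]
          rw [this, one_smul]
          exact ih c b
        · rw [if_neg hc]
          have : chi false (p, a) (c, b) = 0 := by
            rw [chi, if_neg]; rintro ⟨-, h1, h2⟩; exact hc ⟨h1.symm, h2.symm⟩
          rw [this, zero_smul, sub_zero]; exact (IL z).zero_mem
    simpa using (IL z).add_mem hrec hfin
end Whit

/-! ## The Yangian side -/

section Ops
variable {N : ℕ} {T : Type*} [Ring T] [Algebra ℂ T]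

/-- The operator `P_a`. -/
def PO (X : Bool → ℕ → Fin N → Fin N → T) (ε : ℂ) (a : ℕ) (f : ℕ → Fin N → T) : ℕ → Fin N → T
  | 0, p => 0
  | r + 1, p => ∑ c, uX X (ε * (-1) ^ r) a p c * f r c

/-- The operator `1 - P_a`. -/
def QO (X : Bool → ℕ → Fin N → Fin N → T) (ε : ℂ) (a : ℕ) (f : ℕ → Fin N → T) : ℕ → Fin N → T :=
  fun r p => f r p - PO X ε a f r p

/-- The operator `(1 - P_b)(1 - P_{b+1}) ⋯ (1 - P_{b+k-1})`. -/
def QQ (X : Bool → ℕ → Fin N → Fin N → T) (ε : ℂ) : ℕ → ℕ → (ℕ → Fin N → T) → ℕ → Fin N → T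
  | b, 0, f => f
  | b, k + 1, f => QO X ε b (QQ X ε (b + 1) k f)

theorem QQ_succ (X : Bool → ℕ → Fin N → Fin N → T) (ε : ℂ) (k : ℕ) : ∀ b f,
    QQ X ε b (k + 1) f = QQ X ε b k (QO X ε (b + k) f) := by
  induction k with
  | zero => intro b f; rfl
  | succ k ih =>
    intro b f
    rw [QQ, ih, QQ, add_right_comm b 1 k]; rfl

/-- The delta sequence. -/
def dseq (q : Fin N) : ℕ → Fin N → T := fun r p => if r = 0 ∧ p = q then 1 else 0

theorem QQ_zero_eq (X : Bool → ℕ → Fin N → Fin N → T) (ε : ℂ) (k : ℕ) : ∀ b f p,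
    QQ X ε b k f 0 p = f 0 p := by
  induction k with
  | zero => intro b f p; rfl
  | succ k ih => intro b f p; rw [QQ, QO, PO, sub_zero, ih]

theorem tau_low (X : Bool → ℕ → Fin N → Fin N → T) (ε : ℂ) (q : Fin N) (m : ℕ) :
    ∀ a p, m < a → tau X ε q m a p = 0 := by
  induction m with
  | zero => intro a p h; rw [tau, if_neg]; omega
  | succ m ih =>
    intro a p h
    rw [tau, if_neg (by omega), ih _ _ (by omega), add_zero]
    exact Finset.sum_eq_zero fun c _ => by rw [ih _ _ (by omega), mul_zero]

/-- `v_a(r) = τ(r+a)_a`. -/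
def vv (X : Bool → ℕ → Fin N → Fin N → T) (ε : ℂ) (q : Fin N) (a : ℕ) : ℕ → Fin N → T :=
  fun r p => tau X ε q (r + a) a p

theorem QO_vv_zero (X : Bool → ℕ → Fin N → Fin N → T) (ε : ℂ) (q : Fin N) :
    QO X ε 0 (vv X ε q 0) = dseq q := by
  funext r p
  cases r with
  | zero => simp [QO, vv, PO, tau, dseq]
  | succ r => simp [QO, vv, PO, tau, dseq]

theorem QO_vv_succ (X : Bool → ℕ → Fin N → Fin N → T) (ε : ℂ) (q : Fin N) (a : ℕ) :
    QO X ε (a + 1) (vv X ε q (a + 1)) = vv X ε q a := by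
  funext r p
  have e : ∀ r, (-1 : ℂ) ^ (r + (a + 1) + (a + 1)) = (-1) ^ r := by
    intro r; rw [add_assoc, pow_add, Even.neg_one_pow ⟨a + 1, rfl⟩, mul_one]
  cases r with
  | zero =>
    simp only [QO, vv, PO, sub_zero, zero_add, tau]
    rw [Finset.sum_eq_zero fun c _ => by rw [tau_low _ _ _ _ _ _ (by show 0 + a < a + 1; omega), mul_zero]]
    simp
  | succ r =>
    simp only [QO, vv, PO]
    rw [show r + 1 + (a + 1) = (r + (a + 1)) + 1 by ring, tau, e]
    simp [show r + (a + 1) = r + 1 + a by ring]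

theorem QQ_vv (X : Bool → ℕ → Fin N → Fin N → T) (ε : ℂ) (q : Fin N) (a : ℕ) :
    QQ X ε 0 (a + 1) (vv X ε q a) = dseq q := by
  induction a with
  | zero => exact QO_vv_zero X ε q
  | succ a ih => rw [QQ_succ, zero_add, QO_vv_succ, ih]

/-- Convolution. -/
def cnv (A : ℂ → Fin N → ℕ → Fin N → T) (ε : ℂ) (v : ℕ → Fin N → T) : ℕ → Fin N → T :=
  fun d p => ∑ x ∈ Finset.HasAntidiagonal.antidiagonal d, ∑ c, A (ε * (-1) ^ x.2) c x.1 p * v x.2 c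

theorem cnv_QO (X : Bool → ℕ → Fin N → Fin N → T) (a : ℕ) (A : ℂ → Fin N → ℕ → Fin N → T) (ε : ℂ)
    (v : ℕ → Fin N → T) :
    cnv (fun η c => QO X η a (A η c)) ε v = QO X ε a (cnv A ε v) := by
  funext d p
  simp only [cnv, QO, sub_mul, Finset.sum_sub_distrib]
  congr 1
  cases d with
  | zero => simp [PO]
  | succ d =>
    rw [Finset.Nat.antidiagonal_succ]
    simp only [Finset.sum_cons, Finset.sum_map, PO, zero_mul, Finset.sum_const_zero, zero_add,
      Function.Embedding.prodMap, Function.Embedding.coeFn_mk, Prod.map, cnv]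
    simp only [Finset.mul_sum, Finset.sum_mul, Nat.succ_eq_add_one, Function.Embedding.refl_apply, PO]
    have : ∀ x ∈ Finset.HasAntidiagonal.antidiagonal d, ∑ c, ∑ i, uX X (ε * (-1) ^ x.2 * (-1) ^ x.1) a p i *
        A (ε * (-1) ^ x.2) c x.1 i * v x.2 c = ∑ i, ∑ c, uX X (ε * (-1) ^ d) a p i *
        (A (ε * (-1) ^ x.2) c x.1 i * v x.2 c) := by
      intro x hx
      rw [Finset.sum_comm]
      refine Finset.sum_congr rfl fun i _ => Finset.sum_congr rfl fun c _ => ?_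
      rw [mul_assoc ε, ← pow_add, add_comm x.2, Finset.HasAntidiagonal.mem_antidiagonal.1 hx, mul_assoc]
    rw [Finset.sum_congr rfl this, Finset.sum_comm]

theorem cnv_QQ (X : Bool → ℕ → Fin N → Fin N → T) (k : ℕ) : ∀ (b : ℕ) (A : ℂ → Fin N → ℕ → Fin N → T)
    (ε : ℂ) (v : ℕ → Fin N → T),
    cnv (fun η c => QQ X η b k (A η c)) ε v = QQ X ε b k (cnv A ε v) := by
  induction k with
  | zero => intro b A ε v; rfl
  | succ k ih =>
    intro b A ε v
    simp only [QQ]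
    rw [cnv_QO X b (fun η c => QQ X η (b + 1) k (A η c)), ih]

theorem cnv_dseq (ε : ℂ) (v : ℕ → Fin N → T) : cnv (fun η c => dseq c) ε v = v := by
  funext d p
  rw [cnv, Finset.sum_eq_single (0, d)]
  · simp [dseq]
  · rintro ⟨x1, x2⟩ hx hne
    refine Finset.sum_eq_zero fun c _ => ?_
    rw [dseq, if_neg, zero_mul]
    rintro ⟨h1, -⟩
    apply hne
    simp at hx h1
    ext <;> simp <;> omega
  · simp

/-- The basic identity: the convolution of the Yangian side and the W-algebra side is trivial. -/
theorem cnv_main (X : Bool → ℕ → Fin N → Fin N → T) (ε : ℂ) (q : Fin N) (a : ℕ) :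
    cnv (fun η c => QQ X η 0 (a + 1) (dseq c)) ε (vv X ε q a) = dseq q := by
  rw [cnv_QQ X (a + 1) 0 (fun η c => dseq c), cnv_dseq, QQ_vv]

theorem neg_one_pow_cases (ε : ℂ) (r : ℕ) : ε * (-1) ^ r = ε ∨ ε * (-1) ^ r = -ε := by
  rcases neg_one_pow_eq_or ℂ r with h | h <;> simp [h]

theorem vv_mem (X : Bool → ℕ → Fin N → Fin N → T) (a : ℕ) (S : Subalgebra ℂ T)
    (hE : ∀ ε, (ε = 1 ∨ ε = -1) → ∀ c r p, QQ X ε 0 (a + 1) (dseq c) r p ∈ S)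
    (ε : ℂ) (hε : ε = 1 ∨ ε = -1) (q : Fin N) (d : ℕ) : ∀ p, vv X ε q a d p ∈ S := by
  induction d using Nat.strong_induction_on with
  | _ d ih =>
    intro p
    have hε' : ∀ r, ε * (-1) ^ r = 1 ∨ ε * (-1) ^ r = -1 := by
      intro r
      rcases neg_one_pow_cases ε r with h | h <;> rw [h] <;> rcases hε with h | h <;> simp [h]
    have h := congrFun (congrFun (cnv_main X ε q a) d) p
    rw [cnv, Finset.sum_eq_add_sum_sdiff_singleton_of_mem (i := (0, d)) (by simp)] at h
    simp only [QQ_zero_eq] at h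
    have e1 : ∑ c, (dseq c 0 p : T) * vv X ε q a d c = vv X ε q a d p := by simp [dseq]
    rw [e1] at h
    rw [eq_sub_of_add_eq h]
    refine S.sub_mem ?_ (S.sum_mem fun x hx => S.sum_mem fun c _ => S.mul_mem (hE _ (hε' _) _ _ _) ?_)
    · unfold dseq; split_ifs
      · exact S.one_mem
      · exact S.zero_mem
    · obtain ⟨x1, x2⟩ := x
      simp at hx
      exact ih _ (by simp; omega) c

theorem QQ_mem (X : Bool → ℕ → Fin N → Fin N → T) (a : ℕ) (S : Subalgebra ℂ T)
    (hE : ∀ ε, (ε = 1 ∨ ε = -1) → ∀ q r p, vv X ε q a r p ∈ S)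
    (d : ℕ) : ∀ (ε : ℂ) (hε : ε = 1 ∨ ε = -1) (q p : Fin N), QQ X ε 0 (a + 1) (dseq q) d p ∈ S := by
  have v0 : ∀ ε q p, vv X ε q a 0 p = if p = q then 1 else 0 := by
    intro ε q p
    have h := congrFun (congrFun (cnv_main X ε q a) 0) p
    simpa [cnv, QQ_zero_eq, dseq] using h
  induction d using Nat.strong_induction_on with
  | _ d ih =>
    intro ε hε q p
    have hε' : ∀ r, ε * (-1) ^ r = 1 ∨ ε * (-1) ^ r = -1 := by
      intro r
      rcases neg_one_pow_cases ε r with h | h <;> rw [h] <;> rcases hε with h | h <;> simp [h]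
    have h := congrFun (congrFun (cnv_main X ε q a) d) p
    rw [cnv, Finset.sum_eq_add_sum_sdiff_singleton_of_mem (i := (d, 0)) (by simp)] at h
    simp only [v0, pow_zero, mul_one] at h
    simp only [mul_ite, mul_one, mul_zero, Finset.sum_ite_eq', Finset.mem_univ, if_true] at h
    rw [eq_sub_of_add_eq h]
    refine S.sub_mem ?_ (S.sum_mem fun x hx => S.sum_mem fun c _ => S.mul_mem ?_ (hE _ hε _ _ _))
    · unfold dseq; split_ifs
      · exact S.one_mem
      · exact S.zero_mem
    · obtain ⟨x1, x2⟩ := x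
      simp at hx
      exact ih _ (by simp; omega) _ (hε' _) _ _

end Ops

/-! ## The images of the Yangian generators -/

section Step
variable {N : ℕ} {T : Type*} [Ring T] [Algebra ℂ T]

/-- The values of `ev`, in an abstract algebra. -/
def evA (x : Bool → Fin N → Fin N → T) (r : ℕ) (i j : QIdx N) : T :=
  (if j.1 then (-1 : ℂ) ^ r else 1) •
    (match r with
      | 0 => if xor i.1 j.1 then 0 else algebraMap ℂ T (kd i.2 j.2)
      | 1 => -(x (xor i.1 j.1) j.2 i.2)
      | _ + 2 => 0)

theorem evA_zero (x : Bool → Fin N → Fin N → T) (i : QIdx N) (p : Fin N) :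
    evA x 0 i (false, p) = if i = (false, p) then 1 else 0 := by
  obtain ⟨b, i⟩ := i
  cases b <;> simp [evA, kd]

theorem evA_one (x : Bool → Fin N → Fin N → T) (i : QIdx N) (p : Fin N) :
    evA x 1 i (false, p) = -(x i.1 p i.2) := by
  obtain ⟨b, i⟩ := i
  cases b <;> simp [evA]

theorem evA_two (x : Bool → Fin N → Fin N → T) (r : ℕ) (i j : QIdx N) (h : 2 ≤ r) :
    evA x r i j = 0 := by
  obtain ⟨r, rfl⟩ := Nat.exists_eq_add_of_le' h
  simp [evA]

theorem g_step (g g' : ℕ → QIdx N → QIdx N → T) (x : Bool → Fin N → Fin N → T)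
    (hstep : ∀ (s : ℕ) (i j : QIdx N), g' s i j = ∑ t : Fin (s + 1), ∑ kk : QIdx N,
          ((-1 : ℂ) ^ ((qpar i + qpar kk) * (qpar j + qpar kk))) •
            (g t.val i kk * evA x (s - t.val) kk j))
    (hcx : ∀ s i j p c, g s i j * x false p c = x false p c * g s i j)
    (hcxi : ∀ s i j p c, g s i j * x true p c =
      ((-1 : ℂ) ^ (qpar i + qpar j)) • (x true p c * g s i j))
    (hpar : ∀ s i j, g s (qneg i) (qneg j) = ((-1 : ℂ) ^ s) • g s i j) :
    (∀ i p, g' 0 i (false, p) = g 0 i (false, p)) ∧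
    (∀ s i p, g' (s + 1) i (false, p) = g (s + 1) i (false, p) -
      ∑ c, (x false p c * g s i (false, c) +
        ((-1 : ℂ) ^ s) • (x true p c * g s (qneg i) (false, c)))) := by
  constructor
  · intro i p
    rw [hstep]
    simp only [Nat.reduceAdd, Fin.sum_univ_one, Fin.val_zero, Nat.sub_zero, evA_zero]
    simp [qpar]
  · intro s i p
    rw [hstep, Fin.sum_univ_castSucc, Fin.sum_univ_castSucc, Finset.sum_eq_zero, zero_add]
    · simp only [Fin.val_castSucc, Fin.val_last, Nat.sub_self, Nat.add_sub_cancel_left, evA_one,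
        evA_zero]
      rw [add_comm, sub_eq_add_neg]
      congr 1
      · simp [qpar]
      · rw [Fintype.sum_prod_type, Fintype.sum_bool, ← Finset.sum_add_distrib,
          ← Finset.sum_neg_distrib]
        refine Finset.sum_congr rfl fun c _ => ?_
        have e : g s i (true, c) = ((-1 : ℂ) ^ s) • g s (qneg i) (false, c) := by
          rw [← hpar]; simp [qneg]
        simp only [mul_neg, hcx, hcxi, smul_neg, smul_smul]
        simp only [e, mul_smul_comm, smul_smul]
        have e2 : ((-1 : ℂ) ^ ((qpar i + qpar ((true, c) : QIdx N)) *
            (qpar ((false, p) : QIdx N) + qpar ((true, c) : QIdx N))) * (-1) ^ (qpar i + qpar ((true, c) : QIdx N))) = 1 := by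
          simp only [qpar, if_true, Bool.false_eq_true, if_false, zero_add, mul_one]
          rw [← pow_add, Even.neg_one_pow ⟨_, rfl⟩]
        have e3 : ((-1 : ℂ) ^ ((qpar i + qpar ((false, c) : QIdx N)) *
            (qpar ((false, p) : QIdx N) + qpar ((false, c) : QIdx N)))) = 1 := by
          simp [qpar]
        rw [e2, e3, one_mul, one_smul]
        abel
    · intro t _
      refine Finset.sum_eq_zero fun kk _ => ?_
      rw [evA_two _ _ _ _ (by have := t.isLt; simp only [Fin.val_castSucc]; omega), mul_zero, smul_zero]

theorem E_step (g g' : ℕ → QIdx N → QIdx N → T) (X : Bool → ℕ → Fin N → Fin N → T)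
    (h0 : ∀ i p, g' 0 i (false, p) = g 0 i (false, p))
    (h1 : ∀ s i p, g' (s + 1) i (false, p) = g (s + 1) i (false, p) -
      ∑ c, (X false 0 p c * g s i (false, c) +
        ((-1 : ℂ) ^ s) • (X true 0 p c * g s (qneg i) (false, c))))
    (ε : ℂ) (hε : ε * ε = 1) (q : Fin N) :
    (fun s p => g' s (false, q) (false, p) + ε • g' s (true, q) (false, p)) =
      QO X ε 0 (fun s p => g s (false, q) (false, p) + ε • g s (true, q) (false, p)) := by
  funext s p
  cases s with
  | zero => simp [QO, PO, h0]
  | succ s =>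
    simp only [QO, PO, h1, uX]
    rw [smul_sub, sub_add_sub_comm]
    congr 1
    rw [Finset.smul_sum, ← Finset.sum_add_distrib]
    refine Finset.sum_congr rfl fun c _ => ?_
    simp only [qneg, Bool.not_false, Bool.not_true, mul_add, add_mul, smul_mul_assoc,
      mul_smul_comm, smul_add, smul_smul]
    have e : ∀ y : ℂ, ε * y * ε = y := by intro y; linear_combination y * hε
    have e' : ∀ y : ℂ, ε * (ε * y) = y := by intro y; linear_combination y * hε
    simp only [e, e']
    module
end Step

section TQs
variable {N : ℕ}

theorem xT_comm {k : ℕ} (i i' : Fin k) (hi : i ≠ i') (p q r s : Fin N) :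
    (xT i p q : TQ N k) * xT i' r s = xT i' r s * xT i p q := by
  have := RingQuot.mkAlgHom_rel ℂ (TRel.xx i i' p q r s)
  simp only [map_sub, map_mul, map_smul, kdl, if_neg hi, zero_mul, zero_smul, sub_zero] at this
  rw [map_zero] at this
  exact sub_eq_zero.1 this
theorem xxiT_comm {k : ℕ} (i i' : Fin k) (hi : i ≠ i') (p q r s : Fin N) :
    (xT i p q : TQ N k) * xiT i' r s = xiT i' r s * xT i p q := by
  have := RingQuot.mkAlgHom_rel ℂ (TRel.xxi i i' p q r s)
  simp only [map_sub, map_mul, map_smul, kdl, if_neg hi, zero_mul, zero_smul, sub_zero] at this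
  rw [map_zero] at this
  exact sub_eq_zero.1 this
theorem xixiT_comm {k : ℕ} (i i' : Fin k) (hi : i ≠ i') (p q r s : Fin N) :
    (xiT i p q : TQ N k) * xiT i' r s = -(xiT i' r s * xiT i p q) := by
  have := RingQuot.mkAlgHom_rel ℂ (TRel.xixi i i' p q r s)
  simp only [map_add, map_mul, map_smul, kdl, if_neg hi, zero_mul, zero_smul, add_zero] at this
  rw [map_zero] at this
  exact eq_neg_of_add_eq_zero_left this

/-- Uniform generators of `TQ`. -/
def xx {k : ℕ} (s : Bool) (a : Fin k) (p q : Fin N) : TQ N k := if s then xiT a p q else xT a p q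

/-- Uniform generators, indexed by natural numbers. -/
def XT (N k : ℕ) (s : Bool) (a : ℕ) (p q : Fin N) : TQ N k :=
  if h : a < k then xx s ⟨a, h⟩ p q else 0

theorem emb_evval {k : ℕ} (a : Fin k) (φ : UQ N →ₐ[ℂ] TQ N k) (h1 : ∀ i j, φ (Ue i j) = xT a i j)
    (h2 : ∀ i j, φ (Uf i j) = xiT a i j) (r : ℕ) (i j : QIdx N) :
    φ (evval r i j) = evA (fun s => xx s a) r i j := by
  unfold evval evA
  rw [map_smul]
  congr 1
  match r with
  | 0 => 
    simp only; split_ifs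
    · exact map_zero _
    · exact AlgHom.commutes _ _
  | 1 =>
    simp only [map_neg, xx]; split_ifs
    · rw [h2]
    · rw [h1]
  | r + 2 => exact map_zero _

theorem TY_par (m : ℕ) (i j : QIdx N) : (TY m (qneg i) (qneg j) : YQ N) = ((-1 : ℂ) ^ m) • TY m i j := by
  cases m with
  | zero =>
    simp only [TY, Tf, pow_zero, one_smul]
    have : kdq (qneg i) (qneg j) = kdq i j := by
      obtain ⟨a, i⟩ := i
      obtain ⟨b, j⟩ := j
      cases a <;> cases b <;> simp [kdq, qneg]
    rw [this]
  | succ m =>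
    have := RingQuot.mkAlgHom_rel ℂ (YRel.par m i j)
    rw [map_smul] at this
    exact this

theorem skew_mul {T' : Type*} [Ring T'] [Algebra ℂ T'] (A B ζ : T') (α β c : ℂ)
    (hA : A * ζ = α • (ζ * A)) (hB : B * ζ = β • (ζ * B)) :
    (c • (A * B)) * ζ = (α * β) • (ζ * (c • (A * B))) := by
  rw [smul_mul_assoc, mul_assoc, hB, mul_smul_comm, ← mul_assoc, hA, smul_mul_assoc, mul_smul_comm,
    mul_assoc, smul_smul, smul_smul, smul_smul]
  congr 1
  ring

theorem hom_evA {T' : Type*} [Ring T'] [Algebra ℂ T'] (x : Bool → Fin N → Fin N → T') (ζ : T')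
    (η : ℂ) (hη : η * η = 1) (h : ∀ s p q, x s p q * ζ = (if s then η else 1) • (ζ * x s p q))
    (r : ℕ) (i j : QIdx N) : evA x r i j * ζ = η ^ (qpar i + qpar j) • (ζ * evA x r i j) := by
  unfold evA
  rw [smul_mul_assoc, mul_smul_comm, smul_comm]
  congr 1
  obtain ⟨a, i⟩ := i
  obtain ⟨b, j⟩ := j
  match r with
  | 0 => cases a <;> cases b <;> simp [qpar, pow_succ, hη, Algebra.commutes]
  | 1 => cases a <;> cases b <;> simp [qpar, pow_succ, hη, h]
  | r + 2 => simp

variable (emb : ∀ k : ℕ, Fin k → (UQ N →ₐ[ℂ] TQ N k))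
    (hembx : ∀ (k : ℕ) (a : Fin k) (i j : Fin N), emb k a (Ue i j) = xT a i j)
    (hembxi : ∀ (k : ℕ) (a : Fin k) (i j : Fin N), emb k a (Uf i j) = xiT a i j)
    (ishUp : ∀ k : ℕ, TQ N k →ₐ[ℂ] TQ N (k + 1))
    (hishx : ∀ (k : ℕ) (a : Fin k) (i j : Fin N), ishUp k (xT a i j) = xT a.succ i j)
    (hishxi : ∀ (k : ℕ) (a : Fin k) (i j : Fin N), ishUp k (xiT a i j) = xiT a.succ i j)
    (G : ∀ k : ℕ, YQ N →ₐ[ℂ] TQ N k)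
    (hG1 : ∀ (s : ℕ) (i j : QIdx N), G 1 (TY s i j) = emb 1 0 (evval s i j))
    (hGstep : ∀ (k : ℕ), 1 ≤ k → ∀ (s : ℕ) (i j : QIdx N),
      G (k + 1) (TY s i j) =
        ∑ t : Fin (s + 1), ∑ kk : QIdx N,
          ((-1 : ℂ) ^ ((qpar i + qpar kk) * (qpar j + qpar kk))) •
            (ishUp k (G k (TY t.val i kk)) * emb (k + 1) 0 (evval (s - t.val) kk j)))

include hembx hembxi hishx hishxi hG1 hGstep in
theorem G_hom {T' : Type*} [Ring T'] [Algebra ℂ T'] (ζ : T') (η : ℂ) (hη : η * η = 1)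
    (k : ℕ) (hk : 1 ≤ k) :
    ∀ (φ : TQ N k →ₐ[ℂ] T') (h : ∀ s a p q, φ (xx s a p q) * ζ =
      (if s then η else 1) • (ζ * φ (xx s a p q))) (s : ℕ) (i j : QIdx N),
    φ (G k (TY s i j)) * ζ = η ^ (qpar i + qpar j) • (ζ * φ (G k (TY s i j))) := by
  induction k, hk using Nat.le_induction with
  | base =>
    intro φ h s i j
    have e : φ (G 1 (TY s i j)) = evA (fun s p q => φ (xx s 0 p q)) s i j := by
      rw [hG1]
      have := emb_evval (0 : Fin 1) (emb 1 0) (hembx 1 0) (hembxi 1 0) s i j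
      rw [this]
      unfold evA
      rw [map_smul]
      congr 1
      match s with
      | 0 => simp only; split_ifs
             · exact map_zero _
             · exact AlgHom.commutes _ _
      | 1 => simp only [map_neg]
      | s + 2 => exact map_zero _
    rw [e]
    exact hom_evA _ ζ η hη (fun s p q => h s 0 p q) s i j
  | succ k hk ih =>
    intro φ h s i j
    have e : ∀ r kk, φ (emb (k+1) 0 (evval r kk j)) = evA (fun s p q => φ (xx s 0 p q)) r kk j := by
      intro r kk
      rw [emb_evval (0 : Fin (k+1)) (emb (k+1) 0) (hembx _ 0) (hembxi _ 0)]
      unfold evA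
      rw [map_smul]
      congr 1
      match r with
      | 0 => simp only; split_ifs
             · exact map_zero _
             · exact AlgHom.commutes _ _
      | 1 => simp only [map_neg]
      | s + 2 => exact map_zero _
    have h2 := ih (φ.comp (ishUp k)) (by
      intro s a p q
      have : ishUp k (xx s a p q) = xx s a.succ p q := by
        unfold xx; split_ifs
        · exact hishxi _ _ _ _
        · exact hishx _ _ _ _
      rw [AlgHom.comp_apply, this]
      exact h _ _ _ _)
    rw [hGstep k hk, map_sum, Finset.sum_mul, Finset.mul_sum, Finset.smul_sum]
    refine Finset.sum_congr rfl fun t _ => ?_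
    rw [map_sum, Finset.sum_mul, Finset.mul_sum, Finset.smul_sum]
    refine Finset.sum_congr rfl fun kk _ => ?_
    have h3 := hom_evA (fun s p q => φ (xx s 0 p q)) ζ η hη (fun s p q => h s 0 p q) (s - t.val) kk j
    have h4 := h2 t.val i kk
    rw [AlgHom.comp_apply] at h4
    rw [map_smul, map_mul, e, skew_mul _ _ ζ _ _ _ h4 h3, ← pow_add,
      show qpar i + qpar kk + (qpar kk + qpar j) = qpar i + qpar j + 2 * qpar kk by ring,
      pow_add, pow_mul, pow_two, hη, one_pow, mul_one]

include hishx hishxi in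
theorem ish_QQ (k : ℕ) (ε : ℂ) (j : ℕ) : ∀ b, b + j ≤ k → ∀ (f : ℕ → Fin N → TQ N k) (s : ℕ) (p : Fin N),
    ishUp k (QQ (XT N k) ε b j f s p) = QQ (XT N (k + 1)) ε (b + 1) j (fun s p => ishUp k (f s p)) s p := by
  induction j with
  | zero => intro b hb f s p; rfl
  | succ j ih =>
    intro b hb f s p
    have hX : ∀ t p c, ishUp k (XT N k t b p c) = XT N (k + 1) t (b + 1) p c := by
      intro t p c
      have : b < k := by omega
      rw [XT, XT, dif_pos this, dif_pos (by omega)]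
      unfold xx; split_ifs
      · exact hishxi _ _ _ _
      · exact hishx _ _ _ _
    rw [QQ, QQ, QO, QO, map_sub, ih _ (by omega)]
    congr 1
    cases s with
    | zero => exact map_zero _
    | succ s =>
      rw [PO, PO, map_sum]
      refine Finset.sum_congr rfl fun c _ => ?_
      rw [map_mul, ih _ (by omega), uX, uX, map_add, map_smul, hX, hX]

include hembx hembxi hishx hishxi hG1 hGstep in
theorem G_eq (k : ℕ) (hk : 1 ≤ k) : ∀ (ε : ℂ) (hε : ε * ε = 1) (q : Fin N),
    (fun s p => G k (TY s (false, q) (false, p)) + ε • G k (TY s (true, q) (false, p))) =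
      QQ (XT N k) ε 0 k (dseq q) := by
  induction k, hk using Nat.le_induction with
  | base =>
    intro ε hε q
    funext s p
    have e : ∀ i, G 1 (TY s i (false, p)) = evA (fun s => xx s 0) s i (false, p) := by
      intro i
      rw [hG1]
      exact emb_evval (0 : Fin 1) (emb 1 0) (hembx 1 0) (hembxi 1 0) s i _
    rw [e, e, QQ, QQ, QO]
    match s with
    | 0 => simp [evA_zero, PO, dseq, eq_comm]
    | 1 =>
      rw [evA_one, evA_one, PO]
      simp only [dseq, uX, XT]
      simp
      abel
    | s + 2 => rw [evA_two _ _ _ _ (by omega), evA_two _ _ _ _ (by omega)]; simp [PO, dseq]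
  | succ k hk ih =>
    intro ε hε q
    have hxi : ∀ s (a : Fin k) p q, ishUp k (xx s a p q) = xx s a.succ p q := by
      intro s a p q
      unfold xx; split_ifs
      · exact hishxi _ _ _ _
      · exact hishx _ _ _ _
    have hne : ∀ a : Fin k, a.succ ≠ 0 := fun a => Fin.succ_ne_zero a
    obtain ⟨h0, h1⟩ := g_step (fun s i j => ishUp k (G k (TY s i j)))
      (fun s i j => G (k + 1) (TY s i j)) (fun s p q => XT N (k + 1) s 0 p q)
      (by
        intro s i j
        rw [hGstep k hk]
        refine Finset.sum_congr rfl fun t _ => Finset.sum_congr rfl fun kk _ => ?_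
        rw [emb_evval (0 : Fin (k + 1)) (emb (k + 1) 0) (hembx _ 0) (hembxi _ 0)]
        congr 3
        )
      (by
        intro s i j p c
        have := G_hom emb hembx hembxi ishUp hishx hishxi G hG1 hGstep (XT N (k + 1) false 0 p c) 1
          (by norm_num) k hk (ishUp k) (by
            intro s a p' q'
            rw [hxi]
            simp only [ite_self, one_smul, XT, Nat.zero_lt_succ, dif_pos]
            cases s
            · exact xT_comm _ _ (hne a) _ _ _ _
            · exact (xxiT_comm _ _ (hne a).symm _ _ _ _).symm) s i j
        simpa using this)
      (by
        intro s i j p c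
        exact G_hom emb hembx hembxi ishUp hishx hishxi G hG1 hGstep (XT N (k + 1) true 0 p c) (-1)
          (by norm_num) k hk (ishUp k) (by
            intro s a p' q'
            rw [hxi]
            simp only [XT, Nat.zero_lt_succ, dif_pos]
            cases s
            · rw [if_neg (by simp), one_smul]; exact xxiT_comm _ _ (hne a) _ _ _ _
            · rw [if_pos rfl]; exact (xixiT_comm _ _ (hne a) _ _ _ _).trans (neg_one_smul ℂ _).symm) s i j)
      (by
        intro s i j
        simp only [TY_par, map_smul])
    refine (E_step (fun s i j => ishUp k (G k (TY s i j)))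
      (fun s i j => G (k + 1) (TY s i j)) (XT N (k + 1)) h0 h1 ε hε q).trans ?_
    rw [QQ]
    congr 1
    funext s p
    rw [zero_add]
    have := ish_QQ ishUp hishx hishxi k ε k 0 (by omega) (dseq q) s p
    rw [← ih ε hε q] at this
    simp only [map_add, map_smul] at this
    refine this.trans ?_
    rw [zero_add]
    congr 1
    funext s p
    unfold dseq
    split_ifs
    · exact map_one _
    · exact map_zero _

include hembx hembxi hishx hishxi hG1 hGstep in
/-- A subalgebra contains the image of `G` iff it contains the coefficients. -/
theorem G_range_le (k : ℕ) (hk : 1 ≤ k) (S : Subalgebra ℂ (TQ N k))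
    (hS : ∀ ε : ℂ, (ε = 1 ∨ ε = -1) → ∀ q r p, QQ (XT N k) ε 0 k (dseq q) r p ∈ S) (y : YQ N) :
    G k y ∈ S := by
  have hE := G_eq emb hembx hembxi ishUp hishx hishxi G hG1 hGstep k hk
  have h1 : ∀ s q p, G k (TY s (false, q) (false, p)) + (1 : ℂ) • G k (TY s (true, q) (false, p)) ∈ S := by
    intro s q p
    have := congrFun (congrFun (hE 1 (by norm_num) q) s) p
    rw [this]; exact hS _ (Or.inl rfl) _ _ _
  have h2 : ∀ s q p, G k (TY s (false, q) (false, p)) + (-1 : ℂ) • G k (TY s (true, q) (false, p)) ∈ S := by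
    intro s q p
    have := congrFun (congrFun (hE (-1) (by norm_num) q) s) p
    rw [this]; exact hS _ (Or.inr rfl) _ _ _
  have gen : ∀ {A : Type _} [Ring A] [Algebra ℂ A] (S : Subalgebra ℂ A) (a b : A), a + (1 : ℂ) • b ∈ S →
      a + (-1 : ℂ) • b ∈ S → a ∈ S ∧ b ∈ S := by
    intro A _ _ S a b h1 h2
    have e1 : a = (2⁻¹ : ℂ) • ((a + (1 : ℂ) • b) + (a + (-1 : ℂ) • b)) := by module
    have e2 : b = (2⁻¹ : ℂ) • ((a + (1 : ℂ) • b) - (a + (-1 : ℂ) • b)) := by module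
    exact ⟨e1 ▸ S.smul_mem (S.add_mem h1 h2) _, e2 ▸ S.smul_mem (S.sub_mem h1 h2) _⟩
  have h3 : ∀ s (i : QIdx N) p, G k (TY s i (false, p)) ∈ S := by
    rintro s ⟨b, q⟩ p
    cases b
    · exact (gen S _ _ (h1 s q p) (h2 s q p)).1
    · exact (gen S _ _ (h1 s q p) (h2 s q p)).2
  have h4 : ∀ s (i j : QIdx N), G k (TY s i j) ∈ S := by
    rintro s i ⟨b, p⟩
    cases b
    · exact h3 s i p
    · have e : (TY s i (true, p) : YQ N) = ((-1 : ℂ) ^ s) • TY s (qneg i) (false, p) := by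
        rw [← TY_par]; simp [qneg]
      rw [e, map_smul]
      exact S.smul_mem (h3 _ _ _) _
  obtain ⟨a, rfl⟩ := RingQuot.mkAlgHom_surjective ℂ (YRel N) y
  induction a using FreeAlgebra.induction with
  | grade0 r => rw [AlgHom.commutes, AlgHom.commutes]; exact S.algebraMap_mem r
  | grade1 g => obtain ⟨m, i, j⟩ := g; exact h4 (m + 1) i j
  | mul a b ha hb => rw [map_mul, map_mul]; exact S.mul_mem ha hb
  | add a b ha hb => rw [map_add, map_add]; exact S.add_mem ha hb

end TQs

/-! ## The filtration and the generation theorem for Whittaker vectors -/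

section Filt
variable {N l : ℕ} {R : Type*} [Ring R] [Algebra ℂ R] {z : Bool → Fin N × Fin l → Fin N × Fin l → R}

/-- The constant term in the commutator of two shifted generators. -/
def th (s t : Bool) (i j k m : Fin N × Fin l) : ℂ :=
  dl j k * chi (xor s t) i m - sg s t * dl m i * chi (xor s t) k j

theorem zc_comm (hz : IsQ z) (s t : Bool) (i j k m : Fin N × Fin l) :
    zc z s i j * zc z t k m = sg s t • (zc z t k m * zc z s i j) + th s t i j k m • 1 +
      (dl j k • zc z (xor s t) i m - (sg s t * dl m i) • zc z (xor s t) k j) := by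
  have h := hz.mul_eq s t i j k m
  have e : ∀ s i j, zc z s i j = z s i j - chi s i j • 1 := fun _ _ _ => rfl
  simp only [e, th, sub_mul, mul_sub, h, smul_mul_assoc, mul_smul_comm, one_mul, mul_one, smul_sub,
    smul_smul]
  cases s <;> cases t
  · simp [sg]; module
  · simp [sg]; module
  · simp [sg]; module
  · simp [sg, chi_true]; module

/-- Offset. -/
def off (i j : Fin N × Fin l) : ℤ := (j.2.val : ℤ) - i.2.val

theorem chi_ne {s : Bool} {i j : Fin N × Fin l} (h : off i j ≠ -1) : chi s i j = 0 := by
  rw [chi, if_neg]; rintro ⟨-, -, h2⟩; apply h; rw [off, h2]; push_cast; ring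

theorem off_add {i j k m : Fin N × Fin l} (h : j = k) : off i m = off i j + off k m := by
  subst h; simp [off]

theorem th_ne {s t : Bool} {i j k m : Fin N × Fin l} (h : off i j + off k m ≠ -1) :
    th s t i j k m = 0 := by
  unfold th
  have h1 : dl j k * chi (xor s t) i m = 0 := by
    by_cases e : j = k
    · rw [chi_ne (by rw [off_add e]; exact h), mul_zero]
    · rw [dl_ne e, zero_mul]
  have h2 : dl m i * chi (xor s t) k j = 0 := by
    by_cases e : m = i
    · rw [chi_ne (by rw [off_add e, add_comm]; exact h), mul_zero]
    · rw [dl_ne e, zero_mul]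
  rw [h1, mul_assoc, h2]; simp

/-- The graded pieces. -/
def Gs (z : Bool → Fin N × Fin l → Fin N × Fin l → R) (t : ℤ) : Submodule ℂ R :=
  Submodule.span ℂ {x | ∃ s i j, off i j = t ∧ x = zc z s i j}

theorem Gs_zc {s : Bool} {i j : Fin N × Fin l} {t : ℤ} (h : off i j = t) : zc z s i j ∈ Gs z t :=
  Submodule.subset_span ⟨s, i, j, h, rfl⟩

theorem Gs_br (s t : Bool) (i j k m : Fin N × Fin l) :
    (dl j k • zc z (xor s t) i m - (sg s t * dl m i) • zc z (xor s t) k j) ∈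
      Gs z (off i j + off k m) := by
  refine (Gs z _).sub_mem (dl_smul_mem' _ _ _ _ fun e => Gs_zc (off_add e))
    (dl_smul_mem _ _ _ _ _ fun e => Gs_zc ?_)
  rw [off_add e, add_comm]

/-- Adapted letters `(s, p, q, k, b)`. -/
abbrev Lt (N l : ℕ) := Bool × Fin N × Fin N × Fin l × Fin l

/-- Signs. -/
def sn (s : Bool) (a : ℕ) : ℂ := if s then (-1) ^ a else 1

theorem sn_sq (s : Bool) (a : ℕ) : sn s a * sn s a = 1 := by
  cases s
  · simp [sn]
  · simp [sn, ← mul_pow]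

/-- Coefficients of adapted letters. -/
def cf (u : Lt N l) (i j : Fin l) : ℂ :=
  if i ≤ u.2.2.2.2 ∧ j.val = i.val + u.2.2.2.1.val then sn u.1 i.val else 0

/-- Values of adapted letters. -/
def cl (z : Bool → Fin N × Fin l → Fin N × Fin l → R) (u : Lt N l) : R :=
  ∑ i, ∑ j, cf u i j • zc z u.1 (u.2.1, i) (u.2.2.1, j)

/-- The degree of a letter. -/
def dg (u : Lt N l) : ℤ := 2 * (u.2.2.2.1.val : ℤ) + 1
/-- The degree of a word. -/
def dw (w : List (Lt N l)) : ℤ := (w.map dg).sum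
/-- The value of a word. -/
def wp (z : Bool → Fin N × Fin l → Fin N × Fin l → R) (w : List (Lt N l)) : R := (w.map (cl z)).prod

theorem cf_ne {u : Lt N l} {i j : Fin l} (p q : Fin N) (h : off (p, i) (q, j) ≠ u.2.2.2.1.val) : cf u i j = 0 := by
  rw [cf, if_neg]; rintro ⟨-, h2⟩; apply h; simp only [off, h2]; push_cast; ring

/-- The constant term in the commutator of a shifted generator with a letter. -/
def Th (s : Bool) (i j : Fin N × Fin l) (u : Lt N l) : ℂ :=
  ∑ a, ∑ b, cf u a b * th s u.1 i j (u.2.1, a) (u.2.2.1, b)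

theorem Th_ne {s : Bool} {i j : Fin N × Fin l} {u : Lt N l} (h : off i j + u.2.2.2.1.val ≠ -1) :
    Th s i j u = 0 := by
  refine Finset.sum_eq_zero fun a _ => Finset.sum_eq_zero fun b _ => ?_
  by_cases e : off (u.2.1, a) (u.2.2.1, b) = u.2.2.2.1.val
  · rw [th_ne (by rw [e]; exact h), mul_zero]
  · rw [cf_ne _ _ e, zero_mul]

theorem zc_cl (hz : IsQ z) (s : Bool) (i j : Fin N × Fin l) (u : Lt N l) :
    ∃ g ∈ Gs z (off i j + u.2.2.2.1.val), zc z s i j * cl z u =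
      sg s u.1 • (cl z u * zc z s i j) + Th s i j u • 1 + g := by
  refine ⟨∑ a, ∑ b, cf u a b • (dl j (u.2.1, a) • zc z (xor s u.1) i (u.2.2.1, b) -
    (sg s u.1 * dl (u.2.2.1, b) i) • zc z (xor s u.1) (u.2.1, a) j), ?_, ?_⟩
  · refine Submodule.sum_mem _ fun a _ => Submodule.sum_mem _ fun b _ => ?_
    by_cases e : off (u.2.1, a) (u.2.2.1, b) = u.2.2.2.1.val
    · rw [← e]; exact (Gs z _).smul_mem _ (Gs_br _ _ _ _ _ _)
    · rw [cf_ne _ _ e, zero_smul]; exact (Gs z _).zero_mem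
  · simp only [cl, Th, Finset.mul_sum, Finset.sum_mul, Finset.smul_sum, Finset.sum_smul,
      ← Finset.sum_add_distrib]
    refine Finset.sum_congr rfl fun a _ => Finset.sum_congr rfl fun b _ => ?_
    rw [mul_smul_comm, zc_comm hz, smul_mul_assoc]
    module

theorem cl_cl (hz : IsQ z) (v u : Lt N l) :
    ∃ g ∈ Gs z (v.2.2.2.1.val + u.2.2.2.1.val), cl z v * cl z u =
      sg v.1 u.1 • (cl z u * cl z v) + g := by
  choose g hg h using fun i j => zc_cl hz v.1 (v.2.1, i) (v.2.2.1, j) u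
  refine ⟨∑ i, ∑ j, cf v i j • g i j, ?_, ?_⟩
  · refine Submodule.sum_mem _ fun a _ => Submodule.sum_mem _ fun b _ => ?_
    by_cases e : off (v.2.1, a) (v.2.2.1, b) = v.2.2.2.1.val
    · rw [← e]; exact (Gs z _).smul_mem _ (hg _ _)
    · rw [cf_ne _ _ e, zero_smul]; exact (Gs z _).zero_mem
  · have : cl z v = ∑ i, ∑ j, cf v i j • zc z v.1 (v.2.1, i) (v.2.2.1, j) := rfl
    rw [this]
    simp only [Finset.mul_sum, Finset.sum_mul, Finset.smul_sum, ← Finset.sum_add_distrib]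
    refine Finset.sum_congr rfl fun a _ => Finset.sum_congr rfl fun b _ => ?_
    rw [smul_mul_assoc, h, mul_smul_comm]
    by_cases e : off (v.2.1, a) (v.2.2.1, b) = v.2.2.2.1.val
    · rw [Th_ne (by rw [e]; omega)]; module
    · rw [cf_ne _ _ e]; simp

/-- The filtration. -/
def FF (z : Bool → Fin N × Fin l → Fin N × Fin l → R) (d : ℤ) : Submodule ℂ R :=
  (II z).restrictScalars ℂ ⊔ Submodule.span ℂ {x | ∃ w, dw w ≤ d ∧ x = wp z w}

theorem FF_I {x : R} (d : ℤ) (hx : x ∈ II z) : x ∈ FF z d := Submodule.mem_sup_left hx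
theorem FF_w {w : List (Lt N l)} {d : ℤ} (h : dw w ≤ d) : wp z w ∈ FF z d :=
  Submodule.mem_sup_right (Submodule.subset_span ⟨w, h, rfl⟩)

theorem FF_ind {d : ℤ} (C : Submodule ℂ R) (hI : ∀ x ∈ II z, x ∈ C)
    (hw : ∀ w, dw w ≤ d → wp z w ∈ C) {x : R} (hx : x ∈ FF z d) : x ∈ C := by
  have : FF z d ≤ C := by
    refine sup_le (fun x hx => hI x hx) (Submodule.span_le.2 ?_)
    rintro x ⟨w, h, rfl⟩
    exact hw w h
  exact this hx

theorem FF_mono {d e : ℤ} (h : d ≤ e) {x : R} (hx : x ∈ FF z d) : x ∈ FF z e :=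
  FF_ind _ (fun x hx => FF_I _ hx) (fun w hw => FF_w (hw.trans h)) hx

theorem dg_pos (u : Lt N l) : 1 ≤ dg u := by unfold dg; omega
theorem dw_cons (u : Lt N l) (w : List (Lt N l)) : dw (u :: w) = dg u + dw w := by simp [dw]
theorem wp_cons (u : Lt N l) (w : List (Lt N l)) : wp z (u :: w) = cl z u * wp z w := by simp [wp]
theorem dw_ge (w : List (Lt N l)) : (w.length : ℤ) ≤ dw w := by
  induction w with
  | nil => simp [dw]
  | cons u w ih => rw [dw_cons]; have := dg_pos u; simp only [List.length_cons]; push_cast; omega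

/-- To prove that left multiplication by `a` maps `FF d` to `FF e`. -/
theorem FF_mul {a : R} {d e : ℤ} (hw : ∀ w, dw w ≤ d → a * wp z w ∈ FF z e) {x : R}
    (hx : x ∈ FF z d) : a * x ∈ FF z e :=
  FF_ind ((FF z e).comap (LinearMap.mulLeft ℂ a))
    (fun x hx => FF_I _ (II_mul_left a hx)) hw hx

theorem cl_FF (u : Lt N l) {d : ℤ} {x : R} (hx : x ∈ FF z d) : cl z u * x ∈ FF z (d + dg u) := by
  refine FF_mul (fun w hw => ?_) hx
  rw [← wp_cons]; exact FF_w (by rw [dw_cons]; omega)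

theorem zc_letters (s : Bool) (p q : Fin N) (i j : Fin l) (h : i ≤ j) :
    ∃ u v : Lt N l, dg u = 2 * off (p, i) (q, j) + 1 ∧ dg v = 2 * off (p, i) (q, j) + 1 ∧
      ∃ c d : ℂ, zc z s (p, i) (q, j) = c • cl z u + d • cl z v := by
  have hk : j.val - i.val < l := by omega
  have h' : i.val ≤ j.val := h
  have hdg : ∀ b : Fin l, dg ((s, p, q, ⟨j.val - i.val, hk⟩, b) : Lt N l) = 2 * off (p, i) (q, j) + 1 := by
    intro b; simp only [dg, off]; omega
  by_cases hi : i.val = 0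
  · refine ⟨(s, p, q, ⟨j.val - i.val, hk⟩, i), (s, p, q, ⟨j.val - i.val, hk⟩, i), hdg _, hdg _, sn s i, 0, ?_⟩
    rw [zero_smul, add_zero]
    unfold cl
    rw [Finset.sum_eq_single i, Finset.sum_eq_single j]
    · simp only [cf]
      rw [if_pos ⟨le_rfl, by omega⟩, smul_smul, sn_sq, one_smul]
    · intro b _ hb
      simp only [cf]
      rw [if_neg, zero_smul]
      rintro ⟨-, h2⟩; apply hb; ext; omega
    · simp
    · intro a _ ha
      refine Finset.sum_eq_zero fun b _ => ?_
      simp only [cf]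
      rw [if_neg, zero_smul]
      rintro ⟨h1, h2⟩; apply ha; ext; have := Fin.le_def.1 h1; omega
    · simp
  · refine ⟨(s, p, q, ⟨j.val - i.val, hk⟩, i), (s, p, q, ⟨j.val - i.val, hk⟩, ⟨i.val - 1, by omega⟩),
      hdg _, hdg _, sn s i, - sn s i, ?_⟩
    rw [neg_smul, ← sub_eq_add_neg, ← smul_sub]
    simp only [cl]
    rw [← Finset.sum_sub_distrib, Finset.sum_eq_single i]
    · rw [← Finset.sum_sub_distrib, Finset.sum_eq_single j]
      · simp only [cf]
        rw [if_pos ⟨le_rfl, by omega⟩, if_neg, zero_smul, sub_zero, smul_smul, sn_sq, one_smul]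
        rintro ⟨h1, -⟩; have := Fin.le_def.1 h1; simp at this; omega
      · intro b _ hb
        simp only [cf]
        rw [if_neg, if_neg, sub_self]
        · rintro ⟨-, h2⟩; apply hb; ext; omega
        · rintro ⟨-, h2⟩; apply hb; ext; omega
      · simp
    · intro a _ ha
      rw [← Finset.sum_sub_distrib]
      refine Finset.sum_eq_zero fun b _ => ?_
      simp only [cf]
      have : a ≤ i ↔ a ≤ (⟨i.val - 1, by omega⟩ : Fin l) := by
        rw [Fin.le_def, Fin.le_def]; simp only
        have : a.val ≠ i.val := fun h => ha (Fin.ext h)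
        omega
      rw [← sub_smul]
      simp only [this, sub_self, zero_smul]
    · simp

theorem zc_wp (hz : IsQ z) (w : List (Lt N l)) : ∀ (s : Bool) (i j : Fin N × Fin l),
    zc z s i j * wp z w ∈ FF z (dw w + 2 * off i j + 1) := by
  induction w with
  | nil =>
    rintro s ⟨p, i⟩ ⟨q, j⟩
    by_cases h : i ≤ j
    · obtain ⟨u, v, hu, hv, c, d, e⟩ := zc_letters (z := z) s p q i j h
      have : wp z ([] : List (Lt N l)) ∈ FF z (dw ([] : List (Lt N l))) := FF_w le_rfl
      rw [e, add_mul, smul_mul_assoc, smul_mul_assoc, add_assoc]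
      refine (FF z _).add_mem ((FF z _).smul_mem _ ?_) ((FF z _).smul_mem _ ?_)
      · rw [← hu]; exact cl_FF u this
      · rw [← hv]; exact cl_FF v this
    · push Not at h
      simp only [wp, List.map_nil, List.prod_nil, mul_one]
      exact FF_I _ (zc_mem h)
  | cons x w ih =>
    rintro s ⟨p, i⟩ ⟨q, j⟩
    by_cases h : i ≤ j
    · obtain ⟨u, v, hu, hv, c, d, e⟩ := zc_letters (z := z) s p q i j h
      have : wp z (x :: w) ∈ FF z (dw (x :: w)) := FF_w le_rfl
      rw [e, add_mul, smul_mul_assoc, smul_mul_assoc, add_assoc]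
      refine (FF z _).add_mem ((FF z _).smul_mem _ ?_) ((FF z _).smul_mem _ ?_)
      · rw [← hu]; exact cl_FF u this
      · rw [← hv]; exact cl_FF v this
    · obtain ⟨g, hg, e⟩ := zc_cl hz s (p, i) (q, j) x
      rw [wp_cons, ← mul_assoc, e, add_mul, add_mul, smul_mul_assoc, smul_mul_assoc, one_mul,
        mul_assoc, dw_cons]
      refine (FF z _).add_mem ((FF z _).add_mem ((FF z _).smul_mem _ ?_) ?_) ?_
      · refine FF_mono ?_ (cl_FF x (ih s (p, i) (q, j)))
        omega
      · by_cases ht : off (p, i) (q, j) + x.2.2.2.1.val = -1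
        · refine (FF z _).smul_mem _ (FF_w ?_)
          unfold dg; omega
        · rw [Th_ne ht, zero_smul]; exact (FF z _).zero_mem
      · clear e
        induction hg using Submodule.span_induction with
        | mem y hy =>
          obtain ⟨s', i', j', ho, rfl⟩ := hy
          refine FF_mono ?_ (ih s' i' j')
          rw [ho]; unfold dg; omega
        | zero => simp
        | add a b _ _ ha hb => rw [add_mul]; exact (FF z _).add_mem ha hb
        | smul a b _ hb => rw [smul_mul_assoc]; exact (FF z _).smul_mem _ hb

theorem Gs_FF (hz : IsQ z) {t d e : ℤ} {g x : R} (hg : g ∈ Gs z t) (hx : x ∈ FF z d)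
    (h : d + 2 * t + 1 ≤ e) : g * x ∈ FF z e := by
  induction hg using Submodule.span_induction with
  | mem y hy =>
    obtain ⟨s', i', j', ho, rfl⟩ := hy
    refine FF_mul (fun w hw => FF_mono ?_ (zc_wp hz w s' i' j')) hx
    rw [ho]; omega
  | zero => simp
  | add a b _ _ ha hb => rw [add_mul]; exact (FF z _).add_mem ha hb
  | smul a b _ hb => rw [smul_mul_assoc]; exact (FF z _).smul_mem _ hb

theorem FF_exhaust (hz : IsQ z) (x : R) : ∃ d : ℕ, x ∈ FF z d := by
  let C : Submodule ℂ R :=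
    { carrier := {x | ∃ d : ℕ, x ∈ FF z d}
      zero_mem' := ⟨0, (FF z _).zero_mem⟩
      add_mem' := by
        rintro a b ⟨d, hd⟩ ⟨e, he⟩
        refine ⟨max d e, (FF z _).add_mem (FF_mono ?_ hd) (FF_mono ?_ he)⟩ <;> simp
      smul_mem' := by
        rintro c a ⟨d, hd⟩
        exact ⟨d, (FF z _).smul_mem _ hd⟩ }
  refine hz.ind C ⟨0, ?_⟩ ?_ x
  · have : wp z ([] : List (Lt N l)) ∈ FF z 0 := FF_w (by simp [dw])
    simpa [wp] using this
  · rintro s i j x ⟨d, hd⟩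
    have e : z s i j = zc z s i j + chi s i j • 1 := by simp [zc]
    refine ⟨d + 2 * l + 1, ?_⟩
    rw [e, add_mul, smul_mul_assoc, one_mul]
    refine (FF z _).add_mem (Gs_FF hz (Gs_zc rfl) hd ?_) ((FF z _).smul_mem _ (FF_mono ?_ hd))
    · unfold off; push_cast; have := j.2.isLt; omega
    · push_cast; omega

theorem FF_neg {d : ℤ} (hd : d < 0) {x : R} (hx : x ∈ FF z d) : x ∈ II z := by
  refine FF_ind ((II z).restrictScalars ℂ) (fun x hx => hx) (fun w hw => ?_) hx
  have := dw_ge w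
  omega

/-- Products with Whittaker vectors. -/
theorem FF_mul_Wh {d e : ℤ} {x y : R} (hx : x ∈ FF z d) (hy : y ∈ FF z e) (hW : Wh z y) :
    x * y ∈ FF z (d + e) := by
  refine FF_ind ((FF z (d + e)).comap (LinearMap.mulRight ℂ y))
    (fun x hx => FF_I _ (II_mul hx hW)) (fun w hw => ?_) hx
  change wp z w * y ∈ FF z (d + e)
  refine FF_mono (d := dw w + e) (by omega) ?_
  clear hw hx
  induction w with
  | nil => simpa [wp, dw] using hy
  | cons u w ih =>
    rw [wp_cons, mul_assoc, dw_cons]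
    refine FF_mono ?_ (cl_FF u ih)
    omega

end Filt

section Filt2
variable {N l : ℕ} {R : Type*} [Ring R] [Algebra ℂ R] {z : Bool → Fin N × Fin l → Fin N × Fin l → R}

/-- Letters which are not centralizer letters. -/
def NT (u : Lt N l) : Prop := u.2.2.2.1.val + u.2.2.2.2.val + 1 < l

theorem sum_pt {l : ℕ} (A C : Fin l) (x : ℂ) :
    (∑ a : Fin l, ∑ c : Fin l, if a = A ∧ c = C then x else 0) = x := by
  rw [Finset.sum_eq_single A, Finset.sum_eq_single C] <;> simp +contextual

theorem sg_sn (s : Bool) (b : ℕ) : sg s s * sn s (b + 1) = sn s b := by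
  cases s <;> simp [sg, sn, pow_succ]

theorem Th_term (s : Bool) (p q : Fin N) (k b b' B A C a c : Fin l) (hB : B.val = b.val + k.val + 1)
    (hA : A.val = b.val + 1) (hC : C.val = b.val + k.val) :
    cf (s, p, q, k, b') a c * th s s (q, B) (p, b) (p, a) (q, c) =
      (if a = b ∧ c = C then (if b ≤ b' then sn s b.val else 0) else 0) -
      (if a = A ∧ c = B then (if b < b' then sn s b.val else 0) else 0) := by
  by_cases h1 : a = b
  · subst h1
    have e : (a = A ∧ c = B) ↔ False := by
      constructor
      · rintro ⟨h, -⟩; rw [h] at hA; omega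
      · simp
    have e2 : a.val ≠ a.val + 1 := by omega
    simp only [e, if_false, th, chi, cf, dl, Bool.xor_self, true_and, sub_zero, if_true, one_mul, e2, mul_zero]
    by_cases h2 : c = C
    · subst h2
      have e3 : B.val = c.val + 1 := by omega
      simp [e3, hC]
    · have e3 : ¬ (B.val = c.val + 1) := by
        intro h; apply h2; ext; omega
      simp [e3, h2]
  · have e0 : ¬ b = a := fun h => h1 h.symm
    simp only [h1, false_and, if_false, th, chi, cf, dl, Bool.xor_self, true_and, Prod.mk.injEq, e0, zero_mul, zero_sub]
    by_cases h2 : c = B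
    · subst h2
      by_cases h3 : a = A
      · subst h3
        have e4 : (a ≤ b') ↔ b < b' := by rw [Fin.le_def, Fin.lt_def, hA]; omega
        have e5 : c.val = a.val + k.val := by omega
        simp only [e4, e5, hA, if_true, and_true, true_and, mul_one]
        split_ifs
        · rw [mul_neg, mul_comm, sg_sn]
        · simp
      · have e4 : ¬ a.val = b.val + 1 := fun h => h3 (Fin.ext (by omega))
        simp [e4, h3]
    · simp [h2]

theorem Th_dual (s : Bool) (p q : Fin N) (k b B : Fin l) (hB : B.val = b.val + k.val + 1)
    (u : Lt N l) : Th s (q, B) (p, b) u = if u = (s, p, q, k, b) then sn s b.val else 0 := by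
  obtain ⟨s', p', q', k', b'⟩ := u
  by_cases hk : k' = k
  swap
  · rw [Th_ne, if_neg]
    · simp [hk]
    · simp only [off]; have : k'.val ≠ k.val := fun h => hk (Fin.ext h)
      omega
  subst hk
  by_cases h3 : s' = s ∧ p' = p ∧ q' = q
  · obtain ⟨rfl, rfl, rfl⟩ := h3
    unfold Th
    have hA : b.val + 1 < l := by omega
    have hC : b.val + k'.val < l := by omega
    simp only [Th_term s' p' q' k' b b' B ⟨_, hA⟩ ⟨_, hC⟩ _ _ hB rfl rfl]
    simp only [Finset.sum_sub_distrib, sum_pt]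
    simp only [Prod.mk.injEq, true_and, Fin.le_def, Fin.lt_def, Fin.ext_iff]
    split_ifs <;> first | omega | simp
  · rw [if_neg]
    · refine Finset.sum_eq_zero fun a _ => Finset.sum_eq_zero fun c _ => ?_
      have : th s s' (q, B) (p, b) (p', a) (q', c) = 0 := by
        simp only [th, chi, dl, Prod.mk.injEq]
        have hx : (xor s s' = false) ↔ s' = s := by cases s <;> cases s' <;> simp
        simp only [hx]
        by_cases e1 : s' = s
        · by_cases e2 : p' = p
          · have e3 : ¬ q' = q := fun e3 => h3 ⟨e1, e2, e3⟩
            have e3' : ¬ q = q' := fun e => e3 e.symm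
            simp [e3, e3']
          · have e2' : ¬ p = p' := fun e => e2 e.symm
            simp [e2, e2']
        · simp [e1]
      simp only [this, mul_zero]
    · simp only [Prod.mk.injEq, true_and]; tauto

/-- Dual operators. -/
def al (z : Bool → Fin N × Fin l → Fin N × Fin l → R) (u : Lt N l) : R :=
  if h : NT u then sn u.1 u.2.2.2.2.val •
    zc z u.1 (u.2.2.1, ⟨u.2.2.2.2.val + u.2.2.2.1.val + 1, by have h' := h; unfold NT at h'; omega⟩) (u.2.1, u.2.2.2.2)
  else 0

theorem al_Wh {y : R} (hy : Wh z y) (u : Lt N l) : al z u * y ∈ II z := by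
  unfold al
  split_ifs with h
  · rw [smul_mul_assoc]
    refine II_smul _ (hy _ _ _ ?_)
    rw [Fin.lt_def]; simp only; omega
  · rw [zero_mul]; exact (II z).zero_mem

theorem al_G (u : Lt N l) : al z u ∈ Gs z (-(u.2.2.2.1.val : ℤ) - 1) := by
  unfold al
  split_ifs with h
  · refine (Gs z _).smul_mem _ (Gs_zc ?_)
    simp only [off]; push_cast; ring
  · exact (Gs z _).zero_mem

theorem al_cl (hz : IsQ z) (u v : Lt N l) :
    ∃ g ∈ Gs z (v.2.2.2.1.val - u.2.2.2.1.val - 1), al z u * cl z v =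
      sg u.1 v.1 • (cl z v * al z u) + (if v = u ∧ NT u then (1 : ℂ) else 0) • 1 + g := by
  by_cases h : NT u
  · obtain ⟨s, p, q, k, b⟩ := u
    have hB : b.val + k.val + 1 < l := by unfold NT at h; simp only at h; omega
    obtain ⟨g, hg, e⟩ := zc_cl hz s (q, ⟨b.val + k.val + 1, hB⟩) (p, b) v
    refine ⟨sn s b.val • g, (Gs z _).smul_mem _ ?_, ?_⟩
    · convert hg using 2
      simp only [off]; push_cast; ring
    · rw [Th_dual s p q k b _ rfl] at e
      simp only [al, h, and_true, dite_true]
      rw [smul_mul_assoc, e, mul_smul_comm]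
      have := sn_sq s b.val
      split_ifs
      · rw [smul_add, smul_add, smul_smul (sn s b.val) (sn s b.val), this, smul_comm (sn s b.val) (sg _ _)]
      · simp only [zero_smul, add_zero]
        rw [smul_add, smul_comm (sn s b.val) (sg _ _)]
  · refine ⟨0, (Gs z _).zero_mem, ?_⟩
    simp [al, h]

theorem sg_sq (s t : Bool) : sg s t * sg s t = 1 := by cases s <;> cases t <;> simp [sg]

theorem E_stepQ (hz : IsQ z) (u v : Lt N l) {d : ℤ} {x : R} (hx : x ∈ FF z d) :
    cl z u * (al z u * (cl z v * x)) - cl z v * (cl z u * (al z u * x)) -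
      (if v = u ∧ NT u then (1 : ℂ) else 0) • (cl z v * x) ∈ FF z (dg v + d - 1) := by
  obtain ⟨g, hg, e⟩ := al_cl hz u v
  obtain ⟨g', hg', e'⟩ := cl_cl hz u v
  have h1 : cl z u * (g * x) ∈ FF z (dg v + d - 1) := by
    refine FF_mono ?_ (cl_FF u (Gs_FF hz hg hx le_rfl))
    unfold dg; omega
  have h2 : g' * (al z u * x) ∈ FF z (dg v + d - 1) := by
    refine Gs_FF hz hg' (Gs_FF hz (al_G u) hx le_rfl) ?_
    unfold dg; omega
  have h3 : (if v = u ∧ NT u then (1 : ℂ) else 0) • (cl z u * x) =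
      (if v = u ∧ NT u then (1 : ℂ) else 0) • (cl z v * x) := by
    split_ifs with h
    · rw [h.1]
    · simp
  have h4 : cl z u * (al z u * (cl z v * x)) - cl z v * (cl z u * (al z u * x)) -
      (if v = u ∧ NT u then (1 : ℂ) else 0) • (cl z v * x) =
      sg u.1 v.1 • (g' * (al z u * x)) + cl z u * (g * x) := by
    rw [← mul_assoc (al z u) (cl z v) x, e, ← h3]
    have : cl z u * ((sg u.1 v.1 • (cl z v * al z u) + (if v = u ∧ NT u then (1 : ℂ) else 0) • 1 + g) * x)
        = sg u.1 v.1 • ((cl z u * cl z v) * (al z u * x)) + (if v = u ∧ NT u then (1 : ℂ) else 0) • (cl z u * x)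
          + cl z u * (g * x) := by
      simp only [add_mul, mul_add, smul_mul_assoc, mul_smul_comm, one_mul, mul_assoc]
    rw [this, e', add_mul, smul_add, smul_mul_assoc, smul_smul, sg_sq, one_smul, mul_assoc]
    abel
  rw [h4]
  exact (FF z _).add_mem ((FF z _).smul_mem _ h2) h1

/-- Euler operator. -/
def Eu (z : Bool → Fin N × Fin l → Fin N × Fin l → R) : R := ∑ u : Lt N l, cl z u * al z u

theorem Eu_Wh {y : R} (hy : Wh z y) : Eu z * y ∈ II z := by
  unfold Eu
  rw [Finset.sum_mul]
  refine Submodule.sum_mem _ fun u _ => ?_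
  rw [mul_assoc]
  exact II_mul_left _ (al_Wh hy u)

/-- Number of non-centralizer letters. -/
def nt (w : List (Lt N l)) : ℕ := w.countP (fun u => decide (NT u))

theorem Eu_step (hz : IsQ z) (v : Lt N l) {d : ℤ} {x : R} (hx : x ∈ FF z d) :
    Eu z * (cl z v * x) - cl z v * (Eu z * x) - (if NT v then (1 : ℂ) else 0) • (cl z v * x) ∈
      FF z (dg v + d - 1) := by
  have e : (if NT v then (1 : ℂ) else 0) • (cl z v * x) =
      ∑ u : Lt N l, (if v = u ∧ NT u then (1 : ℂ) else 0) • (cl z v * x) := by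
    rw [Finset.sum_eq_single v]
    · simp
    · intro b _ hb; rw [if_neg, zero_smul]; rintro ⟨h, -⟩; exact hb h.symm
    · simp
  rw [e]
  simp only [Eu, Finset.sum_mul, Finset.mul_sum, ← Finset.sum_sub_distrib]
  refine Submodule.sum_mem _ fun u _ => ?_
  have := E_stepQ hz u v hx
  simpa only [mul_assoc] using this

theorem Eu_word (hz : IsQ z) (w : List (Lt N l)) :
    Eu z * wp z w - (nt w : ℂ) • wp z w ∈ FF z (dw w - 1) := by
  induction w with
  | nil =>
    have : Eu z * 1 ∈ II z := Eu_Wh Wh.one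
    simp only [wp, nt, List.map_nil, List.prod_nil, List.countP_nil, Nat.cast_zero, zero_smul, sub_zero]
    exact FF_I _ this
  | cons v w ih =>
    have h1 := Eu_step hz v (FF_w (z := z) (w := w) le_rfl)
    have h2 := cl_FF v ih
    rw [wp_cons, dw_cons]
    have e : ((nt (v :: w) : ℕ) : ℂ) = nt w + (if NT v then (1 : ℂ) else 0) := by
      simp only [nt, List.countP_cons]
      split_ifs <;> simp_all
    have e2 : Eu z * (cl z v * wp z w) - ((nt (v :: w) : ℕ) : ℂ) • (cl z v * wp z w) =
      (Eu z * (cl z v * wp z w) - cl z v * (Eu z * wp z w) - (if NT v then (1 : ℂ) else 0) • (cl z v * wp z w))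
       + cl z v * (Eu z * wp z w - (nt w : ℂ) • wp z w) := by
      rw [e, add_smul, mul_sub, mul_smul_comm]; abel
    rw [e2]
    exact (FF z _).add_mem h1 (FF_mono (by omega) h2)

theorem Eu_FF (hz : IsQ z) {d : ℤ} {x : R} (hx : x ∈ FF z d) : Eu z * x ∈ FF z d := by
  refine FF_mul (fun w hw => ?_) hx
  have := (FF z d).add_mem (FF_mono (by omega) (Eu_word hz w)) ((FF z d).smul_mem (nt w : ℂ) (FF_w hw))
  simpa using this

/-- Span of lower terms and words with few non-centralizer letters. -/
def BB (z : Bool → Fin N × Fin l → Fin N × Fin l → R) (d : ℤ) (S : ℕ) : Submodule ℂ R :=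
  FF z (d - 1) ⊔ Submodule.span ℂ {x | ∃ w, dw w ≤ d ∧ nt w ≤ S ∧ x = wp z w}

theorem BB_F {d : ℤ} {S : ℕ} {x : R} (hx : x ∈ FF z (d - 1)) : x ∈ BB z d S := Submodule.mem_sup_left hx
theorem BB_w {d : ℤ} {S : ℕ} {w : List (Lt N l)} (h : dw w ≤ d) (h' : nt w ≤ S) : wp z w ∈ BB z d S :=
  Submodule.mem_sup_right (Submodule.subset_span ⟨w, h, h', rfl⟩)

theorem BB_ind {d : ℤ} {S : ℕ} (C : Submodule ℂ R) (hF : ∀ x ∈ FF z (d - 1), x ∈ C)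
    (hw : ∀ w, dw w ≤ d → nt w ≤ S → wp z w ∈ C) {x : R} (hx : x ∈ BB z d S) : x ∈ C := by
  have : BB z d S ≤ C := by
    refine sup_le (fun x hx => hF x hx) (Submodule.span_le.2 ?_)
    rintro x ⟨w, h, h', rfl⟩
    exact hw w h h'
  exact this hx

theorem BB_step (hz : IsQ z) {d : ℤ} {S : ℕ} {y : R} (hW : Wh z y) (hy : y ∈ BB z d (S + 1)) :
    y ∈ BB z d S := by
  have h1 : ((S + 1 : ℕ) : ℂ) • y - Eu z * y ∈ BB z d S := by
    refine BB_ind ((BB z d S).comap (((S + 1 : ℕ) : ℂ) • LinearMap.id - LinearMap.mulLeft ℂ (Eu z)))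
      (fun x hx => ?_) (fun w h h' => ?_) hy
    · change ((S + 1 : ℕ) : ℂ) • x - Eu z * x ∈ BB z d S
      exact BB_F ((FF z _).sub_mem ((FF z _).smul_mem _ hx) (Eu_FF hz hx))
    · change ((S + 1 : ℕ) : ℂ) • wp z w - Eu z * wp z w ∈ BB z d S
      have e : ((S + 1 : ℕ) : ℂ) • wp z w - Eu z * wp z w =
        (((S + 1 : ℕ) : ℂ) - (nt w : ℂ)) • wp z w - (Eu z * wp z w - (nt w : ℂ) • wp z w) := by
        rw [sub_smul]; abel
      rw [e]
      refine (BB z d S).sub_mem ?_ (BB_F (FF_mono (by omega) (Eu_word hz w)))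
      by_cases hs : nt w = S + 1
      · rw [hs, sub_self, zero_smul]; exact (BB z d S).zero_mem
      · exact (BB z d S).smul_mem _ (BB_w h (by omega))
  have h2 : ((S + 1 : ℕ) : ℂ) • y ∈ BB z d S := by
    have := (BB z d S).add_mem h1 (BB_F (FF_I _ (Eu_Wh hW)))
    simpa using this
  have h3 := (BB z d S).smul_mem (((S + 1 : ℕ) : ℂ)⁻¹) h2
  rwa [smul_smul, inv_mul_cancel₀ (Nat.cast_ne_zero.2 (Nat.succ_ne_zero S)), one_smul] at h3

theorem BB_zero (hz : IsQ z) {d : ℤ} {y : R} (hW : Wh z y) (hy : y ∈ FF z d) : y ∈ BB z d 0 := by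
  have h1 : y ∈ BB z d d.toNat := by
    refine FF_ind _ (fun x hx => BB_F (FF_I _ hx)) (fun w hw => BB_w hw ?_) hy
    have h1 := dw_ge w
    have h2 : nt w ≤ w.length := List.countP_le_length
    omega
  have : ∀ S, y ∈ BB z d S → y ∈ BB z d 0 := by
    intro S
    induction S with
    | zero => exact id
    | succ S ih => exact fun h => ih (BB_step hz hW h)
  exact this _ h1

end Filt2

section Filt3
variable {N l : ℕ} {R : Type*} [Ring R] [Algebra ℂ R] {z : Bool → Fin N × Fin l → Fin N × Fin l → R}

/-- Leading terms. -/
def LdT (z : Bool → Fin N × Fin l → Fin N × Fin l → R) (ε : ℂ) (q : Fin N) (m : ℕ) (p : Fin N) (a : ℕ) : R :=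
  (∑ i : Fin l, ∑ j : Fin l, if i.val ≤ a ∧ i ≤ j ∧ j.val + a + 1 = i.val + m
    then uu z (ε * (-1) ^ j.val) (p, i) (q, j) else 0) + if m = a then (dl p q : ℂ) • 1 else 0

theorem one_FF : (1 : R) ∈ FF z 0 := by
  have : wp z ([] : List (Lt N l)) ∈ FF z 0 := FF_w (by simp [dw])
  simpa [wp] using this

theorem uu_G (ε : ℂ) (p q : Fin N) {i j : Fin l} (h : i ≤ j) :
    uu z ε (p, i) (q, j) ∈ Gs z ((j.val : ℤ) - i.val) := by
  have e : ∀ s, z s (p, i) (q, j) = zc z s (p, i) (q, j) := by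
    intro s
    have : chi s (p, i) (q, j) = 0 := by
      apply chi_ne; simp only [off]; have := Fin.le_def.1 h; omega
    simp [zc, this]
  unfold uu
  rw [e, e]
  exact (Gs z _).add_mem (Gs_zc rfl) ((Gs z _).smul_mem _ (Gs_zc rfl))

theorem LdT_FF (ε : ℂ) (hz : IsQ z) (q : Fin N) (m : ℕ) (p : Fin N) (a : ℕ) (h : m ≠ a) :
    LdT z ε q m p a ∈ FF z (2 * ((m : ℤ) - a) - 1) := by
  unfold LdT
  rw [if_neg h, add_zero]
  refine Submodule.sum_mem _ fun i _ => Submodule.sum_mem _ fun j _ => ?_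
  split_ifs with hc
  · rw [← mul_one (uu z _ _ _)]
    refine Gs_FF hz (uu_G _ _ _ hc.2.1) one_FF ?_
    omega
  · exact (FF z _).zero_mem

/-- The leading terms appearing in the recursion. -/
def RT (z : Bool → Fin N × Fin l → Fin N × Fin l → R) (ε : ℂ) (q : Fin N) (m : ℕ) (p : Fin N) (a : Fin l)
    (k : Fin N × Fin l) : R :=
  (if a ≤ k.2 ∧ k.2.val = m then (dl k.1 q : ℂ) • uu z (ε * (-1) ^ m) (p, a) k else 0) +
    (if k.1 = p ∧ k.2.val + 1 = a.val then LdT z ε q m p k.2.val else 0)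

theorem RT_sum (ε : ℂ) (q : Fin N) (m : ℕ) (p : Fin N) (a : Fin l) :
    ∑ k, RT z ε q m p a k = LdT z ε q (m + 1) p a.val := by
  have hA : ∑ k : Fin N × Fin l, (if a ≤ k.2 ∧ k.2.val = m then (dl k.1 q : ℂ) • uu z (ε * (-1) ^ m) (p, a) k else 0)
      = ∑ i : Fin l, ∑ j : Fin l, if i = a ∧ i ≤ j ∧ j.val = m then uu z (ε * (-1) ^ j.val) (p, i) (q, j) else 0 := by
    rw [Fintype.sum_prod_type_right]
    rw [Finset.sum_eq_single a (f := fun i => ∑ j : Fin l, if i = a ∧ i ≤ j ∧ j.val = m then uu z (ε * (-1) ^ j.val) (p, i) (q, j) else 0)]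
    · refine Finset.sum_congr rfl fun c _ => ?_
      simp only [true_and]
      split_ifs with h
      · rw [sum_dl_smul' q (fun r => uu z (ε * (-1) ^ m) (p, a) (r, c)), h.2]
      · simp
    · intro b _ hb; simp [hb]
    · simp
  have hB : ∑ k : Fin N × Fin l, (if k.1 = p ∧ k.2.val + 1 = a.val then LdT z ε q m p k.2.val else 0) =
      if a.val = 0 then 0 else LdT z ε q m p (a.val - 1) := by
    split_ifs with h0
    · exact Finset.sum_eq_zero fun k _ => by rw [if_neg]; omega
    · rw [Finset.sum_eq_single (p, ⟨a.val - 1, by omega⟩)]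
      · rw [if_pos]; exact ⟨rfl, by simp only; omega⟩
      · rintro ⟨r, c⟩ _ hb
        rw [if_neg]
        rintro ⟨rfl, h2⟩
        apply hb
        simp only at h2
        simp only [Prod.mk.injEq, true_and, Fin.ext_iff]; omega
      · simp
  unfold RT
  rw [Finset.sum_add_distrib, hA, hB]
  unfold LdT
  split_ifs with h0 h1 h2 h3 h4
  · omega
  · simp only [add_zero]
    refine Finset.sum_congr rfl fun i _ => Finset.sum_congr rfl fun j _ => ?_
    congr 1
    simp only [Fin.ext_iff, Fin.le_def, eq_iff_iff]; omega
  · rw [← add_assoc, ← Finset.sum_add_distrib]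
    congr 1
    refine Finset.sum_congr rfl fun i _ => ?_
    rw [← Finset.sum_add_distrib]
    refine Finset.sum_congr rfl fun j _ => ?_
    simp only [Fin.ext_iff, Fin.le_def]
    split_ifs <;> first | omega | simp
  · omega
  · omega
  · rw [← add_assoc, ← Finset.sum_add_distrib]
    congr 1
    refine Finset.sum_congr rfl fun i _ => ?_
    rw [← Finset.sum_add_distrib]
    refine Finset.sum_congr rfl fun j _ => ?_
    simp only [Fin.ext_iff, Fin.le_def]
    split_ifs <;> first | omega | simp

theorem SS_lead (hz : IsQ z) (ε : ℂ) (hε : ε * ε = 1) (q : Fin N) (o : Fin l) (ho : o.val = 0) (m : ℕ) :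
    ∀ (p : Fin N) (a : Fin l),
      SS z ε m (p, a) (q, o) - LdT z ε q m p a.val ∈ FF z (2 * ((m : ℤ) - a.val) - 2) := by
  induction m with
  | zero =>
    intro p a
    have : SS z ε 0 (p, a) (q, o) - LdT z ε q 0 p a.val = 0 := by
      unfold LdT SS
      rw [Finset.sum_eq_zero, zero_add, sub_eq_zero]
      · simp only [dl, Prod.mk.injEq, Fin.ext_iff, ho]
        by_cases h : a.val = 0
        · simp [h]
        · have h' : ¬ 0 = a.val := fun e => h e.symm
          simp [h, h']
      · intro i _
        refine Finset.sum_eq_zero fun j _ => ?_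
        rw [if_neg]; rw [Fin.le_def]; omega
    rw [this]; exact (FF z _).zero_mem
  | succ m ih =>
    intro p a
    have h1 := FF_I (2 * (((m + 1 : ℕ) : ℤ) - a.val) - 2) (SS_rec hz ε hε m (p, a) (q, o) ho)
    rw [← RT_sum]
    rw [← sub_add_sub_cancel _ (∑ k, (if (p, a).2 ≤ k.2 then uu z (ε * (-1) ^ m) (p, a) k * SS z ε m k (q, o)
      else chi false (p, a) k • SS z ε m k (q, o))) _]
    refine (FF z _).add_mem h1 ?_
    rw [← Finset.sum_sub_distrib]
    refine Submodule.sum_mem _ ?_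
    rintro ⟨r, c⟩ _
    simp only [RT]
    by_cases hac : a ≤ c
    · rw [if_pos hac]
      have hac' := Fin.le_def.1 hac
      rw [if_neg (show ¬ (r = p ∧ c.val + 1 = a.val) by omega), add_zero]
      have h2 := ih r c
      have h3 := Gs_FF hz (uu_G (ε * (-1) ^ m) p r hac) h2 (e := 2 * (((m + 1 : ℕ) : ℤ) - a.val) - 2)
        (by push_cast; omega)
      have h4 : uu z (ε * (-1) ^ m) (p, a) (r, c) * LdT z ε q m r c.val -
        (if a ≤ c ∧ c.val = m then (dl r q : ℂ) • uu z (ε * (-1) ^ m) (p, a) (r, c) else 0) ∈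
          FF z (2 * (((m + 1 : ℕ) : ℤ) - a.val) - 2) := by
        by_cases hm : c.val = m
        · rw [if_pos ⟨hac, hm⟩]
          have : LdT z ε q m r c.val = (dl r q : ℂ) • 1 := by
            unfold LdT
            rw [if_pos hm.symm, Finset.sum_eq_zero, zero_add]
            intro i _
            refine Finset.sum_eq_zero fun j _ => ?_
            rw [if_neg]; rw [Fin.le_def]; omega
          rw [this, mul_smul_comm, mul_one, sub_self]
          exact (FF z _).zero_mem
        · rw [if_neg (by tauto), sub_zero]
          refine Gs_FF hz (uu_G _ p r hac) (LdT_FF ε hz q m r c.val (Ne.symm hm)) ?_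
          push_cast; omega
      have := (FF z _).add_mem h3 h4
      convert this using 1
      rw [mul_sub]; abel
    · rw [if_neg hac, if_neg (show ¬ (a ≤ c ∧ c.val = m) by tauto), zero_add]
      have hac' : c.val < a.val := by rw [Fin.le_def] at hac; omega
      by_cases hc : r = p ∧ c.val + 1 = a.val
      · rw [if_pos hc]
        have : chi false (p, a) (r, c) = 1 := by
          rw [chi, if_pos]; exact ⟨rfl, hc.1.symm, hc.2.symm⟩
        rw [this, one_smul]
        have h2 := ih r c
        rw [hc.1] at h2 ⊢
        refine FF_mono ?_ h2
        push_cast; omega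
      · rw [if_neg hc, sub_zero]
        have : chi false (p, a) (r, c) = 0 := by
          rw [chi, if_neg]; rintro ⟨-, h2, h3⟩; exact hc ⟨h2.symm, h3.symm⟩
        rw [this, zero_smul]; exact (FF z _).zero_mem

/-- The algebra generated by the Whittaker vectors built from Sergeev elements. -/
def AA (z : Bool → Fin N × Fin l → Fin N × Fin l → R) : Subalgebra ℂ R :=
  Algebra.adjoin ℂ {x | ∃ (ε : ℂ) (m : ℕ) (p q : Fin N) (a o : Fin l), (ε = 1 ∨ ε = -1) ∧ a.val + 1 = l ∧
    o.val = 0 ∧ x = SS z ε m (p, a) (q, o)}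

theorem AA_Wh (hz : IsQ z) {x : R} (hx : x ∈ AA z) : Wh z x := by
  induction hx using Algebra.adjoin_induction with
  | mem x h =>
    obtain ⟨ε, m, p, q, a, o, hε, ha, ho, rfl⟩ := h
    exact Wh_SS hz ε (by rcases hε with rfl | rfl <;> norm_num) m _ _ ha ho
  | algebraMap c => rw [Algebra.algebraMap_eq_smul_one]; exact Wh.one.smul c
  | add x y _ _ h1 h2 => exact h1.add h2
  | mul x y _ _ h1 h2 => exact h1.mul h2

theorem cl_top (u : Lt N l) (hu : ¬ NT u) (L : Fin l) (hL : L.val + 1 = l) :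
    cl z u = cl z (u.1, u.2.1, u.2.2.1, u.2.2.2.1, L) := by
  unfold cl
  refine Finset.sum_congr rfl fun i _ => Finset.sum_congr rfl fun j _ => ?_
  congr 1
  simp only [cf, Fin.le_def]
  congr 1
  unfold NT at hu
  simp only [eq_iff_iff]
  omega

theorem LdT_top (ε : ℂ) (p q : Fin N) (k L : Fin l) (hL : L.val + 1 = l) :
    LdT z ε q (l + k.val) p L.val = cl z (false, p, q, k, L) + (ε * (-1) ^ k.val) • cl z (true, p, q, k, L) := by
  unfold LdT cl
  rw [if_neg (by omega), add_zero]
  simp only [Finset.smul_sum, ← Finset.sum_add_distrib]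
  refine Finset.sum_congr rfl fun i _ => Finset.sum_congr rfl fun j _ => ?_
  simp only [cf, sn, Fin.le_def]
  by_cases h : j.val = i.val + k.val
  · have h1 : i.val ≤ L.val := by omega
    rw [if_pos ⟨h1, by omega, by omega⟩]
    have hc : (i.val ≤ L.val ∧ j.val = i.val + k.val) ↔ True := by simp [h1, h]
    have e : ∀ s, zc z s (p, i) (q, j) = z s (p, i) (q, j) := by
      intro s
      have : chi s (p, i) (q, j) = 0 := by
        apply chi_ne; simp only [off]; omega
      simp [zc, this]
    rw [e, e, uu]
    simp only [hc, smul_smul, Bool.false_eq_true, if_false, if_true, one_smul]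
    rw [h, pow_add]; congr 2; ring
  · rw [if_neg (by omega), if_neg (by omega), if_neg (by omega)]; simp

theorem top_gen (hz : IsQ z) (u : Lt N l) (hu : ¬ NT u) :
    ∃ g ∈ AA z, cl z u - g ∈ FF z (dg u - 1) := by
  obtain ⟨s, p, q, k, b⟩ := u
  have hl : 0 < l := by have := k.isLt; omega
  let L : Fin l := ⟨l - 1, by omega⟩
  let o : Fin l := ⟨0, hl⟩
  have hL : L.val + 1 = l := by simp only [L]; omega
  rw [cl_top _ hu L hL]
  simp only
  have key : ∀ ε : ℂ, ε = 1 ∨ ε = -1 →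
      SS z ε (l + k.val) (p, L) (q, o) - (cl z (false, p, q, k, L) + (ε * (-1) ^ k.val) • cl z (true, p, q, k, L))
        ∈ FF z (dg (s, p, q, k, b) - 1) := by
    intro ε hε
    rw [← LdT_top ε p q k L hL]
    have := SS_lead hz ε (by rcases hε with rfl | rfl <;> norm_num) q o rfl (l + k.val) p L
    refine FF_mono ?_ this
    simp only [dg]; push_cast; omega
  have mem : ∀ ε : ℂ, ε = 1 ∨ ε = -1 → SS z ε (l + k.val) (p, L) (q, o) ∈ AA z := fun ε hε =>
    Algebra.subset_adjoin ⟨ε, _, p, q, L, o, hε, hL, rfl, rfl⟩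
  have k1 := key 1 (Or.inl rfl)
  have k2 := key (-1) (Or.inr rfl)
  have m1 := mem 1 (Or.inl rfl)
  have m2 := mem (-1) (Or.inr rfl)
  generalize SS z 1 (l + k.val) (p, L) (q, o) = A at *
  generalize SS z (-1) (l + k.val) (p, L) (q, o) = B at *
  have hk : ((-1 : ℂ) ^ k.val) * (-1) ^ k.val = 1 := by rw [← mul_pow]; norm_num
  cases s
  · refine ⟨(1 / 2 : ℂ) • (A + B), (AA z).smul_mem ((AA z).add_mem m1 m2) _, ?_⟩
    have := (FF z _).smul_mem (-1 / 2 : ℂ) ((FF z _).add_mem k1 k2)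
    convert this using 1
    module
  · refine ⟨((-1 : ℂ) ^ k.val / 2) • (A - B), (AA z).smul_mem ((AA z).sub_mem m1 m2) _, ?_⟩
    have := (FF z _).smul_mem (- (-1 : ℂ) ^ k.val / 2) ((FF z _).sub_mem k1 k2)
    convert this using 1
    generalize cl z (false, p, q, k, L) = c
    generalize cl z (true, p, q, k, L) = d
    generalize ((-1 : ℂ) ^ k.val) = e at *
    have : (-e / 2) • (A - (c + (1 * e) • d) - (B - (c + (-1 * e) • d))) =
      (e * e) • d - (e / 2) • (A - B) := by module
    rw [this, hk, one_smul]

theorem top_word (hz : IsQ z) (w : List (Lt N l)) (hw : nt w = 0) :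
    ∃ g ∈ AA z, wp z w - g ∈ FF z (dw w - 1) := by
  induction w with
  | nil =>
    refine ⟨1, (AA z).one_mem, ?_⟩
    simp [wp]
  | cons u w ih =>
    have hu : ¬ NT u := by
      intro h; simp [nt, List.countP_cons, h] at hw
    obtain ⟨g, hg, h1⟩ := ih (by simpa [nt, List.countP_cons, hu] using hw)
    obtain ⟨g', hg', h2⟩ := top_gen hz u hu
    refine ⟨g' * g, (AA z).mul_mem hg' hg, ?_⟩
    have e : wp z (u :: w) - g' * g = cl z u * (wp z w - g) + (cl z u - g') * g := by
      rw [wp_cons, mul_sub, sub_mul]; abel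
    rw [e, dw_cons]
    refine (FF z _).add_mem (FF_mono ?_ (cl_FF u h1)) (FF_mono ?_ (FF_mul_Wh h2 (e := dw w) ?_ (AA_Wh hz hg)))
    · omega
    · omega
    · have := (FF z (dw w)).sub_mem (FF_w le_rfl) (FF_mono (by omega) h1)
      simpa using this

theorem Wh_gen_aux (hz : IsQ z) (d : ℕ) : ∀ y : R, Wh z y → y ∈ FF z ((d : ℤ) - 1) →
    ∃ g ∈ AA z, y - g ∈ II z := by
  induction d with
  | zero =>
    intro y hW hy
    refine ⟨0, (AA z).zero_mem, ?_⟩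
    rw [sub_zero]; exact FF_neg (by simp) hy
  | succ d ih =>
    intro y hW hy
    have h1 := BB_zero hz hW hy
    have h2 : y ∈ FF z ((d : ℤ) - 1) ⊔ Subalgebra.toSubmodule (AA z) := by
      refine BB_ind _ (fun x hx => Submodule.mem_sup_left (FF_mono (by push_cast; omega) hx))
        (fun w h h' => ?_) h1
      obtain ⟨g, hg, h3⟩ := top_word hz w (by omega)
      rw [← sub_add_cancel (wp z w) g]
      refine Submodule.add_mem_sup (FF_mono ?_ h3) hg
      push_cast at h; omega
    obtain ⟨f, hf, g, hg, rfl⟩ := Submodule.mem_sup.1 h2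
    have hg' : g ∈ AA z := hg
    obtain ⟨g2, hg2, h4⟩ := ih f (by have := hW.sub (AA_Wh hz hg'); simpa using this) hf
    refine ⟨g2 + g, (AA z).add_mem hg2 hg', ?_⟩
    simpa using h4

/-- Generation theorem. -/
theorem Wh_gen (hz : IsQ z) (y : R) (hW : Wh z y) : ∃ g ∈ AA z, y - g ∈ II z := by
  obtain ⟨d, hd⟩ := FF_exhaust hz y
  exact Wh_gen_aux hz (d + 1) y hW (by simpa using hd)

end Filt3

/-! ## A super Fock space -/
section Fock
variable {X : Type} [Fintype X] (par : X → Bool) (key : X → ℕ)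

/-- Super Fock space. -/
abbrev Fk (X : Type) := (X → ℕ) →₀ ℂ

/-- Jordan-Wigner sign. -/
def jw (x : X) (M : X → ℕ) : ℂ :=
  ∏ w, if par x = true ∧ par w = true ∧ key w < key x then (-1 : ℂ) ^ M w else 1

/-- Elementary operators at one site. -/
def op (x : X) (f : ℕ → ℂ) (g : ℕ → ℕ) : Fk X →ₗ[ℂ] Fk X :=
  Finsupp.linearCombination ℂ fun M => (jw par key x M * f (M x)) • Finsupp.single (Function.update M x (g (M x))) (1 : ℂ)

theorem op_single (x : X) (f : ℕ → ℂ) (g : ℕ → ℕ) (M : X → ℕ) :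
    op par key x f g (Finsupp.single M 1) =
      (jw par key x M * f (M x)) • Finsupp.single (Function.update M x (g (M x))) (1 : ℂ) := by
  simp [op]

theorem jw_update_self (x : X) (M : X → ℕ) (k : ℕ) : jw par key x (Function.update M x k) = jw par key x M := by
  unfold jw
  refine Finset.prod_congr rfl fun w _ => ?_
  by_cases h : w = x
  · subst h; simp
  · rw [Function.update_of_ne h]

theorem jw_update (x w : X) (M : X → ℕ) (k : ℕ) (hk : (-1 : ℂ) ^ k = - (-1) ^ M w) :
    jw par key x (Function.update M w k) =
      jw par key x M * (if par x = true ∧ par w = true ∧ key w < key x then -1 else 1) := by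
  unfold jw
  rw [← Finset.mul_prod_erase _ _ (Finset.mem_univ w), ← Finset.mul_prod_erase _ (fun w => if par x = true ∧ par w = true ∧ key w < key x then (-1 : ℂ) ^ M w else 1) (Finset.mem_univ w)]
  have : ∏ v ∈ Finset.univ.erase w, (if par x = true ∧ par v = true ∧ key v < key x then (-1 : ℂ) ^ (Function.update M w k) v else 1)
    = ∏ v ∈ Finset.univ.erase w, (if par x = true ∧ par v = true ∧ key v < key x then (-1 : ℂ) ^ M v else 1) := by
    refine Finset.prod_congr rfl fun v hv => ?_
    rw [Function.update_of_ne (Finset.ne_of_mem_erase hv)]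
  rw [this, Function.update_self]
  split_ifs
  · rw [hk]; ring
  · ring

theorem jw_sq (x : X) (M : X → ℕ) : jw par key x M * jw par key x M = 1 := by
  unfold jw
  rw [← Finset.prod_mul_distrib]
  refine Finset.prod_eq_one fun w _ => ?_
  split_ifs
  · rw [← mul_pow]; norm_num
  · norm_num

/-- Sites with sign-flipping. -/
def Flip (f : ℕ → ℂ) (g : ℕ → ℕ) : Prop := ∀ k, f k ≠ 0 → (-1 : ℂ) ^ g k = - (-1) ^ k

variable {par key} in
theorem op_comm (hkey : Function.Injective key) {x w : X} (hxw : x ≠ w) {f f' : ℕ → ℂ} {g g' : ℕ → ℕ}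
    (h : Flip f g) (h' : Flip f' g') :
    op par key x f g ∘ₗ op par key w f' g' = sg (par x) (par w) • (op par key w f' g' ∘ₗ op par key x f g) := by
  refine Finsupp.lhom_ext' fun M => LinearMap.ext_ring ?_
  simp only [LinearMap.comp_apply, Finsupp.lsingle_apply, LinearMap.smul_apply, op_single, map_smul,
    smul_smul, Function.update_of_ne hxw, Function.update_of_ne hxw.symm]
  rw [Function.update_comm hxw]
  congr 1
  by_cases e : f (M x) = 0
  · rw [e]; ring
  by_cases e' : f' (M w) = 0
  · rw [e']; ring
  rw [jw_update par key x w M _ (h' _ e'), jw_update par key w x M _ (h _ e)]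
  have hk : key x ≠ key w := fun hh => hxw (hkey hh)
  rcases lt_or_gt_of_ne hk with hlt | hlt
  · simp only [hlt, not_lt_of_gt hlt, and_true, and_false, if_false, sg]
    cases par x <;> cases par w <;> simp <;> ring
  · have hlt' : key w < key x := hlt
    simp only [hlt', not_lt_of_gt hlt', and_true, and_false, if_false, sg]
    cases par x <;> cases par w <;> simp <;> ring

/-- Creation coefficients. -/
def ca (s : Bool) (k : ℕ) : ℂ := if s = true then (if Even k then 1 else 0) else 1
/-- Annihilation coefficients. -/
def cb (s : Bool) (k : ℕ) : ℂ := if s = true then (if Even k then 0 else 1) else k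

/-- Creation operators. -/
def cr (x : X) : Fk X →ₗ[ℂ] Fk X := op par key x (ca (par x)) (fun k => k + 1)
/-- Annihilation operators. -/
def an (x : X) : Fk X →ₗ[ℂ] Fk X := op par key x (cb (par x)) (fun k => k - 1)

theorem flip_a (s : Bool) : Flip (ca s) (fun k => k + 1) := fun k _ => by rw [pow_succ]; ring
theorem flip_b (s : Bool) : Flip (cb s) (fun k => k - 1) := by
  intro k hk
  cases k with
  | zero => exact absurd (by cases s <;> simp [cb]) hk
  | succ k => simp [pow_succ]

variable {par key}

theorem cr_cr (hkey : Function.Injective key) (x w : X) :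
    cr par key x ∘ₗ cr par key w = sg (par x) (par w) • (cr par key w ∘ₗ cr par key x) := by
  by_cases h : x = w
  · subst h
    cases hp : par x
    · simp [sg]
    · have : cr par key x ∘ₗ cr par key x = 0 := by
        refine Finsupp.lhom_ext' fun M => LinearMap.ext_ring ?_
        simp only [LinearMap.comp_apply, Finsupp.lsingle_apply, cr, op_single, map_smul,
          smul_smul, Function.update_self, LinearMap.zero_apply, hp, ca, if_true]
        by_cases e : Even (M x)
        · have : ¬ Even (M x + 1) := by simpa [Nat.even_add_one] using e
          simp [this]
        · simp [e]
      simp [this]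
  · exact op_comm hkey h (flip_a _) (flip_a _)

theorem an_cr (hkey : Function.Injective key) (x w : X) :
    an par key x ∘ₗ cr par key w = sg (par x) (par w) • (cr par key w ∘ₗ an par key x) + (dl x w : ℂ) • LinearMap.id := by
  by_cases h : x = w
  · subst h
    refine Finsupp.lhom_ext' fun M => LinearMap.ext_ring ?_
    simp only [LinearMap.comp_apply, Finsupp.lsingle_apply, cr, an, op_single, map_smul,
      smul_smul, Function.update_self, dl_self, LinearMap.add_apply, LinearMap.smul_apply, LinearMap.id_apply,
      jw_update_self, Function.update_idem, Nat.add_sub_cancel]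
    rcases Nat.eq_zero_or_pos (M x) with h0 | h0
    · have e : Function.update M x (M x) = M := Function.update_eq_self _ _
      rw [e]
      simp only [h0]
      have hj := jw_sq par key x M
      cases hp : par x <;> simp [ca, cb, hp, hj]
    · have e1 : M x - 1 + 1 = M x := by omega
      have e : Function.update M x (M x) = M := Function.update_eq_self _ _
      rw [e1, e, ← add_smul]
      congr 1
      have hj := jw_sq par key x M
      cases hp : par x
      · simp only [ca, cb, sg, Bool.false_eq_true, if_false]
        push_cast
        simp
        linear_combination hj
      · simp only [ca, cb, sg, if_true, Bool.and_self]
        by_cases ev : Even (M x)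
        · have h1 : ¬ Even (M x + 1) := by simpa [Nat.even_add_one] using ev
          simp [ev, h1, hj]
        · have h1 : Even (M x - 1) := by
            rw [← e1, Nat.even_add_one] at ev; simpa using ev
          simp [ev, h1, hj]
  · rw [dl_ne h, zero_smul, add_zero]
    exact op_comm hkey h (flip_b _) (flip_a _)

theorem an_an (hkey : Function.Injective key) (x w : X) :
    an par key x ∘ₗ an par key w = sg (par x) (par w) • (an par key w ∘ₗ an par key x) := by
  by_cases h : x = w
  · subst h
    cases hp : par x
    · simp [sg]
    · have : an par key x ∘ₗ an par key x = 0 := by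
        refine Finsupp.lhom_ext' fun M => LinearMap.ext_ring ?_
        simp only [LinearMap.comp_apply, Finsupp.lsingle_apply, an, op_single, map_smul,
          smul_smul, Function.update_self, LinearMap.zero_apply, hp, cb, if_true]
        by_cases e : Even (M x)
        · simp [e]
        · have : Even (M x - 1) := by
            have e1 : M x - 1 + 1 = M x := by
              have : M x ≠ 0 := by intro h0; rw [h0] at e; simp at e
              omega
            rw [← e1, Nat.even_add_one] at e; simpa using e
          simp [this]
      simp [this]
  · exact op_comm hkey h (flip_b _) (flip_b _)

/-- Vacuum vector. -/
def vac (X : Type) : Fk X := Finsupp.single 0 1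

theorem an_vac (x : X) : an par key x (vac X) = 0 := by
  simp only [an, vac, op_single]
  cases h : par x <;> simp [cb]

theorem cr_single (x : X) (M : X → ℕ) : cr par key x (Finsupp.single M 1) =
    (jw par key x M * ca (par x) (M x)) • Finsupp.single (Function.update M x (M x + 1)) (1 : ℂ) := by
  simp [cr, op_single]

end Fock

section Osc
variable {J : Type} [Fintype J] {A : Type} [Ring A] [Algebra ℂ A] (c a : Bool × J × J → A)

/-- Canonical (anti)commutation relations. -/
structure CCR : Prop where
  cc : ∀ x y, c x * c y = sg x.1 y.1 • (c y * c x)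
  aa : ∀ x y, a x * a y = sg x.1 y.1 • (a y * a x)
  ac : ∀ x y, a x * c y = sg x.1 y.1 • (c y * a x) + (dl x y : ℂ) • 1

/-- Left multiplication derivations. -/
def Dop (s : Bool) (i j : J) : A := ∑ δ : Bool, ∑ k : J, c (xor s δ, i, k) * a (δ, j, k)

variable {c a}

theorem sg_xor (s t u : Bool) : sg (xor s t) u = sg s u * sg t u := by
  cases s <;> cases t <;> cases u <;> simp [sg]
theorem sg_xor' (s t u : Bool) : sg u (xor s t) = sg u s * sg u t := by
  cases s <;> cases t <;> cases u <;> simp [sg]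
theorem sg_symm (s t : Bool) : sg s t = sg t s := by
  cases s <;> cases t <;> simp [sg]
theorem sg_sq' (s t : Bool) : sg s t * sg s t = 1 := by cases s <;> cases t <;> simp [sg]

theorem D_c (H : CCR c a) (s t : Bool) (i j k m : J) :
    Dop c a s i j * c (t, k, m) = sg s t • (c (t, k, m) * Dop c a s i j) + (dl j k : ℂ) • c (xor s t, i, m) := by
  have e : ∀ δ h, c (xor s δ, i, h) * a (δ, j, h) * c (t, k, m) =
      sg s t • (c (t, k, m) * (c (xor s δ, i, h) * a (δ, j, h))) +
        (dl (δ, j, h) (t, k, m) : ℂ) • c (xor s δ, i, h) := by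
    intro δ h
    rw [mul_assoc, H.ac, mul_add, mul_smul_comm, mul_smul_comm, mul_one, ← mul_assoc, H.cc, smul_mul_assoc,
      smul_smul, mul_assoc]
    congr 2
    simp only [sg_xor]
    have := sg_sq' δ t
    linear_combination sg s t * this
  simp only [Dop, Finset.sum_mul, Finset.mul_sum, e, Finset.sum_add_distrib, Finset.smul_sum]
  congr 1
  rw [Finset.sum_eq_single t, Finset.sum_eq_single m]
  · simp [dl]
  · intro b _ hb; simp [dl, hb]
  · simp
  · intro b _ hb; simp [dl, hb]
  · simp

theorem E_E (H : CCR c a) (x y u v : Bool × J × J) :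
    (c x * a y) * (c u * a v) = (sg x.1 u.1 * sg x.1 v.1 * sg y.1 u.1 * sg y.1 v.1) • ((c u * a v) * (c x * a y))
      + (dl y u : ℂ) • (c x * a v) - (sg x.1 u.1 * sg x.1 v.1 * sg y.1 u.1 * sg y.1 v.1 * dl v x : ℂ) • (c u * a y) := by
  have h1 : (c x * a y) * (c u * a v) = sg y.1 u.1 • ((c x * c u) * (a y * a v)) + (dl y u : ℂ) • (c x * a v) := by
    rw [mul_assoc, ← mul_assoc (a y), H.ac, add_mul, mul_add, smul_mul_assoc, mul_smul_comm, smul_mul_assoc, one_mul,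
      mul_smul_comm]
    simp only [mul_assoc]
  have h2 : (c u * a v) * (c x * a y) = sg v.1 x.1 • ((c u * c x) * (a v * a y)) + (dl v x : ℂ) • (c u * a y) := by
    rw [mul_assoc, ← mul_assoc (a v), H.ac, add_mul, mul_add, smul_mul_assoc, mul_smul_comm, smul_mul_assoc, one_mul,
      mul_smul_comm]
    simp only [mul_assoc]
  rw [h1, h2, H.cc x u, H.aa y v, sg_symm v.1 x.1]
  simp only [smul_mul_assoc, mul_smul_comm, smul_add, smul_smul]
  have e : sg x.1 u.1 * sg x.1 v.1 * sg y.1 u.1 * sg y.1 v.1 * sg x.1 v.1 = sg y.1 u.1 * (sg x.1 u.1 * sg y.1 v.1) := by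
    linear_combination (sg y.1 u.1 * (sg x.1 u.1 * sg y.1 v.1)) * sg_sq' x.1 v.1
  rw [e]
  have e2 : sg y.1 u.1 * (sg x.1 u.1 * sg y.1 v.1) = sg y.1 u.1 * (sg y.1 v.1 * sg x.1 u.1) := by ring
  simp only [e2]
  abel_nf

theorem D_D (H : CCR c a) (s t : Bool) (i j k m : J) :
    Dop c a s i j * Dop c a t k m = sg s t • (Dop c a t k m * Dop c a s i j) +
      ((dl j k : ℂ) • Dop c a (xor s t) i m - (sg s t * dl m i : ℂ) • Dop c a (xor s t) k j) := by
  have e : ∀ δ h δ' h', (c (xor s δ, i, h) * a (δ, j, h)) * (c (xor t δ', k, h') * a (δ', m, h')) =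
      sg s t • ((c (xor t δ', k, h') * a (δ', m, h')) * (c (xor s δ, i, h) * a (δ, j, h))) +
      ((if δ = xor t δ' ∧ h = h' then (dl j k : ℂ) else 0) • (c (xor s δ, i, h) * a (δ', m, h')) -
       (if δ' = xor s δ ∧ h' = h then (sg s t * dl m i : ℂ) else 0) • (c (xor t δ', k, h') * a (δ, j, h))) := by
    intro δ h δ' h'
    rw [E_E H]
    have e1 : sg (xor s δ) (xor t δ') * sg (xor s δ) δ' * sg δ (xor t δ') * sg δ δ' = sg s t := by
      cases s <;> cases t <;> cases δ <;> cases δ' <;> simp [sg]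
    simp only [e1]
    have e2 : (dl (δ, j, h) (xor t δ', k, h') : ℂ) = if δ = xor t δ' ∧ h = h' then (dl j k : ℂ) else 0 := by
      simp only [dl, Prod.mk.injEq]; split_ifs <;> simp_all
    have e3 : (sg s t * dl (δ', m, h') (xor s δ, i, h) : ℂ) = if δ' = xor s δ ∧ h' = h then (sg s t * dl m i : ℂ) else 0 := by
      simp only [dl, Prod.mk.injEq]; split_ifs <;> simp_all
    rw [e2, e3]; abel
  have e0 : ∀ s i j, Dop c a s i j = ∑ δ : Bool, ∑ k : J, c (xor s δ, i, k) * a (δ, j, k) := fun _ _ _ => rfl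
  have hA : Dop c a s i j * Dop c a t k m = ∑ δ, ∑ h, ∑ δ', ∑ h',
      (c (xor s δ, i, h) * a (δ, j, h)) * (c (xor t δ', k, h') * a (δ', m, h')) := by
    simp only [e0, Finset.sum_mul]
    simp only [Finset.mul_sum]
  have hB : Dop c a t k m * Dop c a s i j = ∑ δ, ∑ h, ∑ δ', ∑ h',
      (c (xor t δ', k, h') * a (δ', m, h')) * (c (xor s δ, i, h) * a (δ, j, h)) := by
    simp only [e0, Finset.mul_sum]
    simp only [Finset.sum_mul]
  rw [hA, hB]
  simp only [e, Finset.sum_add_distrib, Finset.sum_sub_distrib, ← Finset.smul_sum]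
  congr 1
  congr 1
  · have : ∀ δ' : Bool, ∀ h' : J, ∑ δ : Bool, ∑ h : J, (if δ = xor t δ' ∧ h = h' then (dl j k : ℂ) else 0) •
        (c (xor s δ, i, h) * a (δ', m, h')) = (dl j k : ℂ) • (c (xor (xor s t) δ', i, h') * a (δ', m, h')) := by
      intro δ' h'
      rw [Finset.sum_eq_single (xor t δ'), Finset.sum_eq_single h']
      · simp
      · intro b _ hb; simp [hb]
      · simp
      · intro b _ hb; simp [hb]
      · simp
    simp only [e0, Finset.smul_sum, ← this]
    calc _ = ∑ δ, ∑ δ', ∑ h, ∑ h', (if δ = xor t δ' ∧ h = h' then (dl j k : ℂ) else 0) •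
        (c (xor s δ, i, h) * a (δ', m, h')) := Finset.sum_congr rfl fun _ _ => Finset.sum_comm
      _ = ∑ δ', ∑ δ, ∑ h, ∑ h', (if δ = xor t δ' ∧ h = h' then (dl j k : ℂ) else 0) •
        (c (xor s δ, i, h) * a (δ', m, h')) := Finset.sum_comm
      _ = ∑ δ', ∑ δ, ∑ h', ∑ h, (if δ = xor t δ' ∧ h = h' then (dl j k : ℂ) else 0) •
        (c (xor s δ, i, h) * a (δ', m, h')) := Finset.sum_congr rfl fun _ _ => Finset.sum_congr rfl fun _ _ => Finset.sum_comm
      _ = _ := Finset.sum_congr rfl fun _ _ => Finset.sum_comm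
  · have : ∀ δ : Bool, ∀ h : J, ∑ δ' : Bool, ∑ h' : J, (if δ' = xor s δ ∧ h' = h then (sg s t * dl m i : ℂ) else 0) •
        (c (xor t δ', k, h') * a (δ, j, h)) = (sg s t * dl m i : ℂ) • (c (xor (xor s t) δ, k, h) * a (δ, j, h)) := by
      intro δ h
      rw [Finset.sum_eq_single (xor s δ), Finset.sum_eq_single h]
      · have : xor t (xor s δ) = xor (xor s t) δ := by cases s <;> cases t <;> cases δ <;> rfl
        simp [this]
      · intro b _ hb; simp [hb]
      · simp
      · intro b _ hb; simp [hb]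
      · simp
    simp only [e0, Finset.smul_sum, this]

/-- The operators of the symbol representation. -/
def Lop (c a : Bool × J × J → A) (s : Bool) (i j : J) : A := c (s, i, j) + Dop c a s i j

theorem L_L (H : CCR c a) (s t : Bool) (i j k m : J) :
    Lop c a s i j * Lop c a t k m - sg s t • (Lop c a t k m * Lop c a s i j) =
      (dl j k : ℂ) • Lop c a (xor s t) i m - (sg s t * dl m i : ℂ) • Lop c a (xor s t) k j := by
  simp only [Lop, add_mul, mul_add, D_D H s t, D_c H s t, D_c H t s, H.cc (s, i, j) (t, k, m)]
  simp only [smul_add, smul_smul, sg_symm t s, sg_sq', Bool.xor_comm t s]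
  simp only [one_smul]
  abel

end Osc

/-! ## Reordering words -/
section Reorder
variable {X : Type} {R : Type*} [Ring R] [Algebra ℂ R] (par : X → Bool) (y : X → R) (S : X → Prop)

/-- The product of the letters of a word. -/
def wd (L : List X) : R := (L.map y).prod

theorem wd_nil : wd y [] = 1 := rfl
theorem wd_cons (a : X) (L : List X) : wd y (a :: L) = y a * wd y L := by simp [wd]
theorem wd_append (L L' : List X) : wd y (L ++ L') = wd y L * wd y L' := by simp [wd]

/-- Span of nonempty words of length at most `d` in the letters satisfying `S`. -/
def Fw (d : ℕ) : Submodule ℂ R :=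
  Submodule.span ℂ {x | ∃ L : List X, L ≠ [] ∧ L.length ≤ d ∧ (∀ a ∈ L, S a) ∧ x = wd y L}

/-- Good multisets: no odd letter is repeated. -/
def Good (m : Multiset X) : Prop := ∀ a, par a = true → m.count a ≤ 1

/-- Span of canonical nonempty words. -/
def Cw : Submodule ℂ R :=
  Submodule.span ℂ {x | ∃ m : Multiset X, m ≠ 0 ∧ Good par m ∧ (∀ a ∈ m, S a) ∧ x = wd y m.toList}

/-- Closed under brackets. -/
def Clo : Prop := ∀ a b, S a → S b →
  y a * y b - sg (par a) (par b) • (y b * y a) ∈ Submodule.span ℂ {x | ∃ c, S c ∧ x = y c}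

variable {par y S}

theorem Fw_mul_left {d : ℕ} {a : X} (ha : S a) {x : R} (hx : x ∈ Fw y S d) : y a * x ∈ Fw y S (d + 1) := by
  induction hx using Submodule.span_induction with
  | mem x h =>
    obtain ⟨L, h0, h1, h2, rfl⟩ := h
    refine Submodule.subset_span ⟨a :: L, by simp, by simpa using h1, ?_, (wd_cons _ _ _).symm⟩
    simpa [ha] using h2
  | zero => simp
  | add a b _ _ ha hb => rw [mul_add]; exact Submodule.add_mem _ ha hb
  | smul c b _ hb => rw [mul_smul_comm]; exact Submodule.smul_mem _ _ hb

theorem Fw_letter_mul {L : List X} (hL : ∀ a ∈ L, S a) {x : R}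
    (hx : x ∈ Submodule.span ℂ {x | ∃ c, S c ∧ x = y c}) : x * wd y L ∈ Fw y S (L.length + 1) := by
  induction hx using Submodule.span_induction with
  | mem x h =>
    obtain ⟨c, hc, rfl⟩ := h
    refine Submodule.subset_span ⟨c :: L, by simp, by simp, ?_, (wd_cons _ _ _).symm⟩
    simpa [hc] using hL
  | zero => simp
  | add a b _ _ ha hb => rw [add_mul]; exact Submodule.add_mem _ ha hb
  | smul c b _ hb => rw [smul_mul_assoc]; exact Submodule.smul_mem _ _ hb

theorem Fw_perm (hc : Clo par y S) {L L' : List X} (h : L.Perm L') (hL : ∀ a ∈ L, S a) :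
    ∃ c : ℂ, wd y L - c • wd y L' ∈ Fw y S (L.length - 1) := by
  induction h with
  | nil => exact ⟨1, by simp⟩
  | cons a h ih =>
    rename_i l₁ l₂
    obtain ⟨c, hcc⟩ := ih fun b hb => hL b (by simp [hb])
    refine ⟨c, ?_⟩
    rw [wd_cons, wd_cons, ← mul_smul_comm, ← mul_sub]
    rcases List.eq_nil_or_concat l₁ with rfl | ⟨l', b, rfl⟩
    · have := h.nil_eq; subst this
      have h0 : (Fw y S 0) = ⊥ := by
        rw [Fw, Submodule.span_eq_bot]
        rintro x ⟨L, h1, h2, -⟩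
        exact absurd (List.length_eq_zero_iff.1 (Nat.le_zero.1 h2)) h1
      simp only [List.length_nil, Nat.zero_sub, h0, Submodule.mem_bot] at hcc
      rw [hcc]; simp
    · have := Fw_mul_left (hL a (by simp)) hcc
      simpa using this
  | swap a b l =>
    refine ⟨sg (par b) (par a), ?_⟩
    have h1 := hc b a (hL b (by simp)) (hL a (by simp))
    have h2 := Fw_letter_mul (L := l) (fun x hx => hL x (by simp [hx])) h1
    simpa [wd_cons, sub_mul, mul_assoc] using h2
  | trans h1 h2 ih1 ih2 =>
    obtain ⟨c, h3⟩ := ih1 hL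
    obtain ⟨d, h4⟩ := ih2 fun a ha => hL a (h1.mem_iff.2 ha)
    refine ⟨c * d, ?_⟩
    rw [← h1.length_eq] at h4
    have := Submodule.add_mem _ h3 (Submodule.smul_mem _ c h4)
    rw [smul_sub, smul_smul] at this
    simpa using this

theorem wd_mem_Cw (hc : Clo par y S) : ∀ (d : ℕ) (L : List X), L.length ≤ d → L ≠ [] → (∀ a ∈ L, S a) →
    wd y L ∈ Cw par y S := by
  intro d
  induction d with
  | zero => intro L h1 h2; exact absurd (List.length_eq_zero_iff.1 (Nat.le_zero.1 h1)) h2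
  | succ d ih =>
    intro L h1 h2 h3
    have hF : Fw y S d ≤ Cw par y S := by
      rw [Fw, Submodule.span_le]
      rintro x ⟨L', h4, h5, h6, rfl⟩
      exact ih L' h5 h4 h6
    have hF' : Fw y S (L.length - 1) ≤ Cw par y S := by
      refine le_trans (Submodule.span_mono ?_) hF
      rintro x ⟨L', h4, h5, h6⟩
      exact ⟨L', h4, by omega, h6⟩
    by_cases hg : Good par (L : Multiset X)
    · obtain ⟨c, h4⟩ := Fw_perm hc (L' := (L : Multiset X).toList) (by
        rw [← Multiset.coe_eq_coe]; simp) h3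
      have h5 : wd y (L : Multiset X).toList ∈ Cw par y S :=
        Submodule.subset_span ⟨L, by simpa using h2, hg, by simpa using h3, rfl⟩
      have := Submodule.add_mem _ (hF' h4) (Submodule.smul_mem _ c h5)
      simpa using this
    · simp only [Good, not_forall, not_le, Multiset.coe_count] at hg
      obtain ⟨a, ha, hcount⟩ := hg
      have hm : a ∈ L := List.count_pos_iff.1 (by omega)
      have hp1 := List.perm_cons_erase hm
      have hm2 : a ∈ L.erase a := List.count_pos_iff.1 (by rw [List.count_erase_self]; omega)
      have hp2 := List.perm_cons_erase hm2
      set K := (L.erase a).erase a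
      have hp : L.Perm (a :: a :: K) := hp1.trans (hp2.cons a)
      obtain ⟨c, h4⟩ := Fw_perm hc hp h3
      have hSa : S a := h3 a hm
      have h5 := hc a a hSa hSa
      rw [ha] at h5
      have h6 : y a * y a - sg true true • (y a * y a) = (2 : ℂ) • (y a * y a) := by
        simp only [sg, Bool.and_self, if_true]; module
      rw [h6] at h5
      have h7 : y a * y a ∈ Submodule.span ℂ {x | ∃ c, S c ∧ x = y c} := by
        have := Submodule.smul_mem _ (2⁻¹ : ℂ) h5
        rwa [smul_smul, inv_mul_cancel₀ two_ne_zero, one_smul] at this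
      have h8 := Fw_letter_mul (L := K) (fun x hx => h3 x (hp.mem_iff.2 (by simp [hx]))) h7
      have hlen : K.length + 1 = L.length - 1 := by rw [hp.length_eq]; simp
      rw [hlen] at h8
      have h9 : wd y (a :: a :: K) = y a * y a * wd y K := by rw [wd_cons, wd_cons, mul_assoc]
      rw [← h9] at h8
      have := Submodule.add_mem _ (hF' h4) (Submodule.smul_mem _ c (hF' h8))
      simpa using this

end Reorder

/-! ## Leading terms and linear independence -/
section Lead
variable {X : Type} [Fintype X] (par : X → Bool) (key : X → ℕ)

/-- Vectors of degree less than `d`. -/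
def Vl (X : Type) [Fintype X] (d : ℕ) : Submodule ℂ (Fk X) := Finsupp.supported ℂ ℂ {M : X → ℕ | ∑ x, M x < d}

theorem Vl_mono {d e : ℕ} (h : d ≤ e) : Vl X d ≤ Vl X e :=
  Finsupp.supported_mono fun M hM => lt_of_lt_of_le hM h

theorem single_mem_Vl {d : ℕ} {M : X → ℕ} (h : ∑ x, M x < d) (c : ℂ) : Finsupp.single M c ∈ Vl X d :=
  Finsupp.single_mem_supported ℂ c h

theorem map_Vl {d e : ℕ} (F : Fk X →ₗ[ℂ] Fk X) (h : ∀ M : X → ℕ, ∑ x, M x < d → F (Finsupp.single M 1) ∈ Vl X e)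
    {v : Fk X} (hv : v ∈ Vl X d) : F v ∈ Vl X e := by
  rw [Vl, Finsupp.supported_eq_span_single] at hv
  induction hv using Submodule.span_induction with
  | mem x hx => obtain ⟨M, hM, rfl⟩ := hx; exact h M hM
  | zero => simp
  | add a b _ _ ha hb => rw [map_add]; exact Submodule.add_mem _ ha hb
  | smul c b _ hb => rw [map_smul]; exact Submodule.smul_mem _ _ hb

theorem sum_update (M : X → ℕ) (x : X) (k : ℕ) : ∑ w, Function.update M x k w + M x = ∑ w, M w + k := by
  have h1 := Finset.add_sum_erase Finset.univ (Function.update M x k) (Finset.mem_univ x)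
  have h2 := Finset.add_sum_erase Finset.univ M (Finset.mem_univ x)
  have h3 : ∑ w ∈ Finset.univ.erase x, Function.update M x k w = ∑ w ∈ Finset.univ.erase x, M w :=
    Finset.sum_congr rfl fun w hw => Function.update_of_ne (Finset.ne_of_mem_erase hw) _ _
  rw [h3, Function.update_self] at h1
  omega

theorem cr_Vl {d : ℕ} (x : X) {v : Fk X} (hv : v ∈ Vl X d) : cr par key x v ∈ Vl X (d + 1) := by
  refine map_Vl _ (fun M hM => ?_) hv
  rw [cr_single]
  refine Submodule.smul_mem _ _ (single_mem_Vl ?_ _)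
  have := sum_update M x (M x + 1)
  omega

theorem an_Vl {d : ℕ} (x : X) {v : Fk X} (hv : v ∈ Vl X (d + 1)) : an par key x v ∈ Vl X d := by
  refine map_Vl _ (fun M hM => ?_) hv
  rw [an, op_single]
  rcases Nat.eq_zero_or_pos (M x) with h | h
  · have : cb (par x) (M x) = 0 := by rw [h]; cases par x <;> simp [cb]
    rw [this]; simp
  · refine Submodule.smul_mem _ _ (single_mem_Vl ?_ _)
    have := sum_update M x (M x - 1)
    omega

theorem cran_Vl {d : ℕ} (x w : X) {v : Fk X} (hv : v ∈ Vl X d) : cr par key x (an par key w v) ∈ Vl X d := by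
  cases d with
  | zero =>
    have : v = 0 := by
      have h0 : Vl X 0 = ⊥ := by simp [Vl]
      rw [h0] at hv; simpa using hv
    subst this; simp
  | succ d => exact cr_Vl _ _ _ (an_Vl _ _ _ hv)

variable {par key}

theorem sum_count (L : List X) : ∑ a, L.count a = L.length := by
  have := Multiset.sum_count_eq_card (s := Finset.univ) (m := (L : Multiset X)) (by simp)
  simpa using this

theorem lead {P D : X → Module.End ℂ (Fk X)} (hP : ∀ x, P x = cr par key x + D x)
    (hD : ∀ x d v, v ∈ Vl X d → D x v ∈ Vl X d) :
    ∀ L : List X, Good par (L : Multiset X) → ∃ c : ℂ, c ≠ 0 ∧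
      wd P L (vac X) - c • Finsupp.single (fun a => L.count a) (1 : ℂ) ∈ Vl X L.length := by
  intro L
  induction L with
  | nil => intro _; exact ⟨1, one_ne_zero, by simp [wd_nil, vac, Pi.zero_def]⟩
  | cons a L ih =>
    intro hg
    have hg' : Good par (L : Multiset X) := by
      intro b hb
      have := hg b hb
      simp only [Multiset.coe_count, List.count_cons] at this ⊢
      split_ifs at this <;> omega
    obtain ⟨c, hc, hv⟩ := ih hg'
    set v := wd P L (vac X) with hvdef
    set M : X → ℕ := fun a => L.count a with hM
    have hMs : ∑ x, M x = L.length := sum_count L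
    have hca : ca (par a) (M a) = 1 := by
      cases hp : par a with
      | false => simp [ca]
      | true =>
        have h1 := hg a hp
        simp only [Multiset.coe_count, List.count_cons_self] at h1
        have : M a = 0 := by show L.count a = 0; omega
        rw [this]; simp [ca]
    have hup : Function.update M a (M a + 1) = fun b => (a :: L).count b := by
      funext b
      by_cases h : b = a
      · subst h; simp [hM]
      · rw [Function.update_of_ne h, hM]; simp [List.count_cons, Ne.symm h]
    have hjw : jw par key a M ≠ 0 := fun h0 => by
      have := jw_sq par key a M; rw [h0] at this; simp at this
    refine ⟨c * jw par key a M, mul_ne_zero hc hjw, ?_⟩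
    have e : wd P (a :: L) (vac X) = P a v := by rw [wd_cons]; rfl
    have hs : Finsupp.single M (1 : ℂ) ∈ Vl X (L.length + 1) := single_mem_Vl (by omega) _
    have h1 := cr_Vl par key a hv
    have h2 : D a v ∈ Vl X (L.length + 1) := by
      apply hD
      have := Submodule.add_mem _ (Vl_mono (Nat.le_succ _) hv) (Submodule.smul_mem _ c hs)
      simpa using this
    rw [map_sub, map_smul, cr_single, hca, mul_one, hup, smul_smul] at h1
    have h3 := Submodule.add_mem _ h1 h2
    rw [e, hP, List.length_cons]
    convert h3 using 1
    rw [LinearMap.add_apply]; abel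

theorem linInd {P D : X → Module.End ℂ (Fk X)} (hP : ∀ x, P x = cr par key x + D x)
    (hD : ∀ x d v, v ∈ Vl X d → D x v ∈ Vl X d) {R : Type*} [Ring R] [Algebra ℂ R]
    (y : X → R) (ρ : R →ₐ[ℂ] Module.End ℂ (Fk X)) (hρ : ∀ x, ρ (y x) = P x)
    (cn : Multiset X → List X) (hcn : ∀ m, (cn m : Multiset X) = m) :
    LinearIndependent ℂ fun m : {m : Multiset X // Good par m} => wd y (cn m.1) := by
  have hw : ∀ L, ρ (wd y L) = wd P L := by
    intro L
    induction L with
    | nil => simp [wd_nil]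
    | cons a L ih => rw [wd_cons, wd_cons, map_mul, hρ, ih]
  rw [linearIndependent_iff]
  intro f hf
  by_contra hne
  obtain ⟨m, hm, hmax⟩ := f.support.exists_max_image (fun m => Multiset.card m.1) (Finsupp.support_nonempty_iff.2 hne)
  have h0 : ∑ k ∈ f.support, f k • (wd P (cn k.1) (vac X)) = 0 := by
    have := congrArg (fun r => ρ r (vac X)) hf
    simpa [Finsupp.linearCombination_apply, Finsupp.sum, map_sum, hw, LinearMap.sum_apply] using this
  set M : X → ℕ := fun a => m.1.count a with hM
  have hcard : ∀ k : Multiset X, (cn k).length = Multiset.card k := fun k => by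
    rw [← Multiset.coe_card, hcn]
  have hcount : ∀ k : Multiset X, (fun a => (cn k).count a) = fun a => k.count a := fun k => by
    funext a; rw [← Multiset.coe_count, hcn]
  have hMs : ∑ x, M x = Multiset.card m.1 := Multiset.sum_count_eq_card (by simp)
  have h1 := congrArg (fun v : Fk X => v M) h0
  simp only [Finsupp.finset_sum_apply, Finsupp.smul_apply, Finsupp.zero_apply] at h1
  have hlow : ∀ k ∈ f.support, ∀ v ∈ Vl X (Multiset.card k.1), v M = 0 := by
    intro k hk v hv
    by_contra h
    have : M ∈ {M : X → ℕ | ∑ x, M x < Multiset.card k.1} := (Finsupp.mem_supported ℂ v).1 hv (by simpa using h)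
    have h2 := hmax k hk
    simp only [Set.mem_setOf_eq] at this
    omega
  rw [Finset.sum_eq_single m] at h1
  · obtain ⟨c, hc, hv⟩ := lead hP hD (cn m.1) (by rw [hcn]; exact m.2)
    rw [hcard, hcount] at hv
    have h2 := hlow m hm _ hv
    rw [Finsupp.sub_apply, Finsupp.smul_apply, Finsupp.single_eq_same, sub_eq_zero] at h2
    rw [h2] at h1
    simp [hc] at h1
    exact (Finsupp.mem_support_iff.1 hm) h1
  · intro k hk hkm
    obtain ⟨c, hc, hv⟩ := lead hP hD (cn k.1) (by rw [hcn]; exact k.2)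
    rw [hcard, hcount] at hv
    have h2 := hlow k hk _ hv
    have hne' : (fun a => k.1.count a) ≠ M := by
      intro h
      apply hkm
      apply Subtype.ext
      ext a
      exact congrFun h a
    rw [Finsupp.sub_apply, Finsupp.smul_apply, Finsupp.single_eq_of_ne hne'.symm, smul_zero, sub_zero] at h2
    rw [h2, smul_zero]
  · intro h; exact absurd hm h

end Lead

/-! ## PBW-type independence -/
section Pbw
variable {N l : ℕ} {R : Type*} [Ring R] [Algebra ℂ R] {z : Bool → Fin N × Fin l → Fin N × Fin l → R}

/-- Letters. -/
abbrev XX (N l : ℕ) := Bool × (Fin N × Fin l) × (Fin N × Fin l)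

/-- Shifted letters. -/
def yc (z : Bool → Fin N × Fin l → Fin N × Fin l → R) (u : XX N l) : R := zc z u.1 u.2.1 u.2.2

/-- Letters of `g₀`. -/
def S0 (u : XX N l) : Prop := u.2.1.2 = u.2.2.2
/-- Letters of `n`. -/
def Sn (u : XX N l) : Prop := u.2.1.2 < u.2.2.2
/-- Letters of `m`. -/
def Sm (u : XX N l) : Prop := u.2.2.2 < u.2.1.2

theorem chi_zero {s : Bool} {i j : Fin N × Fin l} (h : i.2 ≤ j.2) : chi s i j = 0 := by
  unfold chi
  rw [if_neg]
  rintro ⟨-, -, h2⟩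
  have : i.2.val ≤ j.2.val := h
  omega

theorem zc_eq {s : Bool} {i j : Fin N × Fin l} (h : i.2 ≤ j.2) : zc z s i j = z s i j := by
  rw [zc, chi_zero h]; simp

theorem zc_commR (hz : IsQ z) (s t : Bool) (i j k m : Fin N × Fin l) :
    zc z s i j * zc z t k m - sg s t • (zc z t k m * zc z s i j) =
      dl j k • z (xor s t) i m - (sg s t * dl m i) • z (xor s t) k j := by
  rw [← hz.comm]
  have h : (chi s i j = 0 ∧ chi t k m = 0) ∨ sg s t = 1 ∨ True := by tauto
  cases s <;> cases t <;>
  simp only [zc, chi_true, sub_mul, mul_sub, smul_sub, smul_mul_assoc, mul_smul_comm, one_mul, mul_one, zero_smul, sub_zero, sg,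
    Bool.and_true, Bool.and_false, Bool.and_self, if_true, if_false, Bool.false_eq_true, one_smul] <;>
  (try simp only [smul_smul]) <;> (try rw [mul_comm (chi false i j) (chi false k m)]) <;> abel

theorem clo_of (hz : IsQ z) (S : XX N l → Prop) (r : Fin l → Fin l → Prop)
    (hS : ∀ u, S u ↔ r u.2.1.2 u.2.2.2)
    (hr : ∀ a b c, r a b → r b c → r a c)
    (hc : ∀ s (i j : Fin N × Fin l) b, r i.2 b → r b j.2 → chi s i j = 0) : Clo Prod.fst (yc z) S := by
  rintro ⟨s, i, j⟩ ⟨t, k, m⟩ hu hv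
  rw [hS] at hu hv
  simp only [yc] at hu hv ⊢
  rw [zc_commR hz]
  refine Submodule.sub_mem _ ?_ ?_
  · by_cases h : j = k
    · subst h
      refine Submodule.smul_mem _ _ (Submodule.subset_span ⟨(xor s t, i, m), ?_, ?_⟩)
      · rw [hS]; exact hr _ _ _ hu hv
      · simp only [yc, zc]; rw [hc _ _ _ _ hu hv]; simp
    · rw [dl_ne h, zero_smul]; exact Submodule.zero_mem _
  · by_cases h : m = i
    · subst h
      refine Submodule.smul_mem _ _ (Submodule.subset_span ⟨(xor s t, k, j), ?_, ?_⟩)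
      · rw [hS]; exact hr _ _ _ hv hu
      · simp only [yc, zc]; rw [hc _ _ _ _ hv hu]; simp
    · rw [dl_ne h, mul_zero, zero_smul]; exact Submodule.zero_mem _

theorem clo_S0 (hz : IsQ z) : Clo Prod.fst (yc z) (S0 (N := N) (l := l)) :=
  clo_of hz _ (fun a b => a = b) (fun u => Iff.rfl) (fun a b c h1 h2 => h1.trans h2)
    (fun s i j b h1 h2 => chi_zero (le_of_eq (h1.trans h2)))
theorem clo_Sn (hz : IsQ z) : Clo Prod.fst (yc z) (Sn (N := N) (l := l)) :=
  clo_of hz _ (fun a b => a < b) (fun u => Iff.rfl) (fun a b c h1 h2 => h1.trans h2)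
    (fun s i j b h1 h2 => chi_zero (h1.trans h2).le)
theorem clo_Sm (hz : IsQ z) : Clo Prod.fst (yc z) (Sm (N := N) (l := l)) :=
  clo_of hz _ (fun a b => b < a) (fun u => Iff.rfl) (fun a b c h1 h2 => h2.trans h1)
    (fun s i j b h1 h2 => by
      unfold chi
      rw [if_neg]
      rintro ⟨-, -, h3⟩
      have h1' : b.val < i.2.val := h1
      have h2' : j.2.val < b.val := h2
      omega)

section Words
variable {X : Type} {par : X → Bool} (y : X → R) (S : X → Prop)
/-- Span of words. -/
def Aw : Submodule ℂ R := Submodule.span ℂ {x | ∃ L : List X, (∀ a ∈ L, S a) ∧ x = wd y L}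
/-- Span of nonempty words. -/
def Ap : Submodule ℂ R := Submodule.span ℂ {x | ∃ L : List X, L ≠ [] ∧ (∀ a ∈ L, S a) ∧ x = wd y L}
/-- Span of letters. -/
def Zw : Submodule ℂ R := Submodule.span ℂ {x | ∃ c, S c ∧ x = y c}
variable {y S}
theorem one_mem_Aw : (1 : R) ∈ Aw y S := Submodule.subset_span ⟨[], by simp, rfl⟩
theorem Zw_mul_Aw : Zw y S * Aw y S ≤ Aw y S := by
  rw [Zw, Aw, Submodule.span_mul_span, Submodule.span_le]
  rintro _ ⟨_, ⟨c, hc, rfl⟩, _, ⟨L, hL, rfl⟩, rfl⟩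
  exact Submodule.subset_span ⟨c :: L, by simpa [hc] using hL, (wd_cons _ _ _).symm⟩
theorem Aw_mul_Zw : Aw y S * Zw y S ≤ Ap y S := by
  rw [Zw, Aw, Submodule.span_mul_span, Submodule.span_le]
  rintro _ ⟨_, ⟨L, hL, rfl⟩, _, ⟨c, hc, rfl⟩, rfl⟩
  refine Submodule.subset_span ⟨L ++ [c], by simp, ?_, ?_⟩
  · intro a ha
    rcases List.mem_append.1 ha with h | h
    · exact hL a h
    · rw [List.mem_singleton.1 h]; exact hc
  · rw [wd_append, wd_cons, wd_nil, mul_one]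
theorem mem_Zw {c : X} (h : S c) : y c ∈ Zw y S := Submodule.subset_span ⟨c, h, rfl⟩

theorem Ap_le (hc : Clo par y S) : Ap y S ≤ Cw par y S := by
  rw [Ap, Submodule.span_le]
  rintro _ ⟨L, h1, h2, rfl⟩
  exact wd_mem_Cw hc _ L le_rfl h1 h2

theorem Aw_le (hc : Clo par y S) : Aw y S ≤
    Submodule.span ℂ {x | ∃ m : Multiset X, Good par m ∧ (∀ a ∈ m, S a) ∧ x = wd y m.toList} := by
  rw [Aw, Submodule.span_le]
  rintro _ ⟨L, h2, rfl⟩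
  by_cases h : L = []
  · subst h
    exact Submodule.subset_span ⟨0, fun a _ => by simp, by simp, by simp⟩
  · refine (Submodule.span_mono ?_ : Cw par y S ≤ _) (wd_mem_Cw hc _ L le_rfl h h2)
    rintro x ⟨m, -, h3⟩
    exact ⟨m, h3⟩
end Words

theorem PP_ind (C : Submodule ℂ R) (h1 : (1 : R) ∈ C)
    (hm : ∀ s (i j : Fin N × Fin l), i.2 ≤ j.2 → ∀ x ∈ C, z s i j * x ∈ C) : ∀ x ∈ PP z, x ∈ C := by
  intro x hx
  have hx' : x ∈ Subalgebra.toSubmodule (PP z) := hx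
  rw [PP, Algebra.adjoin_eq_span] at hx'
  refine (Submodule.span_le.2 ?_) hx'
  intro w hw
  induction hw using Submonoid.closure_induction_left with
  | one => exact h1
  | mul_left a ha b hb ih =>
    obtain ⟨s, i, j, h, rfl⟩ := ha
    exact hm s i j h _ ih

theorem Zn_A0 (hz : IsQ z) (L : List (XX N l)) : (∀ a ∈ L, S0 a) → ∀ x ∈ Zw (yc z) Sn,
    x * wd (yc z) L ∈ Aw (yc z) S0 * Zw (yc z) Sn := by
  induction L with
  | nil =>
    intro _ x hx
    rw [wd_nil, mul_one, ← one_mul x]; exact Submodule.mul_mem_mul one_mem_Aw hx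
  | cons g L ih =>
    intro hL x hx
    induction hx using Submodule.span_induction with
    | zero => simp
    | add a b _ _ ha hb => rw [add_mul]; exact Submodule.add_mem _ ha hb
    | smul c b _ hb => rw [smul_mul_assoc]; exact Submodule.smul_mem _ _ hb
    | mem x hx =>
      obtain ⟨u, hu, rfl⟩ := hx
      have hg : S0 g := hL g (by simp)
      have ihL := ih fun a ha => hL a (by simp [ha])
      obtain ⟨s, i, j⟩ := u
      obtain ⟨t, k, m⟩ := g
      simp only [Sn, S0] at hu hg
      have h1 := zc_commR hz s t i j k m
      have h2 : zc z s i j * zc z t k m - sg s t • (zc z t k m * zc z s i j) ∈ Zw (yc z) Sn := by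
        rw [h1]
        refine Submodule.sub_mem _ ?_ ?_
        · by_cases h : j = k
          · subst h
            have hlt : i.2 < m.2 := by rw [← hg]; exact hu
            rw [← zc_eq (z := z) hlt.le]
            exact Submodule.smul_mem _ _ (mem_Zw (c := (xor s t, i, m)) hlt)
          · rw [dl_ne h, zero_smul]; exact Submodule.zero_mem _
        · by_cases h : m = i
          · subst h
            have hlt : k.2 < j.2 := by rw [hg]; exact hu
            rw [← zc_eq (z := z) hlt.le]
            exact Submodule.smul_mem _ _ (mem_Zw (c := (xor s t, k, j)) hlt)
          · rw [dl_ne h, mul_zero, zero_smul]; exact Submodule.zero_mem _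
      have h3 := ihL _ h2
      have h4 := ihL (yc z (s, i, j)) (mem_Zw hu)
      have h5 : yc z (t, k, m) * (yc z (s, i, j) * wd (yc z) L) ∈ Aw (yc z) S0 * Zw (yc z) Sn := by
        have : yc z (t, k, m) * (yc z (s, i, j) * wd (yc z) L) ∈ Zw (yc z) S0 * (Aw (yc z) S0 * Zw (yc z) Sn) :=
          Submodule.mul_mem_mul (mem_Zw hg) h4
        rw [← mul_assoc (Zw (yc z) S0)] at this
        exact mul_le_mul' Zw_mul_Aw le_rfl this
      have h6 := Submodule.add_mem _ h3 (Submodule.smul_mem _ (sg s t) h5)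
      rw [wd_cons]
      convert h6 using 1
      simp only [yc, sub_mul, smul_mul_assoc, mul_assoc]; abel

theorem PP_le (hz : IsQ z) : ∀ x ∈ PP z, x ∈ Aw (yc z) S0 * Aw (yc z) Sn := by
  apply PP_ind
  · rw [← one_mul (1 : R)]; exact Submodule.mul_mem_mul one_mem_Aw one_mem_Aw
  · intro s i j hij x hx
    rcases hij.eq_or_lt with h | h
    · rw [← zc_eq (z := z) hij]
      have : zc z s i j * x ∈ Zw (yc z) S0 * (Aw (yc z) S0 * Aw (yc z) Sn) :=
        Submodule.mul_mem_mul (mem_Zw (c := (s, i, j)) h) hx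
      rw [← mul_assoc] at this
      exact mul_le_mul' Zw_mul_Aw le_rfl this
    · rw [← zc_eq (z := z) hij]
      have : zc z s i j * x ∈ Zw (yc z) Sn * (Aw (yc z) S0 * Aw (yc z) Sn) :=
        Submodule.mul_mem_mul (mem_Zw (c := (s, i, j)) h) hx
      have h1 : Zw (yc z) Sn * Aw (yc z) S0 ≤ Aw (yc z) S0 * Zw (yc z) Sn := by
        rw [Submodule.mul_le]
        intro a ha b hb
        induction hb using Submodule.span_induction with
        | zero => simp
        | add u v _ _ hu hv => rw [mul_add]; exact Submodule.add_mem _ hu hv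
        | smul c v _ hv => rw [mul_smul_comm]; exact Submodule.smul_mem _ _ hv
        | mem x hx => obtain ⟨L, hL, rfl⟩ := hx; exact Zn_A0 hz L hL a ha
      rw [← mul_assoc] at this
      have := mul_le_mul' h1 le_rfl this
      rw [mul_assoc] at this
      exact mul_le_mul' le_rfl Zw_mul_Aw this

theorem all_le (hz : IsQ z) : ∀ x : R, x ∈ Subalgebra.toSubmodule (PP z) * Aw (yc z) Sm := by
  set B := Subalgebra.toSubmodule (PP z) * Aw (yc z) Sm with hB
  have hPB : ∀ u ∈ PP z, ∀ b ∈ B, u * b ∈ B := by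
    intro u hu b hb
    have : u * b ∈ Subalgebra.toSubmodule (PP z) * B := Submodule.mul_mem_mul hu hb
    rwa [hB, ← mul_assoc, (Subalgebra.isIdempotentElem_toSubmodule (PP z)).eq] at this
  have key : ∀ u ∈ PP z, ∀ v ∈ Aw (yc z) Sm, ∀ s i j, z s i j * (u * v) ∈ B := by
    intro u hu v hv
    let C : Submodule ℂ R :=
      { carrier := {u | u * v ∈ B ∧ ∀ s i j, z s i j * (u * v) ∈ B}
        zero_mem' := by simp
        add_mem' := by
          intro a b ha hb
          refine ⟨by rw [add_mul]; exact B.add_mem ha.1 hb.1, fun s i j => ?_⟩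
          rw [add_mul, mul_add]; exact B.add_mem (ha.2 s i j) (hb.2 s i j)
        smul_mem' := by
          intro c a ha
          refine ⟨by rw [smul_mul_assoc]; exact B.smul_mem _ ha.1, fun s i j => ?_⟩
          rw [smul_mul_assoc, mul_smul_comm]; exact B.smul_mem _ (ha.2 s i j) }
    have hvB : v ∈ B := by
      rw [← one_mul v]; exact Submodule.mul_mem_mul (one_mem (PP z)) hv
    have : u ∈ C := by
      refine PP_ind C ⟨by rwa [one_mul], fun s i j => ?_⟩ ?_ u hu
      · rw [one_mul]
        rcases le_or_gt i.2 j.2 with h | h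
        · exact Submodule.mul_mem_mul (PP_gen h) hv
        · have e : z s i j = zc z s i j + chi s i j • 1 := by rw [zc]; abel
          rw [e, add_mul, smul_mul_assoc, one_mul]
          refine B.add_mem ?_ (B.smul_mem _ hvB)
          have h1 : zc z s i j * v ∈ Aw (yc z) Sm := Zw_mul_Aw (Submodule.mul_mem_mul (mem_Zw (c := (s, i, j)) h) hv)
          rw [← one_mul (zc z s i j * v)]
          exact Submodule.mul_mem_mul (one_mem (PP z)) h1
      · rintro t k m hkm x ⟨hx1, hx2⟩
        refine ⟨by rw [mul_assoc]; exact hx2 _ _ _, fun s i j => ?_⟩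
        rw [mul_assoc, ← mul_assoc, hz.mul_eq s t i j k m, add_mul, sub_mul]
        simp only [smul_mul_assoc]
        refine B.add_mem (B.smul_mem _ ?_) (B.sub_mem (B.smul_mem _ (hx2 _ _ _)) (B.smul_mem _ (hx2 _ _ _)))
        rw [mul_assoc]
        exact hPB _ (PP_gen hkm) _ (hx2 _ _ _)
    exact this.2
  refine hz.ind B ?_ ?_
  · rw [← one_mul (1 : R)]; exact Submodule.mul_mem_mul (one_mem (PP z)) one_mem_Aw
  · intro s i j x hx
    induction hx using Submodule.mul_induction_on' with
    | mem_mul_mem u hu v hv => exact key u hu v hv s i j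
    | add a _ b _ ha hb => rw [mul_add]; exact B.add_mem ha hb

/-- Canonical word. -/
def cnn (m : Multiset (XX N l)) : List (XX N l) :=
  (m.filter S0).toList ++ (m.filter Sn).toList ++ (m.filter Sm).toList

theorem cnn_coe (m : Multiset (XX N l)) : (cnn m : Multiset (XX N l)) = m := by
  rw [cnn, ← Multiset.coe_add, ← Multiset.coe_add, Multiset.coe_toList, Multiset.coe_toList, Multiset.coe_toList]
  ext a
  simp only [Multiset.count_add, Multiset.count_filter]
  rcases lt_trichotomy a.2.1.2 a.2.2.2 with h | h | h
  · simp [S0, Sn, Sm, h, h.ne, h.le, not_lt_of_gt h]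
  · simp [S0, Sn, Sm, h]
  · simp [S0, Sn, Sm, h, h.ne', not_lt_of_gt h]

theorem filter_sum {S : XX N l → Prop} {a b c : Multiset (XX N l)} (ha : ∀ x ∈ a, S x) (hb : ∀ x ∈ b, ¬ S x)
    (hc : ∀ x ∈ c, ¬ S x) : (a + b + c).filter S = a := by
  rw [Multiset.filter_add, Multiset.filter_add, Multiset.filter_eq_self.2 ha, Multiset.filter_eq_nil.2 hb,
    Multiset.filter_eq_nil.2 hc]; simp

theorem cnn_sum {a b c : Multiset (XX N l)} (ha : ∀ x ∈ a, S0 x) (hb : ∀ x ∈ b, Sn x) (hc : ∀ x ∈ c, Sm x) :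
    cnn (a + b + c) = a.toList ++ b.toList ++ c.toList := by
  have e1 : (a + b + c).filter S0 = a := filter_sum ha (fun x hx => (hb x hx).ne) (fun x hx => (hc x hx).ne')
  have e2 : (a + b + c).filter Sn = b := by
    rw [add_comm a b]
    exact filter_sum hb (fun x hx => (ha x hx).not_lt) (fun x hx => not_lt_of_gt (hc x hx))
  have e3 : (a + b + c).filter Sm = c := by
    rw [add_comm (a + b) c, ← add_assoc]
    exact filter_sum hc (fun x hx => (ha x hx).not_gt) (fun x hx => not_lt_of_gt (hb x hx))
  rw [cnn, e1, e2, e3]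

theorem good_add {X : Type} {par : X → Bool} {a b : Multiset X} (ga : Good par a) (gb : Good par b)
    (h : ∀ x ∈ a, x ∉ b) : Good par (a + b) := by
  intro x hx
  rw [Multiset.count_add]
  by_cases hxa : x ∈ a
  · rw [Multiset.count_eq_zero.2 (h x hxa)]; exact ga x hx
  · rw [Multiset.count_eq_zero.2 hxa, zero_add]; exact gb x hx

theorem good_sum {a b c : Multiset (XX N l)} (ha : ∀ x ∈ a, S0 x) (hb : ∀ x ∈ b, Sn x) (hc : ∀ x ∈ c, Sm x)
    (ga : Good Prod.fst a) (gb : Good Prod.fst b) (gc : Good Prod.fst c) : Good Prod.fst (a + b + c) := by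
  refine good_add (good_add ga gb fun x h1 h2 => (hb x h2).ne (ha x h1)) gc fun x h1 h2 => ?_
  rcases Multiset.mem_add.1 h1 with h | h
  · exact (hc x h2).ne' (ha x h)
  · exact not_lt_of_gt (hc x h2) (hb x h)

/-- The span of the canonical words having a letter outside `g₀`. -/
def BX (z : Bool → Fin N × Fin l → Fin N × Fin l → R) : Submodule ℂ R :=
  Submodule.span ℂ ((fun m : {m : Multiset (XX N l) // Good Prod.fst m} => wd (yc z) (cnn m.1)) ''
    {m | ¬ ∀ a ∈ m.1, S0 a})

theorem trip_mem {a b c : Multiset (XX N l)} (ha : ∀ x ∈ a, S0 x) (hb : ∀ x ∈ b, Sn x) (hc : ∀ x ∈ c, Sm x)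
    (ga : Good Prod.fst a) (gb : Good Prod.fst b) (gc : Good Prod.fst c) (hne : b ≠ 0 ∨ c ≠ 0) :
    wd (yc z) a.toList * wd (yc z) b.toList * wd (yc z) c.toList ∈ BX z := by
  refine Submodule.subset_span ⟨⟨a + b + c, good_sum ha hb hc ga gb gc⟩, ?_, ?_⟩
  · intro h
    simp only at h
    rcases hne with h' | h'
    · obtain ⟨x, hx⟩ := Multiset.exists_mem_of_ne_zero h'
      exact (hb x hx).ne (h x (by simp [hx]))
    · obtain ⟨x, hx⟩ := Multiset.exists_mem_of_ne_zero h'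
      exact (hc x hx).ne' (h x (by simp [hx]))
  · simp only
    rw [cnn_sum ha hb hc, wd_append, wd_append]

theorem LL_le_BX (hz : IsQ z) : LL z ≤ BX z := by
  have h1 : LL z ≤ Aw (yc z) S0 * Ap (yc z) Sn := by
    rw [LL, Submodule.span_le]
    rintro _ ⟨u, hu, s, i, j, h, rfl⟩
    have := Submodule.mul_mem_mul (PP_le hz u hu) (mem_Zw (y := yc z) (S := Sn) (c := (s, i, j)) h)
    rw [mul_assoc] at this
    rw [← zc_eq (z := z) h.le]
    exact mul_le_mul' le_rfl Aw_mul_Zw this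
  refine h1.trans ((mul_le_mul' (Aw_le (clo_S0 hz)) (Ap_le (clo_Sn hz))).trans ?_)
  rw [Cw, Submodule.span_mul_span, Submodule.span_le]
  rintro _ ⟨_, ⟨a, ga, ha, rfl⟩, _, ⟨b, hb0, gb, hb, rfl⟩, rfl⟩
  have := trip_mem (z := z) ha hb (c := 0) (by simp) ga gb (fun x _ => by simp) (Or.inl hb0)
  simpa [wd_nil] using this

theorem II_le_BX (hz : IsQ z) : (II z).restrictScalars ℂ ≤ BX z := by
  have h1 : (II z).restrictScalars ℂ ≤ Aw (yc z) S0 * Aw (yc z) Sn * Ap (yc z) Sm := by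
    intro x hx
    have hx' : x ∈ II z := hx
    rw [II, Submodule.mem_span_set'] at hx'
    obtain ⟨n, f, g, rfl⟩ := hx'
    refine Submodule.sum_mem _ fun k _ => ?_
    obtain ⟨s, i, j, h, e⟩ := (g k).2
    rw [e, smul_eq_mul]
    have h2 := Submodule.mul_mem_mul (all_le hz (f k)) (mem_Zw (y := yc z) (S := Sm) (c := (s, i, j)) h)
    rw [mul_assoc] at h2
    have h3 : Subalgebra.toSubmodule (PP z) ≤ Aw (yc z) S0 * Aw (yc z) Sn := PP_le hz
    exact mul_le_mul' h3 Aw_mul_Zw h2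
  refine h1.trans ((mul_le_mul' (mul_le_mul' (Aw_le (clo_S0 hz)) (Aw_le (clo_Sn hz))) (Ap_le (clo_Sm hz))).trans ?_)
  rw [Cw, Submodule.span_mul_span, Submodule.span_mul_span, Submodule.span_le]
  rintro _ ⟨_, ⟨_, ⟨a, ga, ha, rfl⟩, _, ⟨b, gb, hb, rfl⟩, rfl⟩, _, ⟨c, hc0, gc, hc, rfl⟩, rfl⟩
  exact trip_mem ha hb hc ga gb gc (Or.inr hc0)

theorem IL_le_BX (hz : IsQ z) : IL z ≤ BX z := sup_le (II_le_BX hz) (LL_le_BX hz)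

end Pbw

/-! ## The key injectivity -/
section Inj
/-- A numbering of the letters. -/
def kk (X : Type) [Fintype X] (x : X) : ℕ := (Fintype.equivFin X x).val
theorem kk_inj (X : Type) [Fintype X] : Function.Injective (kk X) := fun a b h =>
  (Fintype.equivFin X).injective (Fin.ext h)

variable {J : Type} [Fintype J]
/-- Creation operators for letters. -/
def crE (u : Bool × J × J) : Module.End ℂ (Fk (Bool × J × J)) := cr Prod.fst (kk _) u
/-- Annihilation operators for letters. -/
def anE (u : Bool × J × J) : Module.End ℂ (Fk (Bool × J × J)) := an Prod.fst (kk _) u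

theorem ccrE : CCR (crE (J := J)) anE where
  cc x y := cr_cr (kk_inj _) x y
  aa x y := an_an (kk_inj _) x y
  ac x y := an_cr (kk_inj _) x y

theorem Dop_Vl (s : Bool) (i j : J) (d : ℕ) (v : Fk (Bool × J × J)) (hv : v ∈ Vl (Bool × J × J) d) :
    Dop (crE (J := J)) anE s i j v ∈ Vl (Bool × J × J) d := by
  simp only [Dop, LinearMap.sum_apply, Module.End.mul_apply]
  exact Submodule.sum_mem _ fun δ _ => Submodule.sum_mem _ fun k _ => cran_Vl _ _ _ _ hv

variable {N l : ℕ} {R : Type*} [Ring R] [Algebra ℂ R] {z : Bool → Fin N × Fin l → Fin N × Fin l → R}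

theorem pbw_ind (ρ : R →ₐ[ℂ] Module.End ℂ (Fk (XX N l))) (hρ : ∀ s i j, ρ (z s i j) = Lop crE anE s i j) :
    LinearIndependent ℂ fun m : {m : Multiset (XX N l) // Good Prod.fst m} => wd (yc z) (cnn m.1) := by
  refine linInd (par := Prod.fst) (key := kk _) (P := fun u => ρ (yc z u))
    (D := fun u => Dop crE anE u.1 u.2.1 u.2.2 - chi u.1 u.2.1 u.2.2 • 1) ?_ ?_ (yc z) ρ (fun _ => rfl) cnn cnn_coe
  · rintro ⟨s, i, j⟩
    simp only [yc, zc, map_sub, map_smul, map_one, hρ, Lop, crE]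
    exact add_sub_assoc (G := Module.End ℂ (Fk (XX N l))) _ _ _
  · rintro ⟨s, i, j⟩ d v hv
    simp only [LinearMap.sub_apply, LinearMap.smul_apply, Module.End.one_apply]
    exact Submodule.sub_mem _ (Dop_Vl _ _ _ _ _ hv) (Submodule.smul_mem _ _ hv)

theorem iota_inj (hz : IsQ z)
    (ρ : R →ₐ[ℂ] Module.End ℂ (Fk (XX N l))) (hρ : ∀ s i j, ρ (z s i j) = Lop crE anE s i j)
    {T : Type*} [Ring T] [Algebra ℂ T] (ι : T →ₐ[ℂ] R) (yT : XX N l → T)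
    (hyT : ∀ u, S0 u → ι (yT u) = z u.1 u.2.1 u.2.2) (hclo : Clo Prod.fst yT S0)
    (hT : ∀ C : Submodule ℂ T, 1 ∈ C → (∀ u, S0 u → ∀ x ∈ C, yT u * x ∈ C) → ∀ x, x ∈ C)
    (t : T) (ht : ι t ∈ IL z) : t = 0 := by
  have hw : ∀ L : List (XX N l), (∀ a ∈ L, S0 a) → ι (wd yT L) = wd (yc z) L := by
    intro L
    induction L with
    | nil => intro _; simp [wd_nil]
    | cons a L ih =>
      intro hL
      have ha : S0 a := hL a (by simp)
      rw [wd_cons, wd_cons, map_mul, ih fun b hb => hL b (by simp [hb]), hyT a ha]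
      congr 1
      exact (zc_eq (le_of_eq ha)).symm
  have hcn : ∀ m : Multiset (XX N l), (∀ a ∈ m, S0 a) → cnn m = m.toList := by
    intro m hm
    have := cnn_sum (a := m) (b := 0) (c := 0) hm (by simp) (by simp)
    simpa using this
  have hli := pbw_ind ρ hρ
  set b := fun m : {m : Multiset (XX N l) // Good Prod.fst m} => wd (yc z) (cnn m.1) with hb
  have h1 : t ∈ Aw yT S0 := by
    refine hT _ one_mem_Aw ?_ t
    intro u hu x hx
    exact Zw_mul_Aw (Submodule.mul_mem_mul (mem_Zw hu) hx)
  have h2 := Aw_le hclo h1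
  -- express through a finitely supported function
  let G0 := {m : {m : Multiset (XX N l) // Good Prod.fst m} // ∀ a ∈ m.1, S0 a}
  have h3 : t ∈ Submodule.span ℂ (Set.range fun m : G0 => wd yT m.1.1.toList) := by
    refine Submodule.span_mono ?_ h2
    rintro _ ⟨m, gm, hm, rfl⟩
    exact ⟨⟨⟨m, gm⟩, hm⟩, rfl⟩
  obtain ⟨f, hf⟩ := (Finsupp.mem_span_range_iff_exists_finsupp).1 h3
  have h4 : ι t = Finsupp.linearCombination ℂ (fun m : G0 => b m.1) f := by
    rw [← hf, Finsupp.sum, map_sum, Finsupp.linearCombination_apply, Finsupp.sum]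
    refine Finset.sum_congr rfl fun m _ => ?_
    rw [map_smul, hw _ (fun a ha => m.2 a (by simpa using ha)), hb]
    simp only
    rw [hcn _ m.2]
  have hdis := hli.disjoint_span_image (s := {m | ∀ a ∈ m.1, S0 a}) (t := {m | ¬ ∀ a ∈ m.1, S0 a})
    (by
      rw [Set.disjoint_left]; intro m h h'; exact h' h)
  have h5 : ι t ∈ Submodule.span ℂ (b '' {m | ∀ a ∈ m.1, S0 a}) := by
    rw [h4, Finsupp.linearCombination_apply]
    refine Submodule.sum_mem _ fun m _ => Submodule.smul_mem _ _ (Submodule.subset_span ⟨m.1, m.2, rfl⟩)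
  have h6 : ι t = 0 := by
    have := Submodule.disjoint_def.1 hdis _ h5 (IL_le_BX hz ht)
    exact this
  have hli' : LinearIndependent ℂ fun m : G0 => b m.1 := hli.comp _ Subtype.val_injective
  rw [h6] at h4
  have h7 := linearIndependent_iff.1 hli' f h4.symm
  rw [← hf, h7]; simp

end Inj

/-! ## The abstract main theorem -/
section Main
variable {N l : ℕ} {R : Type*} [Ring R] [Algebra ℂ R] {z : Bool → Fin N × Fin l → Fin N × Fin l → R}
variable {T : Type*} [Ring T] [Algebra ℂ T]

/-- Letters in `T`. -/
def yTT (X : Bool → ℕ → Fin N → Fin N → T) (u : XX N l) : T :=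
  (if u.1 then (-1 : ℂ) ^ u.2.1.2.val else 1) • X u.1 u.2.1.2.val u.2.1.1 u.2.2.1

theorem sgn_sq (s : Bool) (a : ℕ) : (if s then (-1 : ℂ) ^ a else 1) * (if s then (-1 : ℂ) ^ a else 1) = 1 := by
  cases s
  · simp
  · simp [← mul_pow]

theorem X_mem_Z (X : Bool → ℕ → Fin N → Fin N → T) (s : Bool) (a : Fin l) (p q : Fin N) :
    X s a.val p q ∈ Zw (yTT (l := l) X) S0 := by
  have h : yTT X (s, (p, a), (q, a)) ∈ Zw (yTT (l := l) X) S0 := mem_Zw (c := (s, (p, a), (q, a))) rfl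
  have := Submodule.smul_mem _ (if s then (-1 : ℂ) ^ a.val else 1) h
  simp only [yTT] at this
  rwa [smul_smul, sgn_sq, one_smul] at this

theorem clo_yTT (X : Bool → ℕ → Fin N → Fin N → T)
    (hXc : ∀ s t (a b : Fin l) p q r m, X s a.val p q * X t b.val r m - sg s t • (X t b.val r m * X s a.val p q) =
      (dl a b * dl q r) • X (xor s t) a.val p m - (sg s t * dl a b * dl m p) • X (xor s t) a.val r q) :
    Clo Prod.fst (yTT (l := l) X) S0 := by
  rintro ⟨s, ⟨p, a⟩, ⟨q, a'⟩⟩ ⟨t, ⟨r, b⟩, ⟨m, b'⟩⟩ ha hb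
  have e := hXc s t a b p q r m
  have e2 : yTT X (s, (p, a), (q, a')) * yTT X (t, (r, b), (m, b')) -
      sg s t • (yTT X (t, (r, b), (m, b')) * yTT X (s, (p, a), (q, a'))) =
      ((if s then (-1 : ℂ) ^ a.val else 1) * (if t then (-1 : ℂ) ^ b.val else 1)) •
       (X s a.val p q * X t b.val r m - sg s t • (X t b.val r m * X s a.val p q)) := by
    simp only [yTT, smul_mul_assoc, mul_smul_comm, smul_sub, smul_smul]
    congr 2 <;> ring_nf
  show _ - sg s t • _ ∈ _
  rw [e2, e]
  refine Submodule.smul_mem _ _ (Submodule.sub_mem _ (Submodule.smul_mem _ _ ?_) (Submodule.smul_mem _ _ ?_))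
  · exact X_mem_Z X _ _ _ _
  · exact X_mem_Z X _ _ _ _

theorem abstract_main (hl : 0 < l) (hz : IsQ z)
    (ρ : R →ₐ[ℂ] Module.End ℂ (Fk (XX N l))) (hρ : ∀ s i j, ρ (z s i j) = Lop crE anE s i j)
    (ι : T →ₐ[ℂ] R)
    (X : Bool → ℕ → Fin N → Fin N → T)
    (hX : ∀ s (a : Fin l) p q, ι (X s a.val p q) =
      (if s then (-1 : ℂ) ^ a.val else 1) • z s (p, a) (q, a))
    (hXc : ∀ s t (a b : Fin l) p q r m, X s a.val p q * X t b.val r m - sg s t • (X t b.val r m * X s a.val p q) =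
      (dl a b * dl q r) • X (xor s t) a.val p m - (sg s t * dl a b * dl m p) • X (xor s t) a.val r q)
    (hXi : ∀ C : Submodule ℂ T, 1 ∈ C → (∀ s (a : Fin l) p q, ∀ x ∈ C, X s a.val p q * x ∈ C) → ∀ x, x ∈ C)
    (Gr : Subalgebra ℂ T)
    (hG1 : ∀ ε : ℂ, (ε = 1 ∨ ε = -1) → ∀ q r p, QQ X ε 0 l (dseq q) r p ∈ Gr)
    (hG2 : ∀ S : Subalgebra ℂ T,
      (∀ ε : ℂ, (ε = 1 ∨ ε = -1) → ∀ q r p, QQ X ε 0 l (dseq q) r p ∈ S) → Gr ≤ S) (t : T) :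
    (∃ y, Rl z ι y t) ↔ t ∈ Gr := by
  obtain ⟨a, rfl⟩ : ∃ a, l = a + 1 := ⟨l - 1, by omega⟩
  have hε : ∀ ε : ℂ, (ε = 1 ∨ ε = -1) → ε * ε = 1 := by rintro ε (rfl | rfl) <;> norm_num
  have hι : ∀ t, ι t ∈ PP z := by
    refine hXi ((Subalgebra.toSubmodule (PP z)).comap ι.toLinearMap) ?_ ?_
    · show ι 1 ∈ PP z
      rw [map_one]; exact one_mem _
    · intro s b p q x hx
      show ι (_ * x) ∈ PP z
      rw [map_mul, hX]
      exact (PP z).mul_mem ((PP z).smul_mem (PP_gen (s := s) (i := (p, b)) (j := (q, b)) le_rfl) _) hx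
  let la : Fin (a + 1) := Fin.last a
  let o : Fin (a + 1) := 0
  have hSS : ∀ ε : ℂ, (ε = 1 ∨ ε = -1) → ∀ m p q, Rl z ι (SS z ε m (p, la) (q, o)) (tau X ε q m a p) := by
    intro ε he m p q
    exact ⟨Wh_SS hz ε (hε ε he) m _ _ (by simp [la]) (by simp [o]),
      tau_spec hz hι X hX ε (hε ε he) q o rfl m p la⟩
  constructor
  · rintro ⟨y, hW, hy⟩
    obtain ⟨g, hg, hyg⟩ := Wh_gen hz y hW
    have hvv : ∀ ε : ℂ, (ε = 1 ∨ ε = -1) → ∀ q d p, vv X ε q a d p ∈ Gr := fun ε he q d p =>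
      vv_mem X a Gr hG1 ε he q d p
    have : ∃ t' ∈ Gr, Rl z ι g t' := by
      clear hyg
      unfold AA at hg
      induction hg using Algebra.adjoin_induction with
      | mem x hx =>
        obtain ⟨ε, m, p, q, a', o', he, ha', ho', rfl⟩ := hx
        have e1 : a' = la := Fin.ext (by simp [la]; omega)
        have e2 : o' = o := Fin.ext (by simp [o, ho'])
        subst e1 e2
        refine ⟨_, ?_, hSS ε he m p q⟩
        rcases lt_or_ge m a with h | h
        · rw [tau_low]
          · exact Gr.zero_mem
          · exact h
        · have := hvv ε he q (m - a) p
          rwa [vv, Nat.sub_add_cancel h] at this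
      | algebraMap r =>
        refine ⟨r • 1, Gr.smul_mem Gr.one_mem _, ?_⟩
        rw [Algebra.algebraMap_eq_smul_one]
        exact Rl.one.smul r
      | add x y _ _ hx hy =>
        obtain ⟨t1, h1, h1'⟩ := hx
        obtain ⟨t2, h2, h2'⟩ := hy
        exact ⟨_, Gr.add_mem h1 h2, h1'.add h2'⟩
      | mul x y _ _ hx hy =>
        obtain ⟨t1, h1, h1'⟩ := hx
        obtain ⟨t2, h2, h2'⟩ := hy
        exact ⟨_, Gr.mul_mem h1 h2, h1'.mul hz hι h2'⟩
    obtain ⟨t', ht', -, hgt⟩ := this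
    have h3 : ι (t - t') ∈ IL z := by
      have := (IL z).sub_mem ((IL z).add_mem (IL_I hyg) hgt) hy
      have e : y - g + (g - ι t') - (y - ι t) = ι (t - t') := by rw [map_sub]; abel
      rwa [e] at this
    have h4 := iota_inj hz ρ hρ ι (yTT X) ?_ (clo_yTT X hXc) ?_ (t - t') h3
    · rw [sub_eq_zero.1 h4]; exact ht'
    · rintro ⟨s, ⟨p, b⟩, ⟨q, c⟩⟩ hu
      have hbc : b = c := hu
      subst hbc
      simp only [yTT, map_smul, hX, smul_smul, sgn_sq, one_smul]
    · intro C h1 h2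
      refine hXi C h1 fun s b p q x hx => ?_
      have := C.smul_mem (if s then (-1 : ℂ) ^ b.val else 1) (h2 (s, (p, b), (q, b)) rfl x hx)
      simp only [yTT] at this
      rwa [smul_mul_assoc, smul_smul, sgn_sq, one_smul] at this
  · intro ht
    let S : Subalgebra ℂ T :=
      { carrier := {t | ∃ y, Rl z ι y t}
        mul_mem' := by
          rintro x y ⟨u, hu⟩ ⟨v, hv⟩; exact ⟨_, hu.mul hz hι hv⟩
        add_mem' := by
          rintro x y ⟨u, hu⟩ ⟨v, hv⟩; exact ⟨_, hu.add hv⟩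
        algebraMap_mem' := by
          intro r
          refine ⟨r • 1, ?_⟩
          rw [Algebra.algebraMap_eq_smul_one]
          exact Rl.one.smul r }
    refine hG2 S ?_ ht
    intro ε he q r p
    exact QQ_mem X a S (fun ε he q r p => ⟨_, hSS ε he (r + a) p q⟩) r ε he q p

end Main

/-! ## Instantiation -/

theorem superc {A : Type*} [Ring A] [Algebra ℂ A] (x y u v : Bool → A) (c d : ℂ)
    (h1 : x false * y false - y false * x false = c • u false - d • v false)
    (h2 : x false * y true - y true * x false = c • u true - d • v true)
    (h3 : y false * x true - x true * y false = d • v true - c • u true)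
    (h4 : x true * y true + y true * x true = c • u false + d • v false) (s t : Bool) :
    x s * y t - sg s t • (y t * x s) = c • u (xor s t) - (sg s t * d) • v (xor s t) := by
  cases s <;> cases t
  · simpa [sg] using h1
  · simpa [sg] using h2
  · simp only [sg, Bool.and_false, Bool.false_eq_true, if_false, one_smul, one_mul, Bool.xor_false]
    rw [← neg_sub, h3, neg_sub]
  · simpa [sg] using h4

theorem superc_rev {A : Type*} [Ring A] [Algebra ℂ A] (x y u v : Bool → A) (c d : ℂ)
    (h : ∀ s t, x s * y t - sg s t • (y t * x s) = c • u (xor s t) - (sg s t * d) • v (xor s t)) :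
    (x false * y false - y false * x false = c • u false - d • v false) ∧
    (x false * y true - y true * x false = c • u true - d • v true) ∧
    (x true * y true + y true * x true = c • u false + d • v false) := by
  refine ⟨?_, ?_, ?_⟩
  · simpa [sg] using h false false
  · simpa [sg] using h false true
  · simpa [sg] using h true true

theorem Ue_comm {n : ℕ} (i j k m : Fin n) :
    Ue i j * Ue k m - Ue k m * Ue i j = kd j k • Ue i m - kd m i • Ue k j := by
  have := RingQuot.mkAlgHom_rel ℂ (QRel.ee i j k m)
  simpa [Ue, Uf] using this

theorem Uef_comm {n : ℕ} (i j k m : Fin n) :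
    Ue i j * Uf k m - Uf k m * Ue i j = kd j k • Uf i m - kd m i • Uf k j := by
  have := RingQuot.mkAlgHom_rel ℂ (QRel.ef i j k m)
  simpa [Ue, Uf] using this

theorem Uff_comm {n : ℕ} (i j k m : Fin n) :
    Uf i j * Uf k m + Uf k m * Uf i j = kd j k • Ue i m + kd m i • Ue k j := by
  have := RingQuot.mkAlgHom_rel ℂ (QRel.ff i j k m)
  simpa [Ue, Uf] using this

theorem xT_commF {m l : ℕ} (i i' : Fin l) (p q r s : Fin m) :
    xT i p q * xT i' r s - xT i' r s * xT i p q =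
      (kdl i i' * kd q r) • xT i p s - (kdl i i' * kd s p) • xT i' r q := by
  have := RingQuot.mkAlgHom_rel ℂ (TRel.xx i i' p q r s)
  simpa only [xT, xiT, map_sub, map_mul, map_smul, map_add] using this

theorem xxiT_commF {m l : ℕ} (i i' : Fin l) (p q r s : Fin m) :
    xT i p q * xiT i' r s - xiT i' r s * xT i p q =
      (kdl i i' * kd q r) • xiT i p s - (kdl i i' * kd s p) • xiT i' r q := by
  have := RingQuot.mkAlgHom_rel ℂ (TRel.xxi i i' p q r s)
  simpa only [xT, xiT, map_sub, map_mul, map_smul, map_add] using this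

theorem xixiT_commF {m l : ℕ} (i i' : Fin l) (p q r s : Fin m) :
    xiT i p q * xiT i' r s + xiT i' r s * xiT i p q =
      (kdl i i' * kd q r) • xT i p s + (kdl i i' * kd s p) • xT i' r q := by
  have := RingQuot.mkAlgHom_rel ℂ (TRel.xixi i i' p q r s)
  simpa only [xT, xiT, map_sub, map_mul, map_smul, map_add] using this

/-- Uniform generator: `ez false = Ue`, `ez true = Uf`. -/
def ez {n : ℕ} (i j : Fin n) (s : Bool) : UQ n := if s then Uf i j else Ue i j

theorem ez_comm {n : ℕ} (s t : Bool) (i j k m : Fin n) :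
    ez i j s * ez k m t - sg s t • (ez k m t * ez i j s) =
      kd j k • ez i m (xor s t) - (sg s t * kd m i) • ez k j (xor s t) :=
  superc (ez i j) (ez k m) (ez i m) (ez k j) _ _ (Ue_comm i j k m) (Uef_comm i j k m)
    (Uef_comm k m i j) (Uff_comm i j k m) s t

theorem kdl_smul {A : Type*} [Ring A] [Algebra ℂ A] {l : ℕ} (i i' : Fin l) (c : ℂ) (f : Fin l → A) :
    (kdl i i' * c) • f i' = (kdl i i' * c) • f i := by
  by_cases h : i = i'
  · rw [h]
  · simp [kdl, h]

theorem xx_comm {N l : ℕ} (s t : Bool) (a b : Fin l) (p q r m : Fin N) :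
    xx s a p q * xx t b r m - sg s t • (xx t b r m * xx s a p q) =
      (dl a b * dl q r) • xx (xor s t) a p m - (sg s t * dl a b * dl m p) • xx (xor s t) a r q := by
  have key : ∀ v : Bool, (kdl a b * kd m p) • xx v b r q = (kdl a b * kd m p) • xx v a r q :=
    fun v => kdl_smul a b _ (fun a => xx v a r q)
  have h := superc (fun s => xx s a p q) (fun t => xx t b r m) (fun v => xx v a p m) (fun v => xx v b r q)
    (kdl a b * kd q r) (kdl a b * kd m p) (xT_commF a b p q r m) (xxiT_commF a b p q r m)
    (by
      have := xxiT_commF b a r m p q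
      have e1 : kdl b a = kdl a b := by simp [kdl, eq_comm]
      rw [e1] at this
      exact this) (xixiT_commF a b p q r m) s t
  have e2 : dl a b = kdl a b := by unfold dl kdl; congr
  have e3 : dl q r = kd q r := by unfold dl kd; congr
  have e4 : dl m p = kd m p := by unfold dl kd; congr
  rw [e2, e3, e4, mul_assoc, h]
  congr 1
  rw [mul_smul, mul_smul (sg s t), key]

theorem UQ_induct {n : ℕ} (C : Submodule ℂ (UQ n)) (h1 : (1 : UQ n) ∈ C)
    (hm : ∀ s i j, ∀ x ∈ C, ez i j s * x ∈ C) (x : UQ n) : x ∈ C := by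
  obtain ⟨a, rfl⟩ := RingQuot.mkAlgHom_surjective ℂ (QRel n) x
  suffices H : ∀ x ∈ C, RingQuot.mkAlgHom ℂ (QRel n) a * x ∈ C by simpa using H 1 h1
  induction a using FreeAlgebra.induction with
  | grade0 r => intro x hx; simpa [Algebra.algebraMap_eq_smul_one] using C.smul_mem r hx
  | grade1 g =>
    intro x hx
    cases g with
    | E i j => exact hm false i j x hx
    | F i j => exact hm true i j x hx
  | mul a b ha hb => intro x hx; rw [map_mul, mul_assoc]; exact ha _ (hb _ hx)
  | add a b ha hb => intro x hx; rw [map_add, add_mul]; exact C.add_mem (ha _ hx) (hb _ hx)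

theorem TQ_induct {m l : ℕ} (C : Submodule ℂ (TQ m l)) (h1 : (1 : TQ m l) ∈ C)
    (hm : ∀ s (a : Fin l) p q, ∀ x ∈ C, xx s a p q * x ∈ C) (x : TQ m l) : x ∈ C := by
  obtain ⟨a, rfl⟩ := RingQuot.mkAlgHom_surjective ℂ (TRel m l) x
  suffices H : ∀ x ∈ C, RingQuot.mkAlgHom ℂ (TRel m l) a * x ∈ C by simpa using H 1 h1
  induction a using FreeAlgebra.induction with
  | grade0 r => intro x hx; simpa [Algebra.algebraMap_eq_smul_one] using C.smul_mem r hx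
  | grade1 g =>
    intro x hx
    cases g with
    | X a i j => exact hm false a i j x hx
    | Xi a i j => exact hm true a i j x hx
  | mul a b ha hb => intro x hx; rw [map_mul, mul_assoc]; exact ha _ (hb _ hx)
  | add a b ha hb => intro x hx; rw [map_add, add_mul]; exact C.add_mem (ha _ hx) (hb _ hx)

theorem bidx_bij {n l : ℕ} (hl : 0 < l) (h : l ∣ n) :
    Function.Bijective (fun x : Fin (n / l) × Fin l => bidx h x.1 x.2) := by
  constructor
  · rintro ⟨p, a⟩ ⟨q, b⟩ hh
    have hv : l * p.val + a.val = l * q.val + b.val := congrArg Fin.val hh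
    have h1 : p.val = q.val := by
      have e1 : (l * p.val + a.val) / l = p.val := by
        rw [Nat.mul_add_div hl, Nat.div_eq_of_lt a.isLt, add_zero]
      have e2 : (l * q.val + b.val) / l = q.val := by
        rw [Nat.mul_add_div hl, Nat.div_eq_of_lt b.isLt, add_zero]
      rw [← e1, ← e2, hv]
    have h2 : a.val = b.val := by rw [h1] at hv; omega
    rw [Fin.ext h1, Fin.ext h2]
  · intro x
    have hx : x.val / l < n / l := by
      apply Nat.div_lt_div_of_lt_of_dvd h x.isLt
    refine ⟨(⟨x.val / l, hx⟩, ⟨x.val % l, Nat.mod_lt _ hl⟩), ?_⟩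
    apply Fin.ext
    exact Nat.div_add_mod x.val l

/-- The index bijection. -/
def bE {n l : ℕ} (hl : 0 < l) (h : l ∣ n) : Fin (n / l) × Fin l ≃ Fin n :=
  Equiv.ofBijective _ (bidx_bij hl h)

/-- Generators with block indices. -/
def zU {n l : ℕ} (h : l ∣ n) (s : Bool) (i j : Fin (n / l) × Fin l) : UQ n :=
  ez (bidx h i.1 i.2) (bidx h j.1 j.2) s

theorem kd_bidx {n l : ℕ} (hl : 0 < l) (h : l ∣ n) (i j : Fin (n / l) × Fin l) :
    kd (bidx h i.1 i.2) (bidx h j.1 j.2) = dl i j := by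
  have : bidx h i.1 i.2 = bidx h j.1 j.2 ↔ i = j := (bidx_bij hl h).1.eq_iff
  unfold kd dl
  by_cases hij : i = j
  · rw [if_pos (this.2 hij), if_pos hij]
  · rw [if_neg (fun e => hij (this.1 e)), if_neg hij]

theorem isQ_zU {n l : ℕ} (hl : 0 < l) (h : l ∣ n) : IsQ (zU h) where
  comm s t i j k m := by
    rw [← kd_bidx hl h, ← kd_bidx hl h]
    exact ez_comm s t _ _ _ _
  ind C h1 hC := UQ_induct C h1 (by
    intro s i j x hx
    obtain ⟨i, rfl⟩ := (bidx_bij hl h).2 i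
    obtain ⟨j, rfl⟩ := (bidx_bij hl h).2 j
    exact hC s i j x hx)

/-- Images of the generators in the symbol representation. -/
def rhoGen {n : ℕ} {J : Type} [Fintype J] (e : J ≃ Fin n) : QGen n → Module.End ℂ (Fk (Bool × J × J))
  | QGen.E i j => Lop crE anE false (e.symm i) (e.symm j)
  | QGen.F i j => Lop crE anE true (e.symm i) (e.symm j)

theorem dl_symm' {n : ℕ} {J : Type} (e : J ≃ Fin n) (i j : Fin n) : dl (e.symm i) (e.symm j) = kd i j := by
  simp [dl, kd]

theorem rho_rel {n : ℕ} {J : Type} [Fintype J] (e : J ≃ Fin n) ⦃x y : FreeAlgebra ℂ (QGen n)⦄ (hr : QRel n x y) :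
    FreeAlgebra.lift ℂ (rhoGen e) x = FreeAlgebra.lift ℂ (rhoGen e) y := by
  have key : ∀ i j k m : Fin n, _ := fun i j k m =>
    superc_rev (fun s => Lop crE anE s (e.symm i) (e.symm j)) (fun s => Lop crE anE s (e.symm k) (e.symm m))
      (fun s => Lop crE anE s (e.symm i) (e.symm m)) (fun s => Lop crE anE s (e.symm k) (e.symm j))
      (kd j k) (kd m i) (fun s t => by
        rw [← dl_symm' e, ← dl_symm' e]; exact L_L ccrE s t _ _ _ _)
  cases hr with
  | ee i j k m =>
    simp only [map_sub, map_mul, map_smul, FreeAlgebra.lift_ι_apply, rhoGen]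
    exact (key i j k m).1
  | ef i j k m =>
    simp only [map_sub, map_mul, map_smul, FreeAlgebra.lift_ι_apply, rhoGen]
    exact (key i j k m).2.1
  | ff i j k m =>
    simp only [map_add, map_mul, map_smul, FreeAlgebra.lift_ι_apply, rhoGen]
    exact (key i j k m).2.2

/-- The symbol representation. -/
def rhoU {n : ℕ} {J : Type} [Fintype J] (e : J ≃ Fin n) : UQ n →ₐ[ℂ] Module.End ℂ (Fk (Bool × J × J)) :=
  RingQuot.liftAlgHom ℂ ⟨FreeAlgebra.lift ℂ (rhoGen e), fun {x y} hr => rho_rel e hr⟩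

theorem rhoU_ez {n : ℕ} {J : Type} [Fintype J] (e : J ≃ Fin n) (s : Bool) (i j : J) :
    rhoU e (ez (e i) (e j) s) = Lop crE anE s i j := by
  cases s
  · show rhoU e (Ue _ _) = _
    rw [Ue, rhoU, RingQuot.liftAlgHom_mkAlgHom_apply, FreeAlgebra.lift_ι_apply, rhoGen]
    simp
  · show rhoU e (Uf _ _) = _
    rw [Uf, rhoU, RingQuot.liftAlgHom_mkAlgHom_apply, FreeAlgebra.lift_ι_apply, rhoGen]
    simp

theorem PP_zU {n l : ℕ} (h : l ∣ n) : PP (zU h) = Algebra.adjoin ℂ (pSet n l h) := by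
  unfold PP
  congr 1
  ext x
  constructor
  · rintro ⟨s, ⟨p, a⟩, ⟨q, b⟩, hab, rfl⟩
    refine ⟨p, q, a, b, hab, ?_⟩
    cases s
    · exact Or.inl rfl
    · exact Or.inr rfl
  · rintro ⟨p, q, a, b, hab, rfl | rfl⟩
    · exact ⟨false, (p, a), (q, b), hab, rfl⟩
    · exact ⟨true, (p, a), (q, b), hab, rfl⟩

theorem LL_zU {n l : ℕ} (h : l ∣ n) : LL (zU h) = Lspan n l h := by
  unfold LL Lspan
  rw [PP_zU]
  congr 1
  ext x
  constructor
  · rintro ⟨u, hu, s, ⟨p, a⟩, ⟨q, b⟩, hab, rfl⟩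
    refine ⟨u, hu, _, ⟨p, q, a, b, hab, ?_⟩, rfl⟩
    cases s
    · exact Or.inl rfl
    · exact Or.inr rfl
  · rintro ⟨u, hu, _, ⟨p, q, a, b, hab, rfl | rfl⟩, rfl⟩
    · exact ⟨u, hu, false, (p, a), (q, b), hab, rfl⟩
    · exact ⟨u, hu, true, (p, a), (q, b), hab, rfl⟩

theorem zc_zU_false {n l : ℕ} (h : l ∣ n) (p q : Fin (n / l)) (a b : Fin l) :
    zc (zU h) false (p, a) (q, b) = Ue (bidx h p a) (bidx h q b) -
            algebraMap ℂ (UQ n) (if a.val = b.val + 1 ∧ p = q then 1 else 0) := by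
  rw [Algebra.algebraMap_eq_smul_one, zc]
  have : chi false (p, a) (q, b) = (if a.val = b.val + 1 ∧ p = q then 1 else 0 : ℂ) := by
    simp [chi, and_comm]
  rw [this]; rfl

theorem zc_true' {N l : ℕ} {R : Type*} [Ring R] [Algebra ℂ R]
    (z : Bool → Fin N × Fin l → Fin N × Fin l → R) (i j) : zc z true i j = z true i j := by
  simp [zc, chi_true]

theorem zc_zU_true {n l : ℕ} (h : l ∣ n) (p q : Fin (n / l)) (a b : Fin l) :
    zc (zU h) true (p, a) (q, b) = Uf (bidx h p a) (bidx h q b) := zc_true' _ _ _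

theorem II_zU {n l : ℕ} (h : l ∣ n) : II (zU h) = Ichi n l h := by
  unfold II Ichi
  congr 1
  ext x
  constructor
  · rintro ⟨s, ⟨p, a⟩, ⟨q, b⟩, hab, rfl⟩
    refine ⟨p, q, a, b, hab, ?_⟩
    cases s
    · exact Or.inl (zc_zU_false h _ _ _ _)
    · exact Or.inr (zc_zU_true h _ _ _ _)
  · rintro ⟨p, q, a, b, hab, rfl | rfl⟩
    · exact ⟨false, (p, a), (q, b), hab, (zc_zU_false h _ _ _ _).symm⟩
    · exact ⟨true, (p, a), (q, b), hab, (zc_zU_true h _ _ _ _).symm⟩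

theorem Wh_iff {N l : ℕ} {R : Type*} [Ring R] [Algebra ℂ R]
    (z : Bool → Fin N × Fin l → Fin N × Fin l → R) (σ : R → R) (y : R) :
    Wh z y ↔ ∀ (p q : Fin N) (a b : Fin l), b.val < a.val →
      (z false (p, a) (q, b) * y - y * z false (p, a) (q, b) ∈ II z) ∧
      (z true (p, a) (q, b) * y - σ y * z true (p, a) (q, b) ∈ II z) := by
  have e1 : ∀ i j, z false i j * y - y * z false i j = zc z false i j * y - y * zc z false i j := by
    intro i j
    simp only [zc, sub_mul, mul_sub, smul_mul_assoc, mul_smul_comm, one_mul, mul_one]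
    abel
  constructor
  · intro hW p q a b hab
    refine ⟨?_, ?_⟩
    · rw [e1]
      exact (II z).sub_mem (hW false _ _ hab) (II_mul_left _ (zc_mem hab))
    · rw [← zc_true' z]
      exact (II z).sub_mem (hW true _ _ hab) (II_mul_left _ (zc_mem hab))
  · rintro hW s ⟨p, a⟩ ⟨q, b⟩ hab
    obtain ⟨h1, h2⟩ := hW p q a b hab
    cases s
    · rw [e1] at h1
      exact ((II z).sub_mem_iff_left (II_mul_left _ (zc_mem hab))).1 h1
    · rw [← zc_true' z] at h2
      exact ((II z).sub_mem_iff_left (II_mul_left _ (zc_mem hab))).1 h2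

theorem Wcond_iff {n l : ℕ} (h : l ∣ n) (σ : UQ n →ₐ[ℂ] UQ n) (y : UQ n) :
    Wcond h σ y ↔ Wh (zU h) y := by
  rw [Wh_iff (zU h) σ y, II_zU]
  exact Iff.rfl

theorem XT_val {N l : ℕ} (s : Bool) (a : Fin l) (p q : Fin N) : XT N l s a.val p q = xx s a p q := by
  rw [XT, dif_pos a.isLt]


/-- Let `l ∣ n` and let `χ` correspond to the even nilpotent element of
`Q(n)` with all Jordan blocks of size `l`.  Under the Harish-Chandra embedding `ϑ` and the
identification `U(g₀) ≅ U(Q(n/l))^{⊗l}`, the finite W-algebra `W_χ` maps isomorphically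
onto the image of `Y(Q(n/l))` under `ev^{⊗l}∘Δ_l`:  `ϑ(W_χ)` equals that image.
(`ϑ` is encoded as in Statement 2; the family `G j = ev^{⊗j}∘Δ_j` is characterized on
the generators as in Statement 15.) -/
theorem statement18 (n l : ℕ) (hn : 0 < n) (hl : 0 < l) (h : l ∣ n)
    (σ : UQ n →ₐ[ℂ] UQ n)
    (hσe : ∀ i j : Fin n, σ (Ue i j) = Ue i j)
    (hσf : ∀ i j : Fin n, σ (Uf i j) = -Uf i j)
    (ι₀ : TQ (n / l) l →ₐ[ℂ] UQ n)
    (hι₀x : ∀ (i : Fin l) (a b : Fin (n / l)),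
      ι₀ (xT i a b) = Ue (bidx h a i) (bidx h b i))
    (hι₀xi : ∀ (i : Fin l) (a b : Fin (n / l)),
      ι₀ (xiT i a b) = ((-1 : ℂ) ^ i.val) • Uf (bidx h a i) (bidx h b i))
    (emb : ∀ k : ℕ, Fin k → (UQ (n / l) →ₐ[ℂ] TQ (n / l) k))
    (hembx : ∀ (k : ℕ) (a : Fin k) (i j : Fin (n / l)), emb k a (Ue i j) = xT a i j)
    (hembxi : ∀ (k : ℕ) (a : Fin k) (i j : Fin (n / l)), emb k a (Uf i j) = xiT a i j)
    (ishUp : ∀ k : ℕ, TQ (n / l) k →ₐ[ℂ] TQ (n / l) (k + 1))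
    (hishx : ∀ (k : ℕ) (a : Fin k) (i j : Fin (n / l)),
      ishUp k (xT a i j) = xT a.succ i j)
    (hishxi : ∀ (k : ℕ) (a : Fin k) (i j : Fin (n / l)),
      ishUp k (xiT a i j) = xiT a.succ i j)
    (G : ∀ k : ℕ, YQ (n / l) →ₐ[ℂ] TQ (n / l) k)
    (hG1 : ∀ (s : ℕ) (i j : QIdx (n / l)), G 1 (TY s i j) = emb 1 0 (evval s i j))
    (hGstep : ∀ (k : ℕ), 1 ≤ k → ∀ (s : ℕ) (i j : QIdx (n / l)),
      G (k + 1) (TY s i j) =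
        ∑ t : Fin (s + 1), ∑ kk : QIdx (n / l),
          ((-1 : ℂ) ^ ((qpar i + qpar kk) * (qpar j + qpar kk))) •
            (ishUp k (G k (TY t.val i kk)) * emb (k + 1) 0 (evval (s - t.val) kk j))) :
    { t : TQ (n / l) l | ∃ y : UQ n, Wcond h σ y ∧
        y - ι₀ t ∈ (Ichi n l h).restrictScalars ℂ ⊔ Lspan n l h } =
      Set.range ⇑(G l) := by
  have hG := G_eq emb hembx hembxi ishUp hishx hishxi G hG1 hGstep l hl
  ext t
  have key := abstract_main hl (isQ_zU hl h) (rhoU (bE hl h)) (fun s i j => rhoU_ez (bE hl h) s i j) ι₀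
    (XT (n / l) l)
    (by
      intro s a p q
      rw [XT_val]
      cases s
      · exact (hι₀x a p q).trans (one_smul ℂ (Ue (bidx h p a) (bidx h q a))).symm
      · exact hι₀xi a p q)
    (by
      intro s t a b p q r m
      rw [XT_val, XT_val, XT_val, XT_val]
      exact xx_comm s t a b p q r m)
    (by
      intro C h1 hC
      refine TQ_induct C h1 fun s a p q x hx => ?_
      have := hC s a p q x hx
      rwa [XT_val] at this)
    (G l).range
    (by
      intro ε hε q r p
      have hε2 : ε * ε = 1 := by rcases hε with rfl | rfl <;> norm_num
      have := congrFun (congrFun (hG ε hε2 q) r) p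
      rw [← this]
      exact (G l).range.add_mem ⟨_, rfl⟩ ((G l).range.smul_mem ⟨_, rfl⟩ ε))
    (by
      rintro S hS _ ⟨y, rfl⟩
      exact G_range_le emb hembx hembxi ishUp hishx hishxi G hG1 hGstep l hl S hS y) t
  have e : (∃ y, Rl (zU h) ι₀ y t) ↔ ∃ y : UQ n, Wcond h σ y ∧
        y - ι₀ t ∈ (Ichi n l h).restrictScalars ℂ ⊔ Lspan n l h := by
    refine exists_congr fun y => ?_
    unfold Rl IL
    rw [Wcond_iff, II_zU, LL_zU]
  exact e.symm.trans key
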